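/- Let Y be a complex projective variety and suppose Y = Y_1 ∪ Y_2, where for i = 1, 2 the subset Y_i is a non-empty closed subvariety with Y_i ≠ Y. Then for each i = 1, 2 the singular homology with C-coefficients of Y_i is not isomorphic (in all degrees simultaneously) to that of Y. -/

import Mathlib

/-!
STATEMENT 4: Let `Y` be a complex projective variety and suppose `Y = Y₁ ∪ Y₂`,
where for `i = 1, 2` the subset `Yᵢ` is a non-empty closed subvariety with `Yᵢ ≠ Y`.
Then for each `i = 1, 2` the singular homology with `ℂ`-coefficients of `Yᵢ` is not
isomorphic (in all degrees simultaneously) to that of `Y`.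

A projective variety is modelled as an algebraic subset of complex projective space
(the common zero locus of a family of homogeneous polynomials); closed subvarieties
are again algebraic subsets.  Singular homology is with respect to the classical
(quotient) topology.
-/

open CategoryTheory MvPolynomial

/-- The singular chain complex of a topological space with `ℂ`-coefficients. -/
noncomputable def singularChainComplex (X : Type) [TopologicalSpace X] :
    ChainComplex (ModuleCat ℂ) ℕ :=
  (AlgebraicTopology.alternatingFaceMapComplex (ModuleCat ℂ)).obj
    (((CategoryTheory.SimplicialObject.whiskering _ _).obj (ModuleCat.free ℂ)).obj
      (TopCat.toSSet.obj (TopCat.of X)))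

/-- Singular homology of a topological space with `ℂ`-coefficients. -/
noncomputable def singularHomology (X : Type) [TopologicalSpace X] (n : ℕ) : ModuleCat ℂ :=
  (singularChainComplex X).homology n

/-- Complex projective space `ℙ^{N-1}`, with its classical (quotient) topology. -/
abbrev ProjSpace (N : ℕ) := Projectivization ℂ (Fin N → ℂ)

noncomputable instance (N : ℕ) : TopologicalSpace (ProjSpace N) :=
  inferInstanceAs (TopologicalSpace (Quotient _))

/-- A subset of complex projective space is an algebraic subset, i.e. a (complex)
projective variety, if it is the common zero locus of a family of homogeneous
polynomials. -/
def IsAlgebraicSubset {N : ℕ} (S : Set (ProjSpace N)) : Prop :=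
  ∃ P : Set (MvPolynomial (Fin N) ℂ),
    (∀ p ∈ P, ∃ d, p.IsHomogeneous d) ∧
    S = {x : ProjSpace N | ∀ p ∈ P, MvPolynomial.eval x.rep p = 0}


set_option linter.all false

namespace HV

/-! ### Linear chains -/

/-- Linear chains in a vector space: formal combinations of finite tuples. -/
abbrev LC (V : Type) := (Σ m : ℕ, Fin m → V) →₀ ℂ

section
variable {V W : Type}

/-- A basic tuple. -/
noncomputable def tup {m : ℕ} (f : Fin m → V) : LC V := Finsupp.single ⟨m, f⟩ 1

/-- Alternating boundary of one tuple. -/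
noncomputable def lbdf : (m : ℕ) → (Fin m → V) → LC V
  | 0, _ => 0
  | (m + 1), f => ∑ i : Fin (m+1), (-1 : ℂ) ^ (i : ℕ) • tup (fun j => f (Fin.succAbove i j))

/-- Extend a function on tuples linearly. -/
noncomputable def lext {M : Type} [AddCommGroup M] [Module ℂ M] (g : (m : ℕ) → (Fin m → V) → M) :
    LC V →ₗ[ℂ] M := Finsupp.linearCombination ℂ (fun p : (Σ m : ℕ, Fin m → V) => g p.1 p.2)

@[simp] lemma lext_tup {M : Type} [AddCommGroup M] [Module ℂ M] (g : (m : ℕ) → (Fin m → V) → M)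
    {m : ℕ} (f : Fin m → V) : lext g (tup f) = g m f := by
  simp [lext, tup]

lemma lc_hom_ext {M : Type} [AddCommGroup M] [Module ℂ M] {A B : LC V →ₗ[ℂ] M}
    (h : ∀ m (f : Fin m → V), A (tup f) = B (tup f)) : A = B := by
  apply Finsupp.lhom_ext'
  rintro ⟨m, f⟩
  apply LinearMap.ext_ring
  exact h m f

/-- Alternating boundary. -/
noncomputable def lbd : LC V →ₗ[ℂ] LC V := lext lbdf

/-- Cone. -/
noncomputable def cone (b : V) : LC V →ₗ[ℂ] LC V :=
  lext (fun m f => tup (m := m + 1) (Fin.cons b f))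

lemma lbd_tup_zero (f : Fin 0 → V) : lbd (tup f) = 0 := by simp [lbd, lbdf]

lemma lbd_tup_succ {m : ℕ} (f : Fin (m+1) → V) : lbd (tup f) =
    ∑ i : Fin (m+1), (-1 : ℂ) ^ (i : ℕ) • tup (fun j => f (Fin.succAbove i j)) := by
  simp [lbd, lbdf]

@[simp] lemma cone_tup (b : V) {m : ℕ} (f : Fin m → V) :
    cone b (tup f) = tup (m := m + 1) (Fin.cons b f) := by simp [cone]

lemma lbd_cone (b : V) (c : LC V) : lbd (cone b c) = c - cone b (lbd c) := by
  have : lbd ∘ₗ cone b = LinearMap.id - cone b ∘ₗ lbd := by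
    apply lc_hom_ext
    intro m f
    simp only [LinearMap.comp_apply, LinearMap.sub_apply, LinearMap.id_apply, cone_tup]
    rw [lbd_tup_succ, Fin.sum_univ_succ]
    have h0 : (fun j => (Fin.cons b f : Fin (m+1) → V) (Fin.succAbove 0 j)) = f := by
      funext j; simp
    rw [h0]
    simp only [Fin.val_zero, pow_zero, one_smul, sub_eq_add_neg]
    congr 1
    cases m with
    | zero => simp [lbd_tup_zero]
    | succ m =>
      rw [lbd_tup_succ, map_sum, ← Finset.sum_neg_distrib]
      refine Finset.sum_congr rfl fun i _ => ?_
      rw [map_smul, cone_tup, Fin.val_succ, pow_succ, mul_neg_one, neg_smul]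
      congr 3
      funext j
      refine Fin.cases ?_ (fun j => ?_) j
      · simp
      · simp
  exact LinearMap.congr_fun this c

lemma tup_succ_eq_cone {m : ℕ} (f : Fin (m+1) → V) : tup f = cone (f 0) (tup (Fin.tail f)) := by
  simp

lemma lbd_lbd_tup : ∀ {m : ℕ} (f : Fin m → V), lbd (lbd (tup f)) = 0
  | 0, f => by simp [lbd_tup_zero]
  | m+1, f => by
    rw [tup_succ_eq_cone, lbd_cone, map_sub, lbd_cone, lbd_lbd_tup]; simp

lemma lbd_lbd (c : LC V) : lbd (lbd c) = 0 := by
  have : lbd ∘ₗ lbd = (0 : LC V →ₗ[ℂ] LC V) := lc_hom_ext fun m f => lbd_lbd_tup f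
  exact LinearMap.congr_fun this c

/-- Functoriality of linear chains. -/
noncomputable def lmap (A : V → W) : LC V →ₗ[ℂ] LC W := lext (fun m f => tup (m := m) (A ∘ f))

@[simp] lemma lmap_tup (A : V → W) {m : ℕ} (f : Fin m → V) : lmap A (tup f) = tup (A ∘ f) := by
  simp [lmap]

lemma lmap_cone (A : V → W) (b : V) (c : LC V) : lmap A (cone b c) = cone (A b) (lmap A c) := by
  have : lmap A ∘ₗ cone b = cone (A b) ∘ₗ lmap A := lc_hom_ext fun m f => by
    simp only [LinearMap.comp_apply, cone_tup, lmap_tup, Fin.comp_cons]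
  exact LinearMap.congr_fun this c

lemma lmap_lbd (A : V → W) (c : LC V) : lmap A (lbd c) = lbd (lmap A c) := by
  have : lmap A ∘ₗ lbd = lbd ∘ₗ lmap A := lc_hom_ext fun m f => by
    cases m with
    | zero => simp [lbd_tup_zero]
    | succ m =>
      simp only [LinearMap.comp_apply, lmap_tup, lbd_tup_succ, map_sum, map_smul]
      rfl
  exact LinearMap.congr_fun this c

/-- Linear chains of `m`-tuples in `s`. -/
noncomputable def LS (s : Set V) (m : ℕ) : Submodule ℂ (LC V) :=
  Submodule.span ℂ {c | ∃ f : Fin m → V, (∀ i, f i ∈ s) ∧ c = tup f}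

lemma tup_mem_LS {s : Set V} {m : ℕ} {f : Fin m → V} (h : ∀ i, f i ∈ s) : tup f ∈ LS s m :=
  Submodule.subset_span ⟨f, h, rfl⟩

lemma LS_map {s : Set V} {m : ℕ} {M : Type} [AddCommGroup M] [Module ℂ M] (A : LC V →ₗ[ℂ] M)
    (N : Submodule ℂ M) (h : ∀ f : Fin m → V, (∀ i, f i ∈ s) → A (tup f) ∈ N)
    {c : LC V} (hc : c ∈ LS s m) : A c ∈ N := by
  have : LS s m ≤ N.comap A := Submodule.span_le.2 (by
    rintro _ ⟨f, hf, rfl⟩; exact h f hf)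
  exact this hc

lemma cone_mem_LS {s : Set V} {m : ℕ} {b : V} (hb : b ∈ s) {c : LC V} (hc : c ∈ LS s m) :
    cone b c ∈ LS s (m+1) :=
  LS_map _ _ (fun f hf => by
    rw [cone_tup]
    exact tup_mem_LS (fun i => Fin.cases (by simpa using hb) (fun j => by simpa using hf j) i)) hc

lemma lbd_mem_LS {s : Set V} {m : ℕ} {c : LC V} (hc : c ∈ LS s (m+1)) : lbd c ∈ LS s m :=
  LS_map _ _ (fun f hf => by
    rw [lbd_tup_succ]
    exact Submodule.sum_mem _ fun i _ => Submodule.smul_mem _ _ (tup_mem_LS fun j => hf _)) hc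

lemma lmap_mem_LS {s : Set V} {t : Set W} {m : ℕ} {A : V → W} (hA : ∀ x ∈ s, A x ∈ t)
    {c : LC V} (hc : c ∈ LS s m) : lmap A c ∈ LS t m :=
  LS_map _ _ (fun f hf => by
    rw [lmap_tup]; exact tup_mem_LS fun i => hA _ (hf i)) hc

/-- Generic homotopy construction between two operators `A`, `B`, with apex function `b`. -/
noncomputable def Gf (A B : LC V →ₗ[ℂ] LC W) (b : (m : ℕ) → (Fin m → V) → W) :
    (m : ℕ) → (Fin m → V) → LC W
  | 0, _ => 0
  | (m + 1), f => cone (b (m+1) f) (A (tup f) - B (tup f) -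
      ∑ i : Fin (m+1), (-1 : ℂ) ^ (i : ℕ) • Gf A B b m (fun j => f (Fin.succAbove i j)))

/-- Generic homotopy, extended linearly. -/
noncomputable def GG (A B : LC V →ₗ[ℂ] LC W) (b : (m : ℕ) → (Fin m → V) → W) :
    LC V →ₗ[ℂ] LC W := lext (Gf A B b)

lemma GG_tup_zero (A B : LC V →ₗ[ℂ] LC W) (b) (f : Fin 0 → V) : GG A B b (tup f) = 0 := by
  simp [GG, Gf]

lemma GG_tup_succ (A B : LC V →ₗ[ℂ] LC W) (b) {m : ℕ} (f : Fin (m+1) → V) : GG A B b (tup f) =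
    cone (b (m+1) f) (A (tup f) - B (tup f) - GG A B b (lbd (tup f))) := by
  rw [lbd_tup_succ, map_sum]
  simp [GG, Gf]

lemma GG_homotopy (A B : LC V →ₗ[ℂ] LC W) (b) (hA : ∀ c, lbd (A c) = A (lbd c))
    (hB : ∀ c, lbd (B c) = B (lbd c)) (h0 : ∀ f : Fin 0 → V, A (tup f) = B (tup f)) (c : LC V) :
    lbd (GG A B b c) + GG A B b (lbd c) = A c - B c := by
  have key : ∀ (m : ℕ) (c : LC V), c ∈ LS Set.univ m →
      lbd (GG A B b c) + GG A B b (lbd c) = A c - B c := by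
    intro m
    induction m with
    | zero =>
      intro c hc
      have := LS_map (lbd ∘ₗ GG A B b + GG A B b ∘ₗ lbd - (A - B)) ⊥ (fun f _ => by
        simp [GG_tup_zero, lbd_tup_zero, h0]) hc
      simpa [sub_eq_zero] using this
    | succ m ih =>
      intro c hc
      have := LS_map (lbd ∘ₗ GG A B b + GG A B b ∘ₗ lbd - (A - B)) ⊥ (fun f _ => by
        have h1 := ih (lbd (tup f)) (lbd_mem_LS (tup_mem_LS (fun _ => Set.mem_univ _)))
        rw [lbd_lbd, map_zero, add_zero] at h1
        have : lbd (GG A B b (tup f)) + GG A B b (lbd (tup f)) - (A (tup f) - B (tup f)) = 0 := by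
          rw [GG_tup_succ, lbd_cone, map_sub, h1, map_sub lbd, hA, hB]
          simp
        simpa using this) hc
      simpa [sub_eq_zero] using this
  have : lbd ∘ₗ GG A B b + GG A B b ∘ₗ lbd = A - B := lc_hom_ext fun m f =>
    key m _ (tup_mem_LS (fun _ => Set.mem_univ _))
  exact LinearMap.congr_fun this c

lemma GG_mem_LS {A B : LC V →ₗ[ℂ] LC W} {b} {s : Set V} {t : Set W}
    (hA : ∀ m, ∀ c ∈ LS s m, A c ∈ LS t m) (hB : ∀ m, ∀ c ∈ LS s m, B c ∈ LS t m)
    (hb : ∀ m (f : Fin (m+1) → V), (∀ i, f i ∈ s) → b (m+1) f ∈ t) :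
    ∀ (m : ℕ) (c : LC V), c ∈ LS s m → GG A B b c ∈ LS t (m+1)
  | 0, c, hc => LS_map _ _ (fun f hf => by rw [GG_tup_zero]; exact Submodule.zero_mem _) hc
  | m+1, c, hc => LS_map _ _ (fun f hf => by
      rw [GG_tup_succ]
      have hf' := tup_mem_LS hf
      exact cone_mem_LS (hb m f hf) (Submodule.sub_mem _ (Submodule.sub_mem _ (hA _ _ hf')
        (hB _ _ hf')) (GG_mem_LS hA hB hb m _ (lbd_mem_LS hf')))) hc

lemma GG_nat {V' W' : Type} {A B : LC V →ₗ[ℂ] LC W} {A' B' : LC V' →ₗ[ℂ] LC W'} {b b'}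
    (φ : V → V') (ψ : W → W') (hA : ∀ c, lmap ψ (A c) = A' (lmap φ c))
    (hB : ∀ c, lmap ψ (B c) = B' (lmap φ c))
    (hb : ∀ m (f : Fin (m+1) → V), ψ (b (m+1) f) = b' (m+1) (φ ∘ f)) (c : LC V) :
    lmap ψ (GG A B b c) = GG A' B' b' (lmap φ c) := by
  have key : ∀ (m : ℕ) (c : LC V), c ∈ LS Set.univ m →
      lmap ψ (GG A B b c) = GG A' B' b' (lmap φ c) := by
    intro m
    induction m with
    | zero =>
      intro c hc
      have := LS_map (lmap ψ ∘ₗ GG A B b - GG A' B' b' ∘ₗ lmap φ) ⊥ (fun f _ => by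
        simp [GG_tup_zero]) hc
      simpa [sub_eq_zero] using this
    | succ m ih =>
      intro c hc
      have := LS_map (lmap ψ ∘ₗ GG A B b - GG A' B' b' ∘ₗ lmap φ) ⊥ (fun f _ => by
        have h1 := ih (lbd (tup f)) (lbd_mem_LS (tup_mem_LS (fun _ => Set.mem_univ _)))
        have : lmap ψ (GG A B b (tup f)) - GG A' B' b' (lmap φ (tup f)) = 0 := by
          rw [lmap_tup, GG_tup_succ, GG_tup_succ, lmap_cone, map_sub (lmap ψ), map_sub (lmap ψ), h1,
            hA, hB, lmap_lbd, lmap_tup, hb, sub_self]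
        simpa using this) hc
      simpa [sub_eq_zero] using this
  have : lmap ψ ∘ₗ GG A B b = GG A' B' b' ∘ₗ lmap φ := lc_hom_ext fun m f =>
    key m _ (tup_mem_LS (fun _ => Set.mem_univ _))
  exact LinearMap.congr_fun this c

end

section
variable {V W : Type} [AddCommGroup V] [Module ℝ V] [AddCommGroup W] [Module ℝ W]

/-- Barycentre. -/
noncomputable def bary (m : ℕ) (f : Fin m → V) : V := (m : ℝ)⁻¹ • ∑ i, f i

lemma bary_map (A : V →ₗ[ℝ] W) (m : ℕ) (f : Fin m → V) : A (bary m f) = bary m (A ∘ f) := by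
  simp [bary]

lemma bary_mem {s : Set V} (hs : Convex ℝ s) {m : ℕ} {f : Fin (m+1) → V} (hf : ∀ i, f i ∈ s) :
    bary (m+1) f ∈ s := by
  rw [bary, Finset.smul_sum]
  refine hs.sum_mem (fun i _ => by positivity) ?_ (fun i _ => hf i)
  simp
  field_simp

/-- Barycentric subdivision as: identity minus what is needed; here directly by recursion. -/
noncomputable def Sdf : (m : ℕ) → (Fin m → V) → LC V
  | 0, f => tup f
  | (m + 1), f => cone (bary (m+1) f)
      (∑ i : Fin (m+1), (-1 : ℂ) ^ (i : ℕ) • Sdf m (fun j => f (Fin.succAbove i j)))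

/-- Barycentric subdivision. -/
noncomputable def Sd : LC V →ₗ[ℂ] LC V := lext Sdf

lemma Sd_tup_zero (f : Fin 0 → V) : Sd (tup f) = tup f := by simp [Sd, Sdf]

lemma Sd_tup_succ {m : ℕ} (f : Fin (m+1) → V) :
    Sd (tup f) = cone (bary (m+1) f) (Sd (lbd (tup f))) := by
  rw [lbd_tup_succ, map_sum]
  simp [Sd, Sdf]

lemma LS_ext {V M : Type} [AddCommGroup M] [Module ℂ M] {A B : LC V →ₗ[ℂ] M} (m : ℕ)
    (h : ∀ f : Fin m → V, A (tup f) = B (tup f)) {c : LC V} (hc : c ∈ LS Set.univ m) :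
    A c = B c := by
  have := LS_map (A - B) ⊥ (fun f _ => by simp [h]) hc
  simpa [sub_eq_zero] using this

lemma lbd_Sd (c : LC V) : lbd (Sd c) = Sd (lbd c) := by
  have key : ∀ (m : ℕ) (c : LC V), c ∈ LS Set.univ m → (lbd ∘ₗ Sd) c = (Sd ∘ₗ lbd) c := by
    intro m
    induction m with
    | zero => exact fun c hc => LS_ext 0 (fun f => by simp [Sd_tup_zero, lbd_tup_zero]) hc
    | succ m ih => 
      exact fun c hc => LS_ext (m+1) (fun f => by
        have h1 := ih (lbd (tup f)) (lbd_mem_LS (tup_mem_LS (fun _ => Set.mem_univ _)))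
        simp only [LinearMap.comp_apply, lbd_lbd, map_zero] at h1 ⊢
        rw [Sd_tup_succ, lbd_cone, h1]; simp) hc
  have : lbd ∘ₗ Sd = Sd ∘ₗ lbd := lc_hom_ext (V := V) fun m f =>
    key m _ (tup_mem_LS (fun _ => Set.mem_univ _))
  exact LinearMap.congr_fun this c

lemma Sd_nat (A : V →ₗ[ℝ] W) (c : LC V) : lmap A (Sd c) = Sd (lmap A c) := by
  have key : ∀ (m : ℕ) (c : LC V), c ∈ LS Set.univ m →
      (lmap A ∘ₗ Sd) c = (Sd ∘ₗ lmap A) c := by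
    intro m
    induction m with
    | zero => exact fun c hc => LS_ext 0 (fun f => by simp [Sd_tup_zero]) hc
    | succ m ih => 
      exact fun c hc => LS_ext (m+1) (fun f => by
        have h1 := ih (lbd (tup f)) (lbd_mem_LS (tup_mem_LS (fun _ => Set.mem_univ _)))
        simp only [LinearMap.comp_apply] at h1 ⊢
        rw [Sd_tup_succ, lmap_cone, h1, lmap_tup, Sd_tup_succ, bary_map, lmap_lbd, lmap_tup]) hc
  have : lmap A ∘ₗ Sd = Sd ∘ₗ lmap A := lc_hom_ext (V := V) fun m f =>
    key m _ (tup_mem_LS (fun _ => Set.mem_univ _))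
  exact LinearMap.congr_fun this c

lemma Sd_mem_LS {s : Set V} (hs : Convex ℝ s) :
    ∀ (m : ℕ) (c : LC V), c ∈ LS s m → Sd c ∈ LS s m
  | 0, c, hc => LS_map _ _ (fun f hf => by rw [Sd_tup_zero]; exact tup_mem_LS hf) hc
  | m+1, c, hc => LS_map _ _ (fun f hf => by
      rw [Sd_tup_succ]
      exact cone_mem_LS (bary_mem hs hf) (Sd_mem_LS hs m _ (lbd_mem_LS (tup_mem_LS hf)))) hc

/-- Iterated subdivision. -/
noncomputable def SdK (k : ℕ) : LC V →ₗ[ℂ] LC V := Sd ^ k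

lemma SdK_succ (k : ℕ) (c : LC V) : SdK (k+1) c = Sd (SdK k c) := by
  simp [SdK, pow_succ']

@[simp] lemma SdK_zero (c : LC V) : SdK 0 c = c := by simp [SdK]

lemma lbd_SdK (k : ℕ) (c : LC V) : lbd (SdK k c) = SdK k (lbd c) := by
  induction k with
  | zero => simp
  | succ k ih => rw [SdK_succ, lbd_Sd, ih, SdK_succ]

lemma SdK_nat (k : ℕ) (A : V →ₗ[ℝ] W) (c : LC V) : lmap A (SdK k c) = SdK k (lmap A c) := by
  induction k with
  | zero => simp
  | succ k ih => rw [SdK_succ, Sd_nat, ih, SdK_succ]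

lemma SdK_mem_LS (k : ℕ) {s : Set V} (hs : Convex ℝ s) (m : ℕ) (c : LC V) (hc : c ∈ LS s m) :
    SdK k c ∈ LS s m := by
  induction k with
  | zero => simpa
  | succ k ih => rw [SdK_succ]; exact Sd_mem_LS hs m _ ih

lemma SdK_tup_zero (k : ℕ) (f : Fin 0 → V) : SdK k (tup f) = tup f := by
  induction k with
  | zero => simp
  | succ k ih => rw [SdK_succ, ih, Sd_tup_zero]

/-- Homotopy between the identity and iterated subdivision. -/
noncomputable def TK (k : ℕ) : LC V →ₗ[ℂ] LC V :=
  GG LinearMap.id (SdK k) (fun m f => bary m f)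

lemma TK_homotopy (k : ℕ) (c : LC V) : lbd (TK k c) + TK k (lbd c) = c - SdK k c := by
  have h0 : ∀ f : Fin 0 → V, (LinearMap.id : LC V →ₗ[ℂ] LC V) (tup f) = SdK k (tup f) := by
    intro f; rw [SdK_tup_zero, LinearMap.id_apply]
  exact GG_homotopy LinearMap.id (SdK k) (fun m f => bary m f) (fun _ => rfl) (lbd_SdK k) h0 c

lemma TK_mem_LS (k : ℕ) {s : Set V} (hs : Convex ℝ s) (m : ℕ) (c : LC V) (hc : c ∈ LS s m) :
    TK k c ∈ LS s (m+1) :=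
  GG_mem_LS (fun _ _ h => h) (SdK_mem_LS k hs) (fun _ _ h => bary_mem hs h) m c hc

lemma TK_nat (k : ℕ) (A : V →ₗ[ℝ] W) (c : LC V) : lmap A (TK k c) = TK k (lmap A c) :=
  GG_nat A A (fun _ => rfl) (SdK_nat k A) (fun m f => bary_map A (m+1) f) c

/-- Prism operator. -/
noncomputable def PR : LC V →ₗ[ℂ] LC (V × ℝ) :=
  GG (lmap fun x => (x, 1)) (lmap fun x => (x, 0)) (fun m f => (bary m f, 0))

lemma PR_homotopy (c : LC V) : lbd (PR c) + PR (lbd c) =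
    lmap (fun x => (x, (1:ℝ))) c - lmap (fun x => (x, (0:ℝ))) c :=
  GG_homotopy _ _ _ (fun c => (lmap_lbd _ c).symm) (fun c => (lmap_lbd _ c).symm)
    (fun f => by simp only [lmap_tup]; congr 1; exact Subsingleton.elim _ _) c

lemma PR_mem_LS {s : Set V} (hs : Convex ℝ s) (m : ℕ) (c : LC V) (hc : c ∈ LS s m) :
    PR c ∈ LS (s ×ˢ Set.Icc (0:ℝ) 1) (m+1) :=
  GG_mem_LS (fun _ _ h => lmap_mem_LS (fun x hx => Set.mk_mem_prod hx (by simp)) h)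
    (fun _ _ h => lmap_mem_LS (fun x hx => Set.mk_mem_prod hx (by simp)) h)
    (fun _ _ h => Set.mk_mem_prod (bary_mem hs h) (by simp)) m c hc

lemma lmap_lmap {V W U : Type} (A : V → W) (B : W → U) (c : LC V) :
    lmap B (lmap A c) = lmap (B ∘ A) c := by
  have : lmap B ∘ₗ lmap A = lmap (B ∘ A) := lc_hom_ext fun m f => by simp [Function.comp_assoc]
  exact LinearMap.congr_fun this c

lemma PR_nat (A : V →ₗ[ℝ] W) (c : LC V) : lmap (Prod.map A id) (PR c) = PR (lmap A c) :=
  GG_nat A _ (fun c => by simp only [lmap_lmap]; rfl) (fun c => by simp only [lmap_lmap]; rfl)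
    (fun m f => by simp [bary_map]) c

end

end HV


namespace HV

/-! ### Singular chains -/

/-- Singular simplices of all dimensions. -/
abbrev Sx (E : Type) [TopologicalSpace E] := Σ n : ℕ, C(stdSimplex ℝ (Fin (n+1)), E)

/-- Total singular chains. -/
abbrev Chn (E : Type) [TopologicalSpace E] := Sx E →₀ ℂ

section basic
variable {E E' E'' : Type} [TopologicalSpace E] [TopologicalSpace E'] [TopologicalSpace E'']

/-- basis chain. -/
noncomputable def sx {n : ℕ} (σ : C(stdSimplex ℝ (Fin (n+1)), E)) : Chn E :=
  Finsupp.single ⟨n, σ⟩ 1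

/-- Extend linearly. -/
noncomputable def cext {M : Type} [AddCommGroup M] [Module ℂ M]
    (g : (n : ℕ) → C(stdSimplex ℝ (Fin (n+1)), E) → M) : Chn E →ₗ[ℂ] M :=
  Finsupp.linearCombination ℂ (fun p : Sx E => g p.1 p.2)

@[simp] lemma cext_sx {M : Type} [AddCommGroup M] [Module ℂ M]
    (g : (n : ℕ) → C(stdSimplex ℝ (Fin (n+1)), E) → M) {n : ℕ}
    (σ : C(stdSimplex ℝ (Fin (n+1)), E)) : cext g (sx σ) = g n σ := by
  simp [cext, sx]

lemma chn_hom_ext {M : Type} [AddCommGroup M] [Module ℂ M] {A B : Chn E →ₗ[ℂ] M}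
    (h : ∀ n (σ : C(stdSimplex ℝ (Fin (n+1)), E)), A (sx σ) = B (sx σ)) : A = B := by
  apply Finsupp.lhom_ext'
  rintro ⟨m, f⟩
  apply LinearMap.ext_ring
  exact h m f

/-- Face map of standard simplices. -/
noncomputable def fmap {n : ℕ} (i : Fin (n+2)) :
    C(stdSimplex ℝ (Fin (n+1)), stdSimplex ℝ (Fin (n+2))) :=
  ⟨stdSimplex.map (Fin.succAbove i), stdSimplex.continuous_map _⟩

/-- Boundary of one simplex. -/
noncomputable def bdf : (n : ℕ) → C(stdSimplex ℝ (Fin (n+1)), E) → Chn E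
  | 0, _ => 0
  | (n + 1), σ => ∑ i : Fin (n+2), (-1 : ℂ) ^ (i : ℕ) • sx (σ.comp (fmap i))

/-- Boundary. -/
noncomputable def bd : Chn E →ₗ[ℂ] Chn E := cext bdf

lemma bd_sx_zero (σ : C(stdSimplex ℝ (Fin (0+1)), E)) : bd (sx σ) = 0 := by
  simp [bd, bdf]

lemma bd_sx_succ {n : ℕ} (σ : C(stdSimplex ℝ (Fin (n+1+1)), E)) : bd (sx σ) =
    ∑ i : Fin (n+2), (-1 : ℂ) ^ (i : ℕ) • sx (σ.comp (fmap i)) := by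
  simp [bd, bdf]

/-- Chains of degree `n` in a subset. -/
noncomputable def Ch (S : Set E) (n : ℕ) : Submodule ℂ (Chn E) :=
  Finsupp.supported ℂ ℂ {p : Sx E | p.1 = n ∧ ∀ x, p.2 x ∈ S}

/-- Chains of all degrees in a subset. -/
noncomputable def ChT (S : Set E) : Submodule ℂ (Chn E) :=
  Finsupp.supported ℂ ℂ {p : Sx E | ∀ x, p.2 x ∈ S}

lemma sx_mem_Ch {S : Set E} {n : ℕ} {σ : C(stdSimplex ℝ (Fin (n+1)), E)} (h : ∀ x, σ x ∈ S) :
    sx σ ∈ Ch S n := Finsupp.single_mem_supported _ _ ⟨rfl, h⟩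

lemma sx_mem_ChT {S : Set E} {n : ℕ} {σ : C(stdSimplex ℝ (Fin (n+1)), E)} (h : ∀ x, σ x ∈ S) :
    sx σ ∈ ChT S := Finsupp.single_mem_supported _ _ h

lemma Ch_map {S : Set E} {n : ℕ} {M : Type} [AddCommGroup M] [Module ℂ M] (A : Chn E →ₗ[ℂ] M)
    (N : Submodule ℂ M)
    (h : ∀ σ : C(stdSimplex ℝ (Fin (n+1)), E), (∀ x, σ x ∈ S) → A (sx σ) ∈ N)
    {c : Chn E} (hc : c ∈ Ch S n) : A c ∈ N := by
  rw [Ch, Finsupp.supported_eq_span_single] at hc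
  have : Submodule.span ℂ ((fun i ↦ Finsupp.single i (1:ℂ)) ''
      {p : Sx E | p.1 = n ∧ ∀ x, p.2 x ∈ S}) ≤ N.comap A := Submodule.span_le.2 (by
    rintro _ ⟨⟨n, σ⟩, ⟨rfl, hf⟩, rfl⟩; exact h σ hf)
  exact this hc

lemma ChT_map {S : Set E} {M : Type} [AddCommGroup M] [Module ℂ M] (A : Chn E →ₗ[ℂ] M)
    (N : Submodule ℂ M)
    (h : ∀ n, ∀ σ : C(stdSimplex ℝ (Fin (n+1)), E), (∀ x, σ x ∈ S) → A (sx σ) ∈ N)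
    {c : Chn E} (hc : c ∈ ChT S) : A c ∈ N := by
  rw [ChT, Finsupp.supported_eq_span_single] at hc
  have : Submodule.span ℂ ((fun i ↦ Finsupp.single i (1:ℂ)) ''
      {p : Sx E | ∀ x, p.2 x ∈ S}) ≤ N.comap A := Submodule.span_le.2 (by
    rintro _ ⟨⟨n, σ⟩, hf, rfl⟩; exact h n σ hf)
  exact this hc

lemma ChT_ext {S : Set E} {M : Type} [AddCommGroup M] [Module ℂ M] {A B : Chn E →ₗ[ℂ] M}
    (h : ∀ n, ∀ σ : C(stdSimplex ℝ (Fin (n+1)), E), (∀ x, σ x ∈ S) → A (sx σ) = B (sx σ))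
    {c : Chn E} (hc : c ∈ ChT S) : A c = B c := by
  have := ChT_map (A - B) ⊥ (fun n σ hσ => by simp [h n σ hσ]) hc
  simpa [sub_eq_zero] using this

lemma Ch_le_ChT (S : Set E) (n : ℕ) : Ch S n ≤ ChT S :=
  Finsupp.supported_mono fun _ h => h.2

lemma Ch_mono {S T : Set E} (h : S ⊆ T) (n : ℕ) : Ch S n ≤ Ch T n :=
  Finsupp.supported_mono fun _ hp => ⟨hp.1, fun x => h (hp.2 x)⟩

lemma ChT_mono {S T : Set E} (h : S ⊆ T) : ChT S ≤ ChT T :=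
  Finsupp.supported_mono fun _ hp => fun x => h (hp x)

lemma mem_Ch_inter {S T : Set E} {n : ℕ} {c : Chn E} (h : c ∈ Ch S n) (h' : c ∈ ChT T) :
    c ∈ Ch (S ∩ T) n := by
  have := Submodule.mem_inf.2 ⟨h, h'⟩
  rw [Ch, ChT, ← Finsupp.supported_inter] at this
  exact by
    refine Finsupp.supported_mono (fun p hp => ?_) this
    exact ⟨hp.1.1, fun x => ⟨hp.1.2 x, hp.2 x⟩⟩

lemma mem_Ch_of_ChT {S T : Set E} {n : ℕ} {c : Chn E} (h : c ∈ Ch S n) (h' : c ∈ ChT T) :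
    c ∈ Ch T n := Ch_mono Set.inter_subset_right n (mem_Ch_inter h h')

lemma mem_ChT_inter {S T : Set E} {c : Chn E} (h : c ∈ ChT S) (h' : c ∈ ChT T) :
    c ∈ ChT (S ∩ T) := by
  have := Submodule.mem_inf.2 ⟨h, h'⟩
  rw [ChT, ChT, ← Finsupp.supported_inter] at this
  exact Finsupp.supported_mono (fun p hp => fun x => Set.mem_inter (hp.1 x) (hp.2 x)) this

lemma ChT_empty {c : Chn E} (h : c ∈ ChT (∅ : Set E)) : c = 0 := by
  have : {p : Sx E | ∀ x, p.2 x ∈ (∅ : Set E)} = ∅ := by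
    ext p
    simp
  rw [ChT, this, Finsupp.supported_empty] at h
  simpa using h

lemma Ch_zero_of_ne {S T : Set E} {n m : ℕ} (hnm : n ≠ m) {c : Chn E} (h : c ∈ Ch S n)
    (h' : c ∈ Ch T m) : c = 0 := by
  have := Submodule.mem_inf.2 ⟨h, h'⟩
  rw [Ch, Ch, ← Finsupp.supported_inter] at this
  have h2 : ({p : Sx E | p.1 = n ∧ ∀ x, p.2 x ∈ S} ∩ {p : Sx E | p.1 = m ∧ ∀ x, p.2 x ∈ T}) = ∅ := by
    ext p
    simp
    intro h _ h2
    exact absurd (h.symm.trans h2) hnm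
  rw [h2, Finsupp.supported_empty] at this
  simpa using this

/-- Projection on the degree `n` part. -/
noncomputable def degp (n : ℕ) : Chn E →ₗ[ℂ] Chn E :=
  cext (fun m σ => if m = n then sx σ else 0)

lemma degp_mem {S : Set E} (n : ℕ) {c : Chn E} (hc : c ∈ ChT S) : degp n c ∈ Ch S n :=
  ChT_map _ _ (fun m σ h => by
    simp only [degp, cext_sx]
    split_ifs with h'
    · subst h'; exact sx_mem_Ch h
    · exact Submodule.zero_mem _) hc

lemma degp_same {S : Set E} {n : ℕ} {c : Chn E} (hc : c ∈ Ch S n) : degp n c = c := by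
  have := Ch_map (degp n - LinearMap.id) ⊥ (fun σ _ => by simp [degp]) hc
  simpa [sub_eq_zero] using this

lemma bd_mem_ChT {S : Set E} {c : Chn E} (hc : c ∈ ChT S) : bd c ∈ ChT S :=
  ChT_map _ _ (fun n σ hf => by
    cases n with
    | zero => rw [bd_sx_zero]; exact Submodule.zero_mem _
    | succ n =>
      rw [bd_sx_succ]
      exact Submodule.sum_mem _ fun i _ => Submodule.smul_mem _ _ (sx_mem_ChT fun j => hf _)) hc

lemma bd_mem_Ch {S : Set E} {n : ℕ} {c : Chn E} (hc : c ∈ Ch S (n+1)) : bd c ∈ Ch S n :=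
  Ch_map _ _ (fun σ hf => by
      rw [bd_sx_succ]
      exact Submodule.sum_mem _ fun i _ => Submodule.smul_mem _ _ (sx_mem_Ch fun j => hf _)) hc

lemma bd_Ch_zero {S : Set E} {c : Chn E} (hc : c ∈ Ch S 0) : bd c = 0 := by
  have := Ch_map bd ⊥ (fun σ hf => by simp [bd_sx_zero]) hc
  simpa using this

open Classical in
/-- Push-forward along a function (zero on simplices on which it is not continuous). -/
noncomputable def push (g : E → E') : Chn E →ₗ[ℂ] Chn E' :=
  cext (fun n σ => if h : Continuous (g ∘ σ) then sx (n := n) ⟨g ∘ σ, h⟩ else 0)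

lemma push_sx {g : E → E'} {n : ℕ} {σ : C(stdSimplex ℝ (Fin (n+1)), E)}
    (h : Continuous (g ∘ σ)) : push g (sx σ) = sx ⟨g ∘ σ, h⟩ := by
  simp [push, h]

lemma cont_on_comp {g : E → E'} {S : Set E} (hg : ContinuousOn g S) {n : ℕ}
    {σ : C(stdSimplex ℝ (Fin (n+1)), E)} (h : ∀ x, σ x ∈ S) : Continuous (g ∘ σ) :=
  hg.comp_continuous σ.continuous h

lemma push_mem {g : E → E'} {S : Set E} {T : Set E'} (h : ∀ x ∈ S, g x ∈ T) {n : ℕ}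
    {c : Chn E} (hc : c ∈ Ch S n) : push g c ∈ Ch T n :=
  Ch_map _ _ (fun σ hf => by
    by_cases hh : Continuous (g ∘ σ)
    · rw [push_sx hh]; exact sx_mem_Ch fun x => h _ (hf x)
    · simp [push, hh]) hc

lemma push_memT {g : E → E'} {S : Set E} {T : Set E'} (h : ∀ x ∈ S, g x ∈ T)
    {c : Chn E} (hc : c ∈ ChT S) : push g c ∈ ChT T :=
  ChT_map _ _ (fun n σ hf => by
    by_cases hh : Continuous (g ∘ σ)
    · rw [push_sx hh]; exact sx_mem_ChT fun x => h _ (hf x)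
    · simp [push, hh]) hc

lemma bd_push {g : E → E'} {S : Set E} (hg : ContinuousOn g S) {c : Chn E} (hc : c ∈ ChT S) :
    bd (push g c) = push g (bd c) := by
  refine ChT_ext (A := bd ∘ₗ push g) (B := push g ∘ₗ bd) (fun n σ hσ => ?_) hc
  simp only [LinearMap.comp_apply]
  rw [push_sx (cont_on_comp hg hσ)]
  cases n with
  | zero => rw [bd_sx_zero, bd_sx_zero, map_zero]
  | succ n =>
    rw [bd_sx_succ, bd_sx_succ, map_sum]
    refine Finset.sum_congr rfl fun i _ => ?_
    rw [map_smul, push_sx (σ := σ.comp (fmap i)) (cont_on_comp hg fun x => hσ _)]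
    rfl

lemma push_sx_congr {g : E → E'} {g' : E'' → E'} {n : ℕ} {σ : C(stdSimplex ℝ (Fin (n+1)), E)}
    {σ' : C(stdSimplex ℝ (Fin (n+1)), E'')} (h : g ∘ σ = g' ∘ σ') :
    push g (sx σ) = push g' (sx σ') := by
  by_cases hc : Continuous (g ∘ σ)
  · rw [push_sx hc, push_sx (h ▸ hc)]
    congr 1
    ext x; exact congrFun h x
  · have hc' : ¬ Continuous (g' ∘ σ') := h ▸ hc
    simp [push, hc, hc']

lemma push_congr {g g' : E → E'} {S : Set E} (h : ∀ x ∈ S, g x = g' x) {c : Chn E}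
    (hc : c ∈ ChT S) : push g c = push g' c := by
  refine ChT_ext (A := push g) (B := push g') (fun n σ hσ => ?_) hc
  exact push_sx_congr (funext fun x => h _ (hσ x))

lemma push_push {g : E → E'} {g' : E' → E''} {S : Set E} (hg : ContinuousOn g S) {c : Chn E}
    (hc : c ∈ ChT S) : push g' (push g c) = push (g' ∘ g) c := by
  refine ChT_ext (A := push g' ∘ₗ push g) (B := push (g' ∘ g)) (fun n σ hσ => ?_) hc
  simp only [LinearMap.comp_apply]
  rw [push_sx (cont_on_comp hg hσ)]
  simp [push, Function.comp_assoc]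

lemma push_id {g : E → E} {S : Set E} (h : ∀ x ∈ S, g x = x) {c : Chn E}
    (hc : c ∈ ChT S) : push g c = c := by
  rw [push_congr (g' := id) h hc]
  refine ChT_ext (A := push id) (B := LinearMap.id) (fun n σ hσ => ?_) hc
  rw [push_sx (by exact σ.continuous)]; rfl

end basic

section real
variable {V : Type} [NormedAddCommGroup V] [NormedSpace ℝ V]

/-- The affine simplex with given vertices. -/
noncomputable def aff {n : ℕ} (f : Fin (n+1) → V) : C(stdSimplex ℝ (Fin (n+1)), V) where
  toFun x := ∑ i, x.1 i • f i
  continuous_toFun := by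
    refine continuous_finsetSum _ fun i _ => ?_
    exact ((continuous_apply i).comp continuous_subtype_val).smul continuous_const

lemma aff_apply {n : ℕ} (f : Fin (n+1) → V) (x : stdSimplex ℝ (Fin (n+1))) :
    aff f x = ∑ i, x.1 i • f i := rfl

lemma fmap_apply {n : ℕ} (i : Fin (n+2)) (x : stdSimplex ℝ (Fin (n+1))) (j : Fin (n+2)) :
    (fmap i x).1 j = ∑ k, if i.succAbove k = j then x.1 k else 0 := by
  change (stdSimplex.map (Fin.succAbove i) x) j = _
  rw [stdSimplex.map_coe, FunOnFinite.linearMap_apply_apply, Finset.sum_filter]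
  rfl

lemma aff_fmap {n : ℕ} (f : Fin (n+2) → V) (i : Fin (n+2)) :
    (aff f).comp (fmap i) = aff (fun j => f (i.succAbove j)) := by
  ext x
  simp only [ContinuousMap.comp_apply, aff_apply, fmap_apply, Finset.sum_smul]
  rw [Finset.sum_comm]
  refine Finset.sum_congr rfl fun k _ => ?_
  simp [ite_smul]

/-- Realisation of one tuple. -/
noncomputable def RRf : (m : ℕ) → (Fin m → V) → Chn V
  | 0, _ => 0
  | (_ + 1), f => sx (aff f)

/-- Realisation of linear chains as singular chains. -/
noncomputable def RR : LC V →ₗ[ℂ] Chn V := lext RRf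

lemma RR_zero (f : Fin 0 → V) : RR (tup f) = 0 := by simp [RR, RRf]
lemma RR_succ {m : ℕ} (f : Fin (m+1) → V) : RR (tup f) = sx (aff f) := by simp [RR, RRf]

lemma RR_lbd (c : LC V) : RR (lbd c) = bd (RR c) := by
  have : RR ∘ₗ lbd = bd ∘ₗ RR := lc_hom_ext (V := V) fun m f => by
    simp only [LinearMap.comp_apply]
    match m, f with
    | 0, f => simp [lbd_tup_zero, RR_zero]
    | 1, f => simp [lbd_tup_succ, RR_succ, RR_zero, bd_sx_zero]
    | m+2, f =>
      rw [lbd_tup_succ, map_sum, RR_succ, bd_sx_succ]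
      refine Finset.sum_congr rfl fun i _ => ?_
      rw [map_smul, RR_succ, aff_fmap]
  exact LinearMap.congr_fun this c

lemma aff_mem {s : Set V} (hs : Convex ℝ s) {n : ℕ} {f : Fin (n+1) → V} (hf : ∀ i, f i ∈ s) (x) :
    aff f x ∈ s :=
  hs.sum_mem (fun i _ => x.2.1 i) x.2.2 (fun i _ => hf i)

lemma RR_mem {s : Set V} (hs : Convex ℝ s) {m : ℕ} {c : LC V} (hc : c ∈ LS s (m+1)) :
    RR c ∈ Ch s m :=
  LS_map _ _ (fun f hf => by rw [RR_succ]; exact sx_mem_Ch (aff_mem hs hf)) hc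

lemma RR_LS_zero {s : Set V} {c : LC V} (hc : c ∈ LS s 0) : RR c = 0 := by
  have := LS_map RR ⊥ (fun f hf => by simp [RR_zero]) hc
  simpa using this

lemma RR_memT {s : Set V} (hs : Convex ℝ s) {m : ℕ} {c : LC V} (hc : c ∈ LS s m) :
    RR c ∈ ChT s := by
  cases m with
  | zero => rw [RR_LS_zero hc]; exact Submodule.zero_mem _
  | succ m => exact Ch_le_ChT _ _ (RR_mem hs hc)

lemma RR_lmap {W : Type} [NormedAddCommGroup W] [NormedSpace ℝ W] (A : V →L[ℝ] W) (c : LC V) :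
    RR (lmap A c) = push A (RR c) := by
  have : RR ∘ₗ lmap A = push A ∘ₗ RR := lc_hom_ext (V := V) fun m f => by
    simp only [LinearMap.comp_apply, lmap_tup]
    cases m with
    | zero => simp [RR_zero]
    | succ m =>
      rw [RR_succ, RR_succ, push_sx (A.continuous.comp (aff f).continuous)]
      congr 1
      ext x
      simp [aff_apply]
  exact LinearMap.congr_fun this c

end real

section ops
variable {E E' : Type} [TopologicalSpace E] [TopologicalSpace E']

/-- Vertices of the standard simplex. -/
noncomputable def vert (n : ℕ) : Fin n → (Fin n → ℝ) := fun i => Pi.single i 1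

lemma vert_mem (n : ℕ) (i : Fin n) : vert n i ∈ stdSimplex ℝ (Fin n) := single_mem_stdSimplex ℝ i

open Classical in
/-- Extension of a simplex by a constant value. -/
noncomputable def sext {n : ℕ} (σ : C(stdSimplex ℝ (Fin (n+1)), E)) (x : Fin (n+1) → ℝ) : E :=
  if h : x ∈ stdSimplex ℝ (Fin (n+1)) then σ ⟨x, h⟩ else σ ⟨vert (n+1) 0, vert_mem _ 0⟩

lemma sext_of_mem {n : ℕ} (σ : C(stdSimplex ℝ (Fin (n+1)), E)) {x : Fin (n+1) → ℝ}
    (h : x ∈ stdSimplex ℝ (Fin (n+1))) : sext σ x = σ ⟨x, h⟩ := by simp [sext, h]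

lemma sext_cont {n : ℕ} (σ : C(stdSimplex ℝ (Fin (n+1)), E)) :
    ContinuousOn (sext σ) (stdSimplex ℝ (Fin (n+1))) := by
  rw [continuousOn_iff_continuous_domRestrict]
  have : (stdSimplex ℝ (Fin (n+1))).domRestrict (sext σ) = σ := by
    funext x; exact sext_of_mem σ x.2
  rw [this]; exact σ.continuous

/-- Natural operators on linear chains. -/
structure NatOp where
  op : (n : ℕ) → LC (Fin n → ℝ) →ₗ[ℂ] LC ((Fin n → ℝ) × ℝ)
  deg : ℕ
  mem : ∀ n (s : Set (Fin n → ℝ)), Convex ℝ s → ∀ m, ∀ c ∈ LS s m,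
    op n c ∈ LS (s ×ˢ Set.Icc (0:ℝ) 1) (m + deg)
  nat : ∀ n n' (A : (Fin n → ℝ) →ₗ[ℝ] (Fin n' → ℝ)) c, lmap (Prod.map A id) (op n c) =
    op n' (lmap A c)
  zero : ∀ n (f : Fin 0 → (Fin n → ℝ)), op n (tup f) ∈ LS Set.univ 0

/-- The map used to push the linear model. -/
noncomputable def hmap (h : E × ℝ → E') {n : ℕ} (σ : C(stdSimplex ℝ (Fin (n+1)), E)) :
    (Fin (n+1) → ℝ) × ℝ → E' := fun p => h (sext σ p.1, p.2)

/-- Singular operator induced by a natural operator and a homotopy. -/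
noncomputable def sop (O : NatOp) (h : E × ℝ → E') : Chn E →ₗ[ℂ] Chn E' :=
  cext (fun n σ => push (hmap h σ) (RR (O.op (n+1) (tup (vert (n+1))))))

lemma sop_sx (O : NatOp) (h : E × ℝ → E') {n : ℕ} (σ : C(stdSimplex ℝ (Fin (n+1)), E)) :
    sop O h (sx σ) = push (hmap h σ) (RR (O.op (n+1) (tup (vert (n+1))))) := by simp [sop]

lemma hmap_cont {h : E × ℝ → E'} {S : Set E} (hh : ContinuousOn h (S ×ˢ Set.Icc (0:ℝ) 1)) {n : ℕ}
    {σ : C(stdSimplex ℝ (Fin (n+1)), E)} (hσ : ∀ x, σ x ∈ S) :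
    ContinuousOn (hmap h σ) (stdSimplex ℝ (Fin (n+1)) ×ˢ Set.Icc (0:ℝ) 1) := by
  refine hh.comp ?_ ?_
  · refine ContinuousOn.prodMk ((sext_cont σ).comp continuousOn_fst fun p hp => hp.1) continuousOn_snd
  · intro p hp
    refine ⟨?_, hp.2⟩
    change sext σ p.1 ∈ S
    rw [sext_of_mem σ hp.1]; exact hσ _

lemma cvx_model (n : ℕ) : Convex ℝ (stdSimplex ℝ (Fin n) ×ˢ Set.Icc (0:ℝ) 1) :=
  (convex_stdSimplex ℝ _).prod (convex_Icc _ _)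

lemma op_vert_mem (O : NatOp) (n : ℕ) : O.op n (tup (vert n)) ∈
    LS (stdSimplex ℝ (Fin n) ×ˢ Set.Icc (0:ℝ) 1) (n + O.deg) :=
  O.mem n _ (convex_stdSimplex ℝ _) n _ (tup_mem_LS (vert_mem n))

lemma sop_mem (O : NatOp) {h : E × ℝ → E'} {A : Set E} {A' : Set E'}
    (hA : ∀ x ∈ A, ∀ t ∈ Set.Icc (0:ℝ) 1, h (x, t) ∈ A') {n : ℕ} {c : Chn E} (hc : c ∈ Ch A n) :
    sop O h c ∈ Ch A' (n + O.deg) :=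
  Ch_map _ _ (fun σ hσ => by
    rw [sop_sx]
    refine push_mem (S := stdSimplex ℝ (Fin (n+1)) ×ˢ Set.Icc (0:ℝ) 1) ?_ (RR_mem (cvx_model _) ?_)
    · intro p hp
      rw [hmap, sext_of_mem σ hp.1]; exact hA _ (hσ _) _ hp.2
    · have := op_vert_mem O (n+1)
      rwa [show n + 1 + O.deg = n + O.deg + 1 by ring] at this) hc

lemma sop_memT (O : NatOp) {h : E × ℝ → E'} {A : Set E} {A' : Set E'}
    (hA : ∀ x ∈ A, ∀ t ∈ Set.Icc (0:ℝ) 1, h (x, t) ∈ A') {c : Chn E} (hc : c ∈ ChT A) :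
    sop O h c ∈ ChT A' :=
  ChT_map _ _ (fun n σ hσ => Ch_le_ChT _ _ (sop_mem O hA (sx_mem_Ch hσ))) hc

lemma bd_sop (O : NatOp) {h : E × ℝ → E'} {S : Set E}
    (hh : ContinuousOn h (S ×ˢ Set.Icc (0:ℝ) 1)) {n : ℕ}
    {σ : C(stdSimplex ℝ (Fin (n+1)), E)} (hσ : ∀ x, σ x ∈ S) :
    bd (sop O h (sx σ)) = push (hmap h σ) (RR (lbd (O.op (n+1) (tup (vert (n+1)))))) := by
  rw [sop_sx, bd_push (hmap_cont hh hσ) (RR_memT (cvx_model _) (op_vert_mem O (n+1))), RR_lbd]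

/-- Linear face map. -/
noncomputable def lface {n : ℕ} (i : Fin (n+2)) : (Fin (n+1) → ℝ) →ₗ[ℝ] (Fin (n+2) → ℝ) :=
  FunOnFinite.linearMap ℝ ℝ (Fin.succAbove i)

lemma lface_vert {n : ℕ} (i : Fin (n+2)) :
    (lface i) ∘ (vert (n+1)) = fun j => vert (n+2) (i.succAbove j) := by
  funext j
  simp [lface, vert]

lemma lface_sext {n : ℕ} (i : Fin (n+2)) (σ : C(stdSimplex ℝ (Fin (n+2)), E)) {x : Fin (n+1) → ℝ}
    (hx : x ∈ stdSimplex ℝ (Fin (n+1))) : sext σ (lface i x) = sext (σ.comp (fmap i)) x := by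
  rw [sext_of_mem _ hx]
  exact sext_of_mem σ (fmap i ⟨x, hx⟩).2

lemma sop_bd (O : NatOp) {h : E × ℝ → E'} {S : Set E} {n : ℕ}
    {σ : C(stdSimplex ℝ (Fin (n+1)), E)} (hσ : ∀ x, σ x ∈ S) :
    sop O h (bd (sx σ)) = push (hmap h σ) (RR (O.op (n+1) (lbd (tup (vert (n+1)))))) := by
  cases n with
  | zero =>
    rw [bd_sx_zero, map_zero, lbd_tup_succ]
    simp only [map_sum, map_smul]
    rw [Finset.sum_eq_zero]
    intro i _
    rw [RR_LS_zero (O.zero _ _), map_zero, smul_zero]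
  | succ n =>
    rw [bd_sx_succ, lbd_tup_succ]
    simp only [map_sum, map_smul]
    refine Finset.sum_congr rfl fun i _ => ?_
    congr 1
    rw [sop_sx, ← lface_vert, ← lmap_tup, ← O.nat]
    have hc : (Prod.map (lface i) id : (Fin (n+1) → ℝ) × ℝ → _) =
      ((LinearMap.toContinuousLinearMap (lface i)).prodMap (ContinuousLinearMap.id ℝ ℝ)) := rfl
    rw [hc, RR_lmap]
    have hm := RR_memT (cvx_model _) (op_vert_mem O (n+1))
    rw [push_push (ContinuousLinearMap.continuous _).continuousOn hm]
    refine push_congr (fun p hp => ?_) hm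
    simp only [hmap, Function.comp_apply]
    congr 2
    exact (lface_sext i σ hp.1).symm

/-- `1`-homotopy. -/
noncomputable def prismOp : NatOp where
  op n := PR
  deg := 1
  mem n s hs m c hc := PR_mem_LS hs m c hc
  nat n n' A c := PR_nat A c
  zero n f := by
    change GG _ _ _ _ ∈ _
    rw [GG_tup_zero]; exact Submodule.zero_mem _

lemma fst_zero_mem {V : Type} {s : Set V} {m : ℕ} {c : LC V} (hc : c ∈ LS s m) :
    lmap (fun x => (x, (0:ℝ))) c ∈ LS (s ×ˢ Set.Icc (0:ℝ) 1) m :=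
  lmap_mem_LS (fun x hx => Set.mk_mem_prod hx (by simp)) hc

/-- Subdivision operator. -/
noncomputable def sdOp (k : ℕ) : NatOp where
  op n := lmap (fun x => (x, (0:ℝ))) ∘ₗ SdK k
  deg := 0
  mem n s hs m c hc := fst_zero_mem (SdK_mem_LS k hs m c hc)
  nat n n' A c := by
    simp only [LinearMap.comp_apply, lmap_lmap]
    rw [← SdK_nat, lmap_lmap]; rfl
  zero n f := by
    simp only [LinearMap.comp_apply]
    exact lmap_mem_LS (s := Set.univ) (fun _ _ => Set.mem_univ _)
      (SdK_mem_LS k convex_univ 0 _ (tup_mem_LS fun _ => Set.mem_univ _))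

/-- Subdivision homotopy operator. -/
noncomputable def tkOp (k : ℕ) : NatOp where
  op n := lmap (fun x => (x, (0:ℝ))) ∘ₗ TK k
  deg := 1
  mem n s hs m c hc := fst_zero_mem (TK_mem_LS k hs m c hc)
  nat n n' A c := by
    simp only [LinearMap.comp_apply, lmap_lmap]
    rw [← TK_nat, lmap_lmap]; rfl
  zero n f := by
    simp only [LinearMap.comp_apply, TK]
    rw [GG_tup_zero, map_zero]; exact Submodule.zero_mem _

lemma aff_const {n : ℕ} (t : ℝ) (x : stdSimplex ℝ (Fin (n+1))) :
    aff (fun i => (vert (n+1) i, t)) x = (x.1, t) := by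
  rw [aff_apply]
  refine Prod.ext ?_ ?_
  · rw [Prod.fst_sum]
    funext j
    simp [vert, Pi.single_apply]
  · rw [Prod.snd_sum]
    simp only [Prod.smul_mk, smul_eq_mul, ← Finset.sum_mul]
    rw [x.2.2, one_mul]

lemma push_const_tup {h : E × ℝ → E'} {n : ℕ} {σ : C(stdSimplex ℝ (Fin (n+1)), E)} (t : ℝ) :
    push (hmap h σ) (RR (lmap (fun x => (x, t)) (tup (vert (n+1))))) =
      push (fun x => h (x, t)) (sx σ) := by
  rw [lmap_tup, RR_succ]
  have : (hmap h σ) ∘ (aff ((fun x => (x, t)) ∘ vert (n+1))) = (fun x => h (x, t)) ∘ σ := by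
    funext x
    simp only [Function.comp_apply]
    rw [show ((fun x => (x, t)) ∘ vert (n+1)) = fun i => (vert (n+1) i, t) from rfl,
      aff_const, hmap]
    simp only
    rw [sext_of_mem σ x.2]
  exact push_sx_congr this

/-- Homotopy lemma. -/
lemma homotopy_lemma {h : E × ℝ → E'} {S : Set E}
    (hh : ContinuousOn h (S ×ˢ Set.Icc (0:ℝ) 1)) {c : Chn E} (hc : c ∈ ChT S) :
    bd (sop prismOp h c) + sop prismOp h (bd c) =
      push (fun x => h (x, 1)) c - push (fun x => h (x, 0)) c := by
  refine ChT_ext (A := bd ∘ₗ sop prismOp h + sop prismOp h ∘ₗ bd)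
    (B := push (fun x => h (x, 1)) - push (fun x => h (x, 0))) (fun n σ hσ => ?_) hc
  simp only [LinearMap.add_apply, LinearMap.comp_apply, LinearMap.sub_apply]
  rw [bd_sop _ hh hσ, sop_bd _ hσ, ← map_add, ← map_add]
  change push _ (RR (lbd (PR _) + PR _)) = _
  rw [PR_homotopy, map_sub, map_sub, push_const_tup, push_const_tup]

lemma sd_homotopy (k : ℕ) (c : Chn E) :
    bd (sop (tkOp k) Prod.fst c) + sop (tkOp k) Prod.fst (bd c) =
      c - sop (sdOp k) Prod.fst c := by
  have hc : c ∈ ChT (Set.univ : Set E) := by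
    simp [ChT]
  refine ChT_ext (A := bd ∘ₗ sop (tkOp k) Prod.fst + sop (tkOp k) Prod.fst ∘ₗ bd)
    (B := LinearMap.id - sop (sdOp k) Prod.fst) (fun n σ hσ => ?_) hc
  simp only [LinearMap.add_apply, LinearMap.comp_apply, LinearMap.sub_apply, LinearMap.id_apply]
  rw [bd_sop _ continuousOn_fst hσ, sop_bd _ hσ, ← map_add, ← map_add, sop_sx]
  change push _ (RR (lbd (lmap _ (TK k _)) + lmap _ (TK k _))) = _ - push _ (RR (lmap _ (SdK k _)))
  rw [← lmap_lbd, ← map_add, TK_homotopy, map_sub, map_sub, map_sub, push_const_tup,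
    push_id (S := Set.univ) (fun _ _ => rfl)]
  exact sx_mem_ChT fun _ => trivial

lemma bd_bd (c : Chn E) : bd (bd c) = 0 := by
  have hc : c ∈ ChT (Set.univ : Set E) := by
    simp [ChT]
  refine ChT_ext (A := bd ∘ₗ bd) (B := 0) (fun n σ hσ => ?_) hc
  have h1 : sx σ = push (hmap Prod.fst σ) (RR (lmap (fun x => (x, (0:ℝ))) (tup (vert (n+1))))) := by
    rw [push_const_tup, push_id (S := Set.univ) (fun _ _ => rfl)]
    exact sx_mem_ChT fun _ => trivial
  have hcont : ContinuousOn (hmap Prod.fst σ) (stdSimplex ℝ (Fin (n+1)) ×ˢ Set.Icc (0:ℝ) 1) :=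
    hmap_cont (S := Set.univ) continuousOn_fst hσ
  have hm : RR (lmap (fun x => (x, (0:ℝ))) (tup (vert (n+1)))) ∈
      ChT (stdSimplex ℝ (Fin (n+1)) ×ˢ Set.Icc (0:ℝ) 1) :=
    RR_memT (cvx_model _) (fst_zero_mem (tup_mem_LS (vert_mem (n+1))))
  simp only [LinearMap.comp_apply, LinearMap.zero_apply]
  rw [h1, bd_push hcont hm, bd_push hcont (bd_mem_ChT hm), ← RR_lbd, ← RR_lbd, lbd_lbd]
  simp

end ops

end HV


namespace HV

/-! ### Small simplices -/

section shrink
variable {V : Type} [NormedAddCommGroup V] [NormedSpace ℝ V]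

/-- Linear chains of tuples in `s` of diameter at most `D`. -/
noncomputable def LD (s : Set V) (D : ℝ) (m : ℕ) : Submodule ℂ (LC V) :=
  Submodule.span ℂ {c | ∃ f : Fin m → V, (∀ i, f i ∈ s) ∧ (∀ i j, dist (f i) (f j) ≤ D) ∧ c = tup f}

lemma tup_mem_LD {s : Set V} {D : ℝ} {m : ℕ} {f : Fin m → V} (h : ∀ i, f i ∈ s)
    (h' : ∀ i j, dist (f i) (f j) ≤ D) : tup f ∈ LD s D m :=
  Submodule.subset_span ⟨f, h, h', rfl⟩

lemma LD_map {s : Set V} {D : ℝ} {m : ℕ} {M : Type} [AddCommGroup M] [Module ℂ M]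
    (A : LC V →ₗ[ℂ] M) (N : Submodule ℂ M)
    (h : ∀ f : Fin m → V, (∀ i, f i ∈ s) → (∀ i j, dist (f i) (f j) ≤ D) → A (tup f) ∈ N)
    {c : LC V} (hc : c ∈ LD s D m) : A c ∈ N := by
  have : LD s D m ≤ N.comap A := Submodule.span_le.2 (by
    rintro _ ⟨f, hf, hf', rfl⟩; exact h f hf hf')
  exact this hc

lemma LD_mono {s t : Set V} (hst : s ⊆ t) {D D' : ℝ} (hD : D ≤ D') {m : ℕ} :
    LD s D m ≤ LD t D' m := fun c hc =>
  LD_map LinearMap.id _ (fun f hf hf' => tup_mem_LD (fun i => hst (hf i))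
    (fun i j => (hf' i j).trans hD)) hc

lemma dist_bary {m : ℕ} {f : Fin (m+1) → V} {D : ℝ} (hf : ∀ i j, dist (f i) (f j) ≤ D)
    {x : V} (hx : x ∈ convexHull ℝ (Set.range f)) :
    dist x (bary (m+1) f) ≤ (m : ℝ) / (m+1) * D := by
  have : convexHull ℝ (Set.range f) ⊆ Metric.closedBall (bary (m+1) f) ((m : ℝ) / (m+1) * D) := by
    refine convexHull_min ?_ (convex_closedBall _ _)
    rintro _ ⟨i, rfl⟩
    rw [Metric.mem_closedBall, dist_eq_norm]
    have e : f i - bary (m+1) f = ((m : ℝ)+1)⁻¹ • ∑ j, (f i - f j) := by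
      rw [Finset.sum_sub_distrib, smul_sub, bary]
      simp only [Finset.sum_const, Finset.card_univ, Fintype.card_fin]
      push_cast
      rw [← Nat.cast_smul_eq_nsmul ℝ, smul_smul]
      push_cast
      rw [inv_mul_cancel₀ (by positivity), one_smul]
    rw [e, norm_smul, Real.norm_of_nonneg (by positivity), div_mul_eq_mul_div, div_eq_inv_mul]
    refine mul_le_mul_of_nonneg_left ?_ (by positivity)
    refine (norm_sum_le _ _).trans ?_
    rw [← Finset.add_sum_erase _ _ (Finset.mem_univ i), sub_self, norm_zero, zero_add]
    refine (Finset.sum_le_card_nsmul _ _ D fun j _ => ?_).trans ?_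
    · rw [← dist_eq_norm]; exact hf i j
    · simp
  exact this hx

lemma cone_mem_LD {s : Set V} {D : ℝ} {m : ℕ} {b : V} (hb : b ∈ s) (hD : 0 ≤ D)
    (h : ∀ x ∈ s, dist x b ≤ D) {c : LC V} (hc : c ∈ LD s D m) : cone b c ∈ LD s D (m+1) :=
  LD_map _ _ (fun f hf hf' => by
    rw [cone_tup]
    refine tup_mem_LD (fun i => Fin.cases (by simpa using hb) (fun j => by simpa using hf j) i) ?_
    intro i j
    refine Fin.cases ?_ (fun i => ?_) i
    · refine Fin.cases (by simpa using hD) (fun j => ?_) j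
      simpa [dist_comm] using h _ (hf j)
    · refine Fin.cases (by simpa using h _ (hf i)) (fun j => ?_) j
      simpa using hf' i j) hc

lemma Sd_mem_LD {D : ℝ} (hD : 0 ≤ D) : ∀ (m : ℕ) (f : Fin m → V),
    (∀ i j, dist (f i) (f j) ≤ D) →
    Sd (tup f) ∈ LD (convexHull ℝ (Set.range f)) (((m:ℝ) - 1) / m * D) m
  | 0, f, hf => by
    rw [Sd_tup_zero]
    exact tup_mem_LD (fun i => i.elim0) (fun i => i.elim0)
  | m+1, f, hf => by
    rw [Sd_tup_succ]
    have e : (((m+1:ℕ):ℝ) - 1) / (m+1:ℕ) * D = (m : ℝ) / (m+1) * D := by push_cast; ring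
    rw [e]
    refine cone_mem_LD (bary_mem (convex_convexHull ℝ _) fun i => subset_convexHull ℝ _ (Set.mem_range_self i))
      (by positivity) (fun x hx => dist_bary hf hx) ?_
    rw [lbd_tup_succ, map_sum]
    refine Submodule.sum_mem _ fun i _ => ?_
    rw [map_smul]
    refine Submodule.smul_mem _ _ ?_
    refine LD_mono (convexHull_mono ?_) ?_ (Sd_mem_LD hD m _ fun j k => hf _ _)
    · rintro _ ⟨j, rfl⟩; exact ⟨_, rfl⟩
    · refine mul_le_mul_of_nonneg_right ?_ hD
      rcases Nat.eq_zero_or_pos m with rfl | hm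
      · simp
      · have : (0:ℝ) < m := by exact_mod_cast hm
        rw [div_le_div_iff₀ this (by positivity)]
        nlinarith

lemma SdK_mem_LD {s : Set V} (hs : Convex ℝ s) {D : ℝ} (hD : 0 ≤ D) (m k : ℕ) (f : Fin (m+1) → V)
    (hf : ∀ i, f i ∈ s) (hf' : ∀ i j, dist (f i) (f j) ≤ D) :
    SdK k (tup f) ∈ LD s (((m:ℝ) / (m+1)) ^ k * D) (m+1) := by
  induction k with
  | zero => simpa using tup_mem_LD hf hf'
  | succ k ih =>
    rw [SdK_succ]
    refine LD_map _ _ (fun g hg hg' => ?_) ih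
    refine LD_mono (convexHull_min ?_ hs) (le_of_eq ?_) (Sd_mem_LD (by positivity) _ g hg')
    · rintro _ ⟨j, rfl⟩; exact hg j
    · push_cast; ring

end shrink

section subdiv
variable {E : Type} [TopologicalSpace E]

/-- The subdivision homotopy. -/
noncomputable def TS (k : ℕ) : Chn E →ₗ[ℂ] Chn E := sop (tkOp k) Prod.fst

/-- The singular subdivision. -/
noncomputable def SS (k : ℕ) : Chn E →ₗ[ℂ] Chn E := sop (sdOp k) Prod.fst

lemma SS_eq (k : ℕ) (c : Chn E) : c = SS k c + bd (TS k c) + TS k (bd c) := by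
  have h := sd_homotopy k c
  unfold TS SS
  rw [add_assoc, h, add_sub_cancel]

lemma TS_mem (k : ℕ) {A : Set E} {n : ℕ} {c : Chn E} (hc : c ∈ Ch A n) : TS k c ∈ Ch A (n+1) :=
  sop_mem (tkOp k) (fun _ hx _ _ => hx) hc

lemma TS_memT (k : ℕ) {A : Set E} {c : Chn E} (hc : c ∈ ChT A) : TS k c ∈ ChT A :=
  sop_memT (tkOp k) (fun _ hx _ _ => hx) hc

lemma SS_mem (k : ℕ) {A : Set E} {n : ℕ} {c : Chn E} (hc : c ∈ Ch A n) : SS k c ∈ Ch A n :=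
  sop_mem (sdOp k) (fun _ hx _ _ => hx) hc

lemma SS_small_sx {ι : Type} {S : Set E} {O : ι → Set E} (hO : ∀ i, IsOpen (O i))
    (hS : S ⊆ ⋃ i, O i) {n : ℕ}
    {σ : C(stdSimplex ℝ (Fin (n+1)), E)} (hσ : ∀ x, σ x ∈ S) :
    ∃ k₀, ∀ k ≥ k₀, SS k (sx σ) ∈ ⨆ i, Ch (S ∩ O i) n := by
  obtain ⟨δ, hδ, hball⟩ := lebesgue_number_lemma_of_metric (α := stdSimplex ℝ (Fin (n+1)))
    (s := Set.univ) (c := fun b : ι => σ ⁻¹' (O b)) isCompact_univ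
    (fun b => (hO b).preimage σ.continuous)
    (fun x _ => by
      obtain ⟨i, hi⟩ := Set.mem_iUnion.1 (hS (hσ x))
      exact Set.mem_iUnion.2 ⟨i, hi⟩)
  have hr : (n:ℝ) / (n+1) < 1 := by rw [div_lt_one (by positivity)]; linarith
  obtain ⟨k₀, hk₀⟩ := exists_pow_lt_of_lt_one hδ hr
  refine ⟨k₀, fun k hk => ?_⟩
  have hlt : ((n:ℝ) / (n+1)) ^ k * 1 < δ := by
    rw [mul_one]
    exact lt_of_le_of_lt (pow_le_pow_of_le_one (by positivity) hr.le hk) hk₀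
  have hmem := SdK_mem_LD (convex_stdSimplex ℝ (Fin (n+1))) zero_le_one n k (vert (n+1))
    (vert_mem (n+1)) (fun i j => by
      refine (Metric.dist_le_diam_of_mem (bounded_stdSimplex _) (vert_mem _ i) (vert_mem _ j)).trans
        diam_stdSimplex_le)
  rw [SS, sop_sx]
  change (push (hmap Prod.fst σ) ∘ₗ RR ∘ₗ lmap (fun x => (x, (0:ℝ)))) (SdK k (tup (vert (n+1)))) ∈ _
  refine LD_map _ _ (fun f hf hf' => ?_) hmem
  simp only [LinearMap.comp_apply, lmap_tup]
  rw [RR_succ]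
  have hin : ∀ x, aff f x ∈ stdSimplex ℝ (Fin (n+1)) := aff_mem (convex_stdSimplex ℝ _) hf
  have hcomp : ∀ x, (hmap Prod.fst σ) (aff ((fun x => (x, (0:ℝ))) ∘ f) x) = σ ⟨aff f x, hin x⟩ := by
    intro x
    have : (aff ((fun x => (x, (0:ℝ))) ∘ f) x) = (aff f x, 0) := by
      simp only [aff_apply, Function.comp_apply]
      refine Prod.ext ?_ ?_
      · simp [Prod.fst_sum]
      · simp [Prod.snd_sum]
    rw [this]
    exact sext_of_mem σ (hin x)
  have hcont : Continuous ((hmap Prod.fst σ) ∘ (aff ((fun x => (x, (0:ℝ))) ∘ f))) := by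
    have : ((hmap Prod.fst σ) ∘ (aff ((fun x => (x, (0:ℝ))) ∘ f))) =
      fun x => σ ⟨aff f x, hin x⟩ := funext hcomp
    rw [this]
    exact σ.continuous.comp (Continuous.subtype_mk (aff f).continuous _)
  rw [push_sx hcont]
  obtain ⟨b, hb⟩ := hball ⟨f 0, hf 0⟩ trivial
  have hx : ∀ x, σ ⟨aff f x, hin x⟩ ∈ O b := by
    intro x
    apply hb
    rw [Metric.mem_ball, Subtype.dist_eq]
    exact aff_mem (convex_ball (f 0) δ) (fun i => (hf' i 0).trans_lt hlt) x
  refine Submodule.mem_iSup_of_mem b (sx_mem_Ch fun x => ?_)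
  change (hmap Prod.fst σ) (aff ((fun x => (x, (0:ℝ))) ∘ f) x) ∈ _
  rw [hcomp]; exact ⟨hσ _, hx x⟩

lemma SS_small_gen {ι : Type} {S : Set E} {O : ι → Set E} (hO : ∀ i, IsOpen (O i))
    (hS : S ⊆ ⋃ i, O i) {n : ℕ} {c : Chn E} (hc : c ∈ Ch S n) :
    ∃ k₀, ∀ k ≥ k₀, SS k c ∈ ⨆ i, Ch (S ∩ O i) n := by
  rw [Ch, Finsupp.supported_eq_span_single] at hc
  induction hc using Submodule.span_induction with
  | mem x hx =>
    obtain ⟨⟨n, σ⟩, ⟨rfl, hf⟩, rfl⟩ := hx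
    exact SS_small_sx hO hS hf
  | zero => exact ⟨0, fun k _ => by simp⟩
  | add x y _ _ hx hy =>
    obtain ⟨k1, h1⟩ := hx
    obtain ⟨k2, h2⟩ := hy
    refine ⟨max k1 k2, fun k hk => ?_⟩
    rw [map_add]
    exact Submodule.add_mem _ (h1 k (le_trans (le_max_left _ _) hk))
      (h2 k (le_trans (le_max_right _ _) hk))
  | smul a x _ hx =>
    obtain ⟨k1, h1⟩ := hx
    exact ⟨k1, fun k hk => by rw [map_smul]; exact Submodule.smul_mem _ _ (h1 k hk)⟩

lemma SS_small {S O₁ O₂ : Set E} (h1 : IsOpen O₁) (h2 : IsOpen O₂) (hS : S ⊆ O₁ ∪ O₂) {n : ℕ}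
    {c : Chn E} (hc : c ∈ Ch S n) :
    ∃ k₀, ∀ k ≥ k₀, SS k c ∈ Ch (S ∩ O₁) n ⊔ Ch (S ∩ O₂) n := by
  have := SS_small_gen (O := fun b : Bool => bif b then O₁ else O₂) (S := S)
    (fun b => by cases b; exacts [h2, h1])
    (fun x hx => Set.mem_iUnion.2 (by
      rcases hS hx with h | h
      · exact ⟨true, h⟩
      · exact ⟨false, h⟩)) hc
  simpa only [iSup_bool_eq, cond_true, cond_false] using this

/-- Subdivision lemma. -/
lemma subdiv {S O₁ O₂ : Set E} (h1 : IsOpen O₁) (h2 : IsOpen O₂) (hS : S ⊆ O₁ ∪ O₂) {n : ℕ}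
    {c : Chn E} (hc : c ∈ Ch S n) : ∃ k, ∃ a ∈ Ch (S ∩ O₁) n, ∃ b ∈ Ch (S ∩ O₂) n,
      c = a + b + bd (TS k c) + TS k (bd c) := by
  obtain ⟨k, hk⟩ := SS_small h1 h2 hS hc
  obtain ⟨a, ha, b, hb, hab⟩ := Submodule.mem_sup.1 (hk k le_rfl)
  exact ⟨k, a, ha, b, hb, by rw [hab]; exact SS_eq k c⟩

end subdiv
end HV

namespace HV

section general
variable {E : Type} [TopologicalSpace E]

/-- Vanishing homology. -/
def Van (S : Set E) (i : ℕ) : Prop := ∀ c ∈ Ch S i, bd c = 0 → ∃ b ∈ Ch S (i+1), bd b = c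

/-- Vanishing relative homology. -/
def VanRel (S T : Set E) (i : ℕ) : Prop :=
  ∀ c ∈ Ch S i, bd c ∈ ChT T → ∃ b ∈ Ch S (i+1), c - bd b ∈ ChT T

/-- Relatively open subsets. -/
def RelOpen (S A : Set E) : Prop := ∃ O, IsOpen O ∧ A = S ∩ O

lemma RelOpen.subset {S A : Set E} (h : RelOpen S A) : A ⊆ S := by
  obtain ⟨O, _, rfl⟩ := h; exact Set.inter_subset_left

lemma relOpen_of_isOpen {S A : Set E} (h : IsOpen A) (hA : A ⊆ S) : RelOpen S A :=
  ⟨A, h, (Set.inter_eq_right.2 hA).symm⟩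

lemma subdivR {S A B : Set E} (hA : RelOpen S A) (hB : RelOpen S B) (hS : S ⊆ A ∪ B) {n : ℕ}
    {c : Chn E} (hc : c ∈ Ch S n) : ∃ k, ∃ a ∈ Ch A n, ∃ b ∈ Ch B n,
      c = a + b + bd (TS k c) + TS k (bd c) := by
  obtain ⟨O₁, h1, rfl⟩ := hA
  obtain ⟨O₂, h2, rfl⟩ := hB
  exact subdiv h1 h2 (hS.trans (Set.union_subset_union Set.inter_subset_right
    Set.inter_subset_right)) hc

lemma van_iff_vanRel_empty {S : Set E} {i : ℕ} : Van S i ↔ VanRel S ∅ i := by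
  constructor
  · intro h c hc hb
    obtain ⟨b, hb, hbc⟩ := h c hc (ChT_empty hb)
    exact ⟨b, hb, by simp [hbc]⟩
  · intro h c hc hb
    obtain ⟨b, hb, hbc⟩ := h c hc (by simp [hb])
    exact ⟨b, hb, (sub_eq_zero.1 (ChT_empty hbc)).symm⟩

lemma van_union {S U V : Set E} (hU : RelOpen S U) (hV : RelOpen S V) (hS : S ⊆ U ∪ V) {i : ℕ}
    (h1 : Van U (i+1)) (h2 : Van V (i+1)) (h3 : Van (U ∩ V) i) : Van S (i+1) := by
  intro c hc hbc
  obtain ⟨k, a, ha, b, hb, e⟩ := subdivR hU hV hS hc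
  rw [hbc, map_zero, add_zero] at e
  have e2 : bd a = - bd b := by
    have := congrArg bd e
    rw [map_add, map_add, bd_bd, hbc, add_zero] at this
    exact eq_neg_of_add_eq_zero_left this.symm
  have hm : bd a ∈ Ch (U ∩ V) i := mem_Ch_inter (bd_mem_Ch ha) (by
    rw [e2]; exact Submodule.neg_mem _ (Ch_le_ChT _ _ (bd_mem_Ch hb)))
  obtain ⟨x, hx, hxe⟩ := h3 _ hm (bd_bd a)
  obtain ⟨u, hu, hue⟩ := h1 (a - x) (Submodule.sub_mem _ ha (Ch_mono Set.inter_subset_left _ hx))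
    (by rw [map_sub, hxe, sub_self])
  obtain ⟨v, hv, hve⟩ := h2 (b + x) (Submodule.add_mem _ hb (Ch_mono Set.inter_subset_right _ hx))
    (by rw [map_add, hxe, e2, add_neg_cancel])
  refine ⟨u + v + TS k c, Submodule.add_mem _ (Submodule.add_mem _ (Ch_mono hU.subset _ hu)
    (Ch_mono hV.subset _ hv)) (TS_mem k hc), ?_⟩
  rw [map_add, map_add, hue, hve]
  conv_rhs => rw [e]
  abel

/-- Excision type lemma. -/
lemma vanRel_excision {S T U : Set E} (hU : RelOpen S U) (hT : RelOpen S T) (hS : S ⊆ U ∪ T) {i : ℕ}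
    (h : VanRel U (U ∩ T) i) : VanRel S T i := by
  intro c hc hbc
  obtain ⟨k, a, ha, b, hb, e⟩ := subdivR hU hT hS hc
  have hb' := Ch_le_ChT _ _ hb
  have h1 : bd a ∈ ChT T := by
    have : bd a = bd c - bd b - bd (TS k (bd c)) := by
      conv_rhs => enter [1,1]; rw [e]
      rw [map_add, map_add, map_add, bd_bd]; abel
    rw [this]
    exact Submodule.sub_mem _ (Submodule.sub_mem _ hbc (bd_mem_ChT hb'))
      (bd_mem_ChT (TS_memT k hbc))
  obtain ⟨x, hx, hxe⟩ := h a ha (mem_ChT_inter (bd_mem_ChT (Ch_le_ChT _ _ ha)) h1)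
  refine ⟨x + TS k c, Submodule.add_mem _ (Ch_mono hU.subset _ hx) (TS_mem k hc), ?_⟩
  have : c - bd (x + TS k c) = (a - bd x) + b + TS k (bd c) := by
    conv_lhs => enter [1]; rw [e]
    rw [map_add]; abel
  rw [this]
  exact Submodule.add_mem _ (Submodule.add_mem _ (ChT_mono Set.inter_subset_right hxe) hb')
    (TS_memT k hbc)

/-- Long exact sequence type lemma. -/
lemma vanRel_of_van {S T : Set E} (hT : T ⊆ S) {i : ℕ} (h1 : Van S (i+1)) (h2 : Van T i) :
    VanRel S T (i+1) := by
  intro c hc hbc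
  obtain ⟨x, hx, hxe⟩ := h2 (bd c) (mem_Ch_of_ChT (bd_mem_Ch hc) hbc) (bd_bd c)
  obtain ⟨y, hy, hye⟩ := h1 (c - x) (Submodule.sub_mem _ hc (Ch_mono hT _ hx))
    (by rw [map_sub, hxe, sub_self])
  exact ⟨y, hy, by rw [hye, sub_sub_cancel]; exact Ch_le_ChT _ _ hx⟩

/-- Triples. -/
lemma vanRel_trans {R S T : Set E} (hRS : S ⊆ R) {i : ℕ} (h1 : VanRel R S i)
    (h2 : VanRel S T i) (h3 : ∀ c ∈ Ch R i, bd c ∈ ChT T → bd c ∈ ChT S) : VanRel R T i := by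
  intro c hc hbc
  obtain ⟨x, hx, hxe⟩ := h1 c hc (h3 c hc hbc)
  obtain ⟨y, hy, hye⟩ := h2 (c - bd x) (mem_Ch_of_ChT (Submodule.sub_mem _ hc (bd_mem_Ch hx)) hxe)
    (by rw [map_sub, bd_bd, sub_zero]; exact hbc)
  refine ⟨x + y, Submodule.add_mem _ hx (Ch_mono hRS _ hy), ?_⟩
  rw [map_add, ← sub_sub]; exact hye

lemma vanRel_trans' {R S T : Set E} (hRS : S ⊆ R) (hTS : T ⊆ S) {i : ℕ} (h1 : VanRel R S i)
    (h2 : VanRel S T i) : VanRel R T i :=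
  vanRel_trans hRS h1 h2 fun c _ hc => ChT_mono hTS hc

/-- Relative Mayer-Vietoris: intersecting the small sets. -/
lemma vanRel_inter {S A B : Set E} (hA : RelOpen S A) (hB : RelOpen S B) {i : ℕ}
    (h1 : VanRel S A i) (h2 : VanRel S B i) (h3 : VanRel S (A ∪ B) (i+1)) :
    VanRel S (A ∩ B) i := by
  intro c hc hbc
  obtain ⟨b1, hb1, e1⟩ := h1 c hc (ChT_mono Set.inter_subset_left hbc)
  obtain ⟨b2, hb2, e2⟩ := h2 c hc (ChT_mono Set.inter_subset_right hbc)
  have hbb : bd (b1 - b2) ∈ ChT (A ∪ B) := by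
    have : bd (b1 - b2) = (c - bd b2) - (c - bd b1) := by rw [map_sub]; abel
    rw [this]
    exact Submodule.sub_mem _ (ChT_mono Set.subset_union_right e2)
      (ChT_mono Set.subset_union_left e1)
  obtain ⟨x, hx, hf⟩ := h3 (b1 - b2) (Submodule.sub_mem _ hb1 hb2) hbb
  set f := b1 - b2 - bd x with hfdef
  have hfm : f ∈ Ch (A ∪ B) (i+1) :=
    mem_Ch_of_ChT (Submodule.sub_mem _ (Submodule.sub_mem _ hb1 hb2) (bd_mem_Ch hx)) hf
  have hA' : RelOpen (A ∪ B) A := by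
    obtain ⟨O, hO, rfl⟩ := hA
    refine ⟨O, hO, ?_⟩
    ext z
    have := hB.subset (a := z)
    simp only [Set.mem_inter_iff, Set.mem_union]; tauto
  have hB' : RelOpen (A ∪ B) B := by
    obtain ⟨O, hO, rfl⟩ := hB
    refine ⟨O, hO, ?_⟩
    ext z
    have := hA.subset (a := z)
    simp only [Set.mem_inter_iff, Set.mem_union]; tauto
  obtain ⟨k, p, hp, q, hq, e⟩ := subdivR hA' hB' le_rfl hfm
  -- boundary of f
  have hbf : bd f = (c - bd b2) - (c - bd b1) := by
    rw [hfdef, map_sub, bd_bd, map_sub]; abel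
  have hp' := Ch_le_ChT _ _ hp
  have hq' := Ch_le_ChT _ _ hq
  refine ⟨b1 - (p - TS k (c - bd b1)), ?_, ?_⟩
  · refine Submodule.sub_mem _ hb1 (Submodule.sub_mem _ (Ch_mono hA.subset _ hp) (TS_mem k ?_))
    exact Submodule.sub_mem _ hc (bd_mem_Ch hb1)
  · refine mem_ChT_inter ?_ ?_
    · have : c - bd (b1 - (p - TS k (c - bd b1))) =
        (c - bd b1) + bd (p - TS k (c - bd b1)) := by rw [map_sub]; abel
      rw [this]
      exact Submodule.add_mem _ e1 (bd_mem_ChT (Submodule.sub_mem _ hp' (TS_memT k e1)))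
    · have h5 : bd f = bd p + bd q + bd (TS k (bd f)) := by
        conv_lhs => rw [e]
        rw [map_add, map_add, map_add, bd_bd, add_zero]
      have h6 : bd (TS k (bd f)) = bd (TS k (c - bd b2)) - bd (TS k (c - bd b1)) := by
        rw [hbf]; simp only [map_sub]
      have h7 : bd f = bd b1 - bd b2 := by rw [hbf]; abel
      have : c - bd (b1 - (p - TS k (c - bd b1))) =
        (c - bd b2) - bd q - bd (TS k (c - bd b2)) := by
        have h8 : bd p = bd b1 - bd b2 - bd q -
            (bd (TS k (c - bd b2)) - bd (TS k (c - bd b1))) := by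
          rw [← h7, ← h6]
          conv_rhs => enter [1,1]; rw [h5]
          abel
        rw [map_sub bd b1, map_sub bd p, h8]
        abel
      rw [this]
      exact Submodule.sub_mem _ (Submodule.sub_mem _ e2 (bd_mem_ChT hq'))
        (bd_mem_ChT (TS_memT k e2))

/-- Finite-dimensional homology. -/
def FD (S : Set E) (n : ℕ) : Prop := ∃ F : Submodule ℂ (Chn E), FiniteDimensional ℂ F ∧
  ∀ c ∈ Ch S n, bd c = 0 → ∃ b ∈ Ch S (n+1), c - bd b ∈ F

lemma exists_fd_lift {K V W C : Type*} [Field K] [AddCommGroup V] [Module K V] [AddCommGroup W]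
    [Module K W] [AddCommGroup C] [Module K C] [FiniteDimensional K W]
    (φ : V →ₗ[K] W) (a : V →ₗ[K] C) : ∃ F : Submodule K C, FiniteDimensional K F ∧
      ∀ p, ∃ q, φ q = φ p ∧ a q ∈ F := by
  obtain ⟨ψ, hψ⟩ := φ.rangeRestrict.exists_rightInverse_of_surjective
    (LinearMap.range_rangeRestrict φ)
  refine ⟨LinearMap.range (a ∘ₗ ψ), inferInstance, fun p => ⟨ψ (φ.rangeRestrict p), ?_, ?_⟩⟩
  · have := LinearMap.congr_fun hψ (φ.rangeRestrict p)
    exact congrArg Subtype.val this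
  · exact ⟨φ.rangeRestrict p, rfl⟩

lemma fd_union_aux {S U V : Set E} (hU : RelOpen S U) (hV : RelOpen S V) (hS : S ⊆ U ∪ V) {n : ℕ}
    (h1 : FD U n) (h2 : FD V n) (F' : Submodule ℂ (Chn E)) [FiniteDimensional ℂ F']
    (h3 : ∀ a ∈ Ch U n, ∀ b ∈ Ch V n, bd a = - bd b →
      ∃ x ∈ Ch (U ∩ V) n, bd a - bd x ∈ F') : FD S n := by
  obtain ⟨F1, hF1, hF1'⟩ := h1
  obtain ⟨F2, hF2, hF2'⟩ := h2
  -- pairs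
  let P : Submodule ℂ (Chn E × Chn E) :=
    ((Ch U n).prod (Ch V n)) ⊓ LinearMap.ker (bd ∘ₗ LinearMap.fst ℂ _ _ + bd ∘ₗ LinearMap.snd ℂ _ _)
      ⊓ F'.comap (bd ∘ₗ LinearMap.fst ℂ _ _)
  let φ : P →ₗ[ℂ] F' := ((bd ∘ₗ LinearMap.fst ℂ _ _).comp P.subtype).codRestrict F' (fun p => p.2.2)
  let addm : Chn E × Chn E →ₗ[ℂ] Chn E := LinearMap.fst ℂ _ _ + LinearMap.snd ℂ _ _
  obtain ⟨F3, hF3, hF3'⟩ := exists_fd_lift (K := ℂ) (V := P) (W := F') φ (addm ∘ₗ P.subtype)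
  refine ⟨F1 ⊔ F2 ⊔ F3, inferInstance, ?_⟩
  intro c hc hbc
  obtain ⟨k, a, ha, b, hb, e⟩ := subdivR hU hV hS hc
  rw [hbc, map_zero, add_zero] at e
  have e2 : bd a = - bd b := by
    have := congrArg bd e
    rw [map_add, map_add, bd_bd, hbc, add_zero] at this
    exact eq_neg_of_add_eq_zero_left this.symm
  obtain ⟨x, hx, hxF⟩ := h3 a ha b hb e2
  have hxU := Ch_mono Set.inter_subset_left _ hx
  have hxV := Ch_mono Set.inter_subset_right _ hx
  have hP : ((a - x, b + x) : Chn E × Chn E) ∈ P := by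
    refine ⟨⟨⟨Submodule.sub_mem _ ha hxU, Submodule.add_mem _ hb hxV⟩, ?_⟩, ?_⟩
    · simp [e2]
    · simpa using hxF
  let p : P := ⟨(a - x, b + x), hP⟩
  obtain ⟨q, hq, hqF⟩ := hF3' p
  have hq1 : bd q.1.1 = bd (a - x) := congrArg Subtype.val hq
  have hq0 : bd q.1.1 + bd q.1.2 = 0 := q.2.1.2
  have hq2 : bd q.1.2 = bd (b + x) := by
    have : bd (b + x) = - bd (a - x) := by rw [map_add, map_sub, e2]; abel
    rw [this, ← hq1]; exact eq_neg_of_add_eq_zero_right hq0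
  obtain ⟨u, hu, hue⟩ := hF1' (a - x - q.1.1) (Submodule.sub_mem _ (Submodule.sub_mem _ ha hxU)
    q.2.1.1.1) (by rw [map_sub, hq1, sub_self])
  obtain ⟨v, hv, hve⟩ := hF2' (b + x - q.1.2) (Submodule.sub_mem _ (Submodule.add_mem _ hb hxV)
    q.2.1.1.2) (by rw [map_sub, hq2, sub_self])
  refine ⟨u + v + TS k c, Submodule.add_mem _ (Submodule.add_mem _ (Ch_mono hU.subset _ hu)
    (Ch_mono hV.subset _ hv)) (TS_mem k hc), ?_⟩
  have : c - bd (u + v + TS k c) = (a - x - q.1.1 - bd u) + (b + x - q.1.2 - bd v) +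
      (q.1.1 + q.1.2) := by
    conv_lhs => enter [1]; rw [e]
    rw [map_add, map_add]; abel
  rw [this]
  refine Submodule.add_mem _ (Submodule.add_mem _ ?_ ?_) ?_
  · exact Submodule.mem_sup_left (Submodule.mem_sup_left hue)
  · exact Submodule.mem_sup_left (Submodule.mem_sup_right hve)
  · exact Submodule.mem_sup_right hqF

lemma fd_union {S U V : Set E} (hU : RelOpen S U) (hV : RelOpen S V) (hS : S ⊆ U ∪ V)
    (h1 : ∀ n, FD U n) (h2 : ∀ n, FD V n) (h3 : ∀ n, FD (U ∩ V) n) (n : ℕ) : FD S n := by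
  cases n with
  | zero =>
    refine fd_union_aux hU hV hS (h1 0) (h2 0) ⊥ fun a ha b hb _ => ⟨0, Submodule.zero_mem _, ?_⟩
    simp [bd_Ch_zero ha]
  | succ n =>
    obtain ⟨F, hF, hF'⟩ := h3 n
    refine fd_union_aux hU hV hS (h1 _) (h2 _) F fun a ha b hb hab => ?_
    exact hF' (bd a) (mem_Ch_inter (bd_mem_Ch ha) (by
      rw [hab]; exact Submodule.neg_mem _ (Ch_le_ChT _ _ (bd_mem_Ch hb)))) (bd_bd a)

end general

section convex
variable {V : Type} [NormedAddCommGroup V] [NormedSpace ℝ V]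

/-- Constant simplex. -/
noncomputable def csx (p : V) (n : ℕ) : Chn V := sx (n := n) (ContinuousMap.const _ p)

lemma bd_csx (p : V) (n : ℕ) : bd (csx p (n+1)) = if Even n then 0 else csx p n := by
  rw [csx, bd_sx_succ]
  have : ∀ i : Fin (n+2), sx ((ContinuousMap.const _ p : C(stdSimplex ℝ (Fin (n+1+1)), V)).comp
      (fmap i)) = csx p n := fun i => rfl
  simp only [this]
  rw [← Finset.sum_smul, Fin.sum_univ_eq_sum_range (fun i => (-1:ℂ)^i), neg_one_geom_sum]
  by_cases h : Even n
  · simp [h, Nat.even_add]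
  · simp [h, Nat.even_add]

lemma convex_cycle {S : Set V} (hS : Convex ℝ S) {p : V} (hp : p ∈ S) {n : ℕ} {c : Chn V}
    (hc : c ∈ Ch S n) (hbc : bd c = 0) :
    ∃ b ∈ Ch S (n+1), ∃ a : ℂ, c = bd b + a • csx p n := by
  let h : V × ℝ → V := fun q => (1 - q.2) • q.1 + q.2 • p
  have hh : ContinuousOn h (S ×ˢ Set.Icc (0:ℝ) 1) := by
    apply Continuous.continuousOn; fun_prop
  have key := homotopy_lemma hh (Ch_le_ChT _ _ hc)
  rw [hbc, map_zero, add_zero] at key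
  rw [push_id (S := Set.univ) (g := fun x => h (x, 0)) (fun x _ => by simp [h])
    (Ch_le_ChT _ _ (Ch_mono (Set.subset_univ _) _ hc))] at key
  have hconst : push (fun x => h (x, 1)) c ∈ Submodule.span ℂ {csx p n} := by
    refine Ch_map _ _ (fun σ hσ => ?_) hc
    have e : (fun x => h (x, 1)) ∘ σ = fun _ => p := by funext x; simp [h]
    have hcont : Continuous ((fun x => h (x, 1)) ∘ σ) := by rw [e]; exact continuous_const
    rw [push_sx hcont]
    refine Submodule.mem_span_singleton.2 ⟨1, ?_⟩
    rw [one_smul, csx]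
    congr 1
    ext x; exact (congrFun e x).symm
  obtain ⟨a, ha⟩ := Submodule.mem_span_singleton.1 hconst
  refine ⟨- sop prismOp h c, Submodule.neg_mem _ (sop_mem prismOp ?_ hc), a, ?_⟩
  · intro x hx t ht
    exact hS hx hp (by linarith [ht.2]) ht.1 (by ring)
  · rw [ha, map_neg, key]; abel

lemma csx_mem {S : Set V} {p : V} (hp : p ∈ S) (n : ℕ) : csx p n ∈ Ch S n :=
  sx_mem_Ch fun _ => hp

lemma csx_ne_zero (p : V) (n : ℕ) : csx p n ≠ 0 := by simp [csx, sx]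

lemma van_convex {S : Set V} (hS : Convex ℝ S) (n : ℕ) : Van S (n+1) := by
  intro c hc hbc
  rcases S.eq_empty_or_nonempty with rfl | ⟨p, hp⟩
  · rw [ChT_empty (Ch_le_ChT _ _ hc)]; exact ⟨0, Submodule.zero_mem _, by simp⟩
  obtain ⟨b, hb, a, e⟩ := convex_cycle hS hp hc hbc
  by_cases hn : Even n
  · refine ⟨b + a • csx p (n+2), Submodule.add_mem _ hb (Submodule.smul_mem _ _ (csx_mem hp _)), ?_⟩
    rw [map_add, map_smul, bd_csx, if_neg (by simpa [Nat.even_add_one] using hn), e]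
  · have h0 := congrArg bd e
    rw [hbc, map_add, bd_bd, zero_add, map_smul, bd_csx, if_neg hn] at h0
    have : a = 0 := by
      rcases smul_eq_zero.1 h0.symm with h | h
      · exact h
      · exact absurd h (csx_ne_zero p n)
    exact ⟨b, hb, by rw [e, this]; simp⟩

lemma fd_convex {S : Set V} (hS : Convex ℝ S) (n : ℕ) : FD S n := by
  rcases S.eq_empty_or_nonempty with rfl | ⟨p, hp⟩
  · exact ⟨⊥, inferInstance, fun c hc _ => ⟨0, Submodule.zero_mem _, by
      rw [ChT_empty (Ch_le_ChT _ _ hc)]; simp⟩⟩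
  · refine ⟨Submodule.span ℂ {csx p n}, inferInstance, fun c hc hbc => ?_⟩
    obtain ⟨b, hb, a, e⟩ := convex_cycle hS hp hc hbc
    exact ⟨b, hb, Submodule.mem_span_singleton.2 ⟨a, by rw [e]; abel⟩⟩

lemma fd_finite_union {ι : Type} (s : Finset ι) : ∀ (C : ι → Set V), (∀ i, IsOpen (C i)) →
    (∀ i, Convex ℝ (C i)) → ∀ n, FD (⋃ i ∈ s, C i) n := by
  classical
  induction s using Finset.induction_on with
  | empty => intro C _ _ n; simpa using fd_convex (convex_empty) n
  | insert j s hj ih =>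
    intro C hO hC n
    rw [Finset.set_biUnion_insert]
    have ho : IsOpen (⋃ i ∈ s, C i) := isOpen_biUnion fun i _ => hO i
    refine fd_union (relOpen_of_isOpen (hO j) Set.subset_union_left)
      (relOpen_of_isOpen ho Set.subset_union_right) le_rfl (fun n => fd_convex (hC j) n)
      (ih C hO hC) (fun n => ?_) n
    rw [Set.inter_iUnion₂]
    exact ih (fun i => C j ∩ C i) (fun i => (hO j).inter (hO i)) (fun i => (hC j).inter (hC i)) n

/-- Neighbourhood retract. -/
def ENR (X : Set V) : Prop := ∃ O : Set V, IsOpen O ∧ X ⊆ O ∧ ∃ r : V → V, ContinuousOn r O ∧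
  (∀ x ∈ O, r x ∈ X) ∧ ∀ x ∈ X, r x = x

lemma fd_enr {X : Set V} (hX : IsCompact X) (h : ENR X) (n : ℕ) : FD X n := by
  obtain ⟨O, hO, hXO, r, hr, hrX, hrid⟩ := h
  have hε : ∀ x : V, ∃ ε > 0, x ∈ X → Metric.ball x ε ⊆ O := by
    intro x
    by_cases hx : x ∈ X
    · obtain ⟨ε, h1, h2⟩ := Metric.isOpen_iff.1 hO x (hXO hx)
      exact ⟨ε, h1, fun _ => h2⟩
    · exact ⟨1, one_pos, fun h => absurd h hx⟩
  choose ε hε0 hε using hε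
  obtain ⟨t, ht, hXt⟩ := hX.elim_nhds_subcover (fun x => Metric.ball x (ε x))
    (fun x _ => Metric.ball_mem_nhds x (hε0 x))
  have hUO : (⋃ x ∈ t, Metric.ball x (ε x)) ⊆ O := Set.iUnion₂_subset fun x hx => hε x (ht x hx)
  obtain ⟨F, hF, hF'⟩ := fd_finite_union t (fun x : V => Metric.ball x (ε x))
    (fun _ => Metric.isOpen_ball) (fun _ => convex_ball _ _) n
  refine ⟨F.map (push r), inferInstance, fun c hc hbc => ?_⟩
  obtain ⟨b, hb, hbF⟩ := hF' c (Ch_mono hXt _ hc) hbc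
  have hb' := Ch_mono hUO _ hb
  refine ⟨push r b, push_mem hrX hb', ?_⟩
  refine ⟨c - bd b, hbF, ?_⟩
  rw [map_sub, push_id hrid (Ch_le_ChT _ _ hc), bd_push hr (Ch_le_ChT _ _ hb')]

end convex

end HV

namespace HV

section boxes
variable {m : ℕ}

/-- Points of `C` violating one of the box inequalities with index in `J`. -/
def DJ (a b : Fin m → ℝ) (J : Finset (Fin m)) (C : Set (Fin m → ℝ)) : Set (Fin m → ℝ) :=
  {x | x ∈ C ∧ ∃ j ∈ J, x j < a j ∨ b j < x j}

lemma convex_lo (C : Set (Fin m → ℝ)) (hC : Convex ℝ C) (j : Fin m) (r : ℝ) :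
    Convex ℝ (C ∩ {x | x j < r}) :=
  hC.inter (convex_halfSpace_lt (LinearMap.isLinear (LinearMap.proj (R := ℝ) (φ := fun _ => ℝ) j)) r)

lemma convex_hi (C : Set (Fin m → ℝ)) (hC : Convex ℝ C) (j : Fin m) (r : ℝ) :
    Convex ℝ (C ∩ {x | r < x j}) :=
  hC.inter (convex_halfSpace_gt (LinearMap.isLinear (LinearMap.proj (R := ℝ) (φ := fun _ => ℝ) j)) r)

lemma isOpen_DJ (a b : Fin m → ℝ) (J : Finset (Fin m)) {C : Set (Fin m → ℝ)} (hC : IsOpen C) :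
    IsOpen (DJ a b J C) := by
  have : DJ a b J C = C ∩ ⋃ j ∈ J, ({x | x j < a j} ∪ {x | b j < x j}) := by
    ext x; simp [DJ]
  rw [this]
  refine hC.inter (isOpen_biUnion fun j _ => IsOpen.union ?_ ?_)
  · exact isOpen_lt (continuous_apply j) continuous_const
  · exact isOpen_lt continuous_const (continuous_apply j)

lemma van_DJ (a b : Fin m → ℝ) (hab : a ≤ b) (J : Finset (Fin m)) : ∀ (C : Set (Fin m → ℝ)),
    IsOpen C → Convex ℝ C → ∀ i, J.card ≤ i → Van (DJ a b J C) i := by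
  classical
  induction J using Finset.induction_on with
  | empty =>
    intro C _ _ i _ c hc hbc
    have : DJ a b ∅ C = ∅ := by ext; simp [DJ]
    rw [this] at hc ⊢
    exact ⟨0, Submodule.zero_mem _, by rw [ChT_empty (Ch_le_ChT _ _ hc), map_zero]⟩
  | insert j J hj ih =>
    intro C hO hC i hi
    rw [Finset.card_insert_of_notMem hj] at hi
    obtain ⟨i, rfl⟩ : ∃ i', i = i' + 1 := ⟨i-1, by omega⟩
    set Pm := C ∩ {x | x j < a j}
    set Pp := C ∩ {x | b j < x j}
    have hPm : IsOpen Pm := hO.inter (isOpen_lt (continuous_apply j) continuous_const)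
    have hPp : IsOpen Pp := hO.inter (isOpen_lt continuous_const (continuous_apply j))
    have hD := isOpen_DJ a b J hO
    have v1 : Van (DJ a b J C ∪ Pm) (i+1) := by
      refine van_union (relOpen_of_isOpen hD Set.subset_union_left)
        (relOpen_of_isOpen hPm Set.subset_union_right) subset_rfl (ih C hO hC _ (by omega))
        (van_convex (convex_lo C hC _ _) _) ?_
      have : DJ a b J C ∩ Pm = DJ a b J Pm := by
        ext x; simp only [DJ, Pm, Set.mem_inter_iff, Set.mem_setOf_eq]
        generalize (∃ j ∈ J, x j < a j ∨ b j < x j) = Q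
        tauto
      rw [this]
      exact ih _ hPm (convex_lo C hC _ _) i (by omega)
    have e : DJ a b (insert j J) C = (DJ a b J C ∪ Pm) ∪ Pp := by
      ext x; simp only [DJ, Pm, Pp, Set.mem_inter_iff, Set.mem_setOf_eq, Set.mem_union,
        Finset.mem_insert, exists_eq_or_imp]
      generalize (∃ j ∈ J, x j < a j ∨ b j < x j) = Q
      tauto
    rw [e]
    refine van_union (relOpen_of_isOpen (hD.union hPm) Set.subset_union_left)
      (relOpen_of_isOpen hPp Set.subset_union_right) subset_rfl v1
        (van_convex (convex_hi C hC _ _) _) ?_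
    have : (DJ a b J C ∪ Pm) ∩ Pp = DJ a b J Pp := by
      ext x; simp only [DJ, Pm, Pp, Set.mem_inter_iff, Set.mem_setOf_eq, Set.mem_union]
      constructor
      · rintro ⟨h | h, h'⟩
        · exact ⟨h', h.2⟩
        · exact absurd (h.2.trans_le (hab j)) (not_lt.2 h'.2.le)
      · rintro ⟨h, h'⟩
        exact ⟨Or.inl ⟨h.1, h'⟩, h⟩
    rw [this]
    exact ih _ hPp (convex_hi C hC _ _) i (by omega)

lemma vanRel_self {E : Type} [TopologicalSpace E] (S : Set E) (i : ℕ) : VanRel S S i :=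
  fun c hc _ => ⟨0, Submodule.zero_mem _, by simpa using Ch_le_ChT _ _ hc⟩

lemma vanRel_box (a b : Fin m → ℝ) {C : Set (Fin m → ℝ)} (hO : IsOpen C) (hC : Convex ℝ C) {i : ℕ}
    (hi : m < i) : VanRel C (C \ Set.Icc a b) i := by
  obtain ⟨i, rfl⟩ : ∃ i', i = i' + 1 := ⟨i-1, by omega⟩
  by_cases hab : a ≤ b
  · refine vanRel_of_van Set.diff_subset (van_convex hC _) ?_
    have : C \ Set.Icc a b = DJ a b Finset.univ C := by
      ext x
      simp only [DJ, Set.mem_diff, Set.mem_Icc, Set.mem_setOf_eq, Finset.mem_univ, true_and,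
        Pi.le_def, not_and_or, not_forall, not_le, exists_or]
    rw [this]
    exact van_DJ a b hab _ C hO hC i (by simp; omega)
  · rw [Set.Icc_eq_empty hab, Set.diff_empty]; exact vanRel_self _ _
end boxes

section cover
variable {E : Type} [TopologicalSpace E] {m : ℕ}

/-- Evenly covered set. -/
def EC (M : Set E) (p : E → Fin m → ℝ) (d : ℕ) (U : Set (Fin m → ℝ))
    (s : Fin d → (Fin m → ℝ) → E) : Prop :=
  (∀ i, ContinuousOn (s i) U) ∧ (∀ i, ∀ y ∈ U, s i y ∈ M ∧ p (s i y) = y) ∧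
  (∀ x ∈ M, p x ∈ U → ∃ i, s i (p x) = x) ∧ (∀ i j, ∀ y ∈ U, s i y = s j y → i = j)

/-- Finite covering of degree `d` of an open set of `ℝ^m`. -/
structure FinCover (M : Set E) (G : Set (Fin m → ℝ)) (p : E → Fin m → ℝ) (d : ℕ) : Prop where
  cont : ContinuousOn p M
  maps : ∀ x ∈ M, p x ∈ G
  opn : IsOpen G
  loc : ∀ y ∈ G, ∃ U, IsOpen U ∧ y ∈ U ∧ U ⊆ G ∧ ∃ s, EC M p d U s

lemma EC.mono {M : Set E} {p : E → Fin m → ℝ} {d : ℕ} {U U' : Set (Fin m → ℝ)}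
    {s : Fin d → (Fin m → ℝ) → E} (h : EC M p d U s) (hU : U' ⊆ U) : EC M p d U' s :=
  ⟨fun i => (h.1 i).mono hU, fun i y hy => h.2.1 i y (hU hy), fun x hx hp => h.2.2.1 x hx (hU hp),
    fun i j y hy => h.2.2.2 i j y (hU hy)⟩

instance simplex_preconn (n : ℕ) : PreconnectedSpace (stdSimplex ℝ (Fin (n+1))) :=
  isPreconnected_iff_preconnectedSpace.1 (convex_stdSimplex ℝ _).isPreconnected

variable [T2Space E]

/-- A continuous lift stays in one sheet. -/
lemma lift_sheet {M : Set E} {p : E → Fin m → ℝ} {d : ℕ} {U : Set (Fin m → ℝ)}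
    {s : Fin d → (Fin m → ℝ) → E} (h : EC M p d U s) (hp : ContinuousOn p M) {n : ℕ}
    (τ : C(stdSimplex ℝ (Fin (n+1)), E)) (hτ : ∀ x, τ x ∈ M) (hU : ∀ x, p (τ x) ∈ U) :
    ∃ i, ∀ x, s i (p (τ x)) = τ x := by
  classical
  have hpc : Continuous (p ∘ τ) := cont_on_comp hp hτ
  have hsc : ∀ i, Continuous (s i ∘ (p ∘ τ)) := fun i => (h.1 i).comp_continuous hpc hU
  let F : Fin d → Set (stdSimplex ℝ (Fin (n+1))) := fun i => {x | s i (p (τ x)) = τ x}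
  have hF : ∀ i, IsClosed (F i) := fun i => isClosed_eq (hsc i) τ.continuous
  have hFo : ∀ i, IsOpen (F i) := by
    intro i
    have : F i = (⋃ j ∈ (Finset.univ.erase i), F j)ᶜ := by
      ext x
      simp only [Set.mem_compl_iff, Set.mem_iUnion, Finset.mem_erase, Finset.mem_univ, and_true,
        not_exists]
      constructor
      · intro hi j hj hj'
        exact hj (h.2.2.2 j i _ (hU x) (hj'.trans hi.symm))
      · intro hj
        obtain ⟨j, hj'⟩ := h.2.2.1 _ (hτ x) (hU x)
        by_cases e : j = i
        · subst e; exact hj'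
        · exact absurd hj' (hj j e)
    rw [this]
    exact (isClosed_biUnion_finset fun j _ => hF j).isOpen_compl
  let x0 : stdSimplex ℝ (Fin (n+1)) := ⟨_, vert_mem (n+1) 0⟩
  obtain ⟨i, hi⟩ := h.2.2.1 _ (hτ x0) (hU x0)
  refine ⟨i, fun x => ?_⟩
  have : F i = Set.univ := IsClopen.eq_univ ⟨hF i, hFo i⟩ ⟨x0, hi⟩
  exact Set.eq_univ_iff_forall.1 this x

/-- Restriction to a sheet. -/
noncomputable def shp (s : (Fin m → ℝ) → E) (p : E → Fin m → ℝ) : Chn E →ₗ[ℂ] Chn E :=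
  open Classical in cext fun n τ => if ∀ x, s (p (τ x)) = τ x then sx τ else 0

lemma shp_sx (s : (Fin m → ℝ) → E) (p : E → Fin m → ℝ) {n : ℕ}
    (τ : C(stdSimplex ℝ (Fin (n+1)), E)) : open Classical in
    shp s p (sx τ) = if ∀ x, s (p (τ x)) = τ x then sx τ else 0 := by
  simp [shp]

lemma vanRel_sheets {M : Set E} {p : E → Fin m → ℝ} {d : ℕ} {U : Set (Fin m → ℝ)}
    {s : Fin d → (Fin m → ℝ) → E} (h : EC M p d U s) (hp : ContinuousOn p M) {T : Set (Fin m → ℝ)}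
    (hT : T ⊆ U) {i : ℕ} (hv : VanRel U T i) : VanRel (M ∩ p ⁻¹' U) (M ∩ p ⁻¹' T) i := by
  classical
  intro c hc hbc
  have hpU : ContinuousOn p (M ∩ p ⁻¹' U) := hp.mono Set.inter_subset_left
  have hq : ∀ j, push (s j) (push p (shp (s j) p c)) = shp (s j) p c := by
    intro j
    refine ChT_ext (A := (push (s j)) ∘ₗ (push p) ∘ₗ (shp (s j) p)) (B := shp (s j) p) ?_
      (Ch_le_ChT _ _ hc)
    intro n σ hσ
    simp only [LinearMap.comp_apply, shp_sx]
    split_ifs with hs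
    · rw [push_push hpU (sx_mem_ChT hσ)]
      refine push_id (S := Set.range σ) ?_ (sx_mem_ChT fun x => ⟨x, rfl⟩)
      rintro _ ⟨x, rfl⟩; exact hs x
    · simp
  have hbq : ∀ j, bd (shp (s j) p c) = shp (s j) p (bd c) := by
    intro j
    refine ChT_ext (A := bd ∘ₗ (shp (s j) p)) (B := shp (s j) p ∘ₗ bd) ?_ (Ch_le_ChT _ _ hc)
    intro n σ hσ
    simp only [LinearMap.comp_apply, shp_sx]
    cases n with
    | zero => split_ifs <;> simp [bd_sx_zero]
    | succ n =>
      obtain ⟨i, hi⟩ := lift_sheet h hp σ (fun x => (hσ x).1) (fun x => (hσ x).2)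
      have key : ∀ {k : ℕ} (f : C(stdSimplex ℝ (Fin (k+1)), stdSimplex ℝ (Fin (n+1+1)))),
          (∀ x, s j (p ((σ.comp f) x)) = (σ.comp f) x) ↔ j = i := by
        intro k f
        constructor
        · intro hx
          let x0 : stdSimplex ℝ (Fin (k+1)) := ⟨_, vert_mem (k+1) 0⟩
          exact h.2.2.2 _ _ _ (hσ (f x0)).2 ((hx x0).trans (hi (f x0)).symm)
        · rintro rfl x; exact hi _
      have key0 : (∀ x, s j (p (σ x)) = σ x) ↔ j = i := key (ContinuousMap.id _)
      rw [bd_sx_succ, map_sum]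
      simp only [map_smul, shp_sx, key, key0]
      split_ifs
      · exact bd_sx_succ σ
      · simp
  have hsum : ∑ j, shp (s j) p c = c := by
    rw [← LinearMap.sum_apply]
    refine ChT_ext (A := ∑ j, shp (s j) p) (B := LinearMap.id) ?_ (Ch_le_ChT _ _ hc)
    intro n σ hσ
    obtain ⟨i, hi⟩ := lift_sheet h hp σ (fun x => (hσ x).1) (fun x => (hσ x).2)
    let x0 : stdSimplex ℝ (Fin (n+1)) := ⟨_, vert_mem (n+1) 0⟩
    rw [LinearMap.sum_apply, Finset.sum_eq_single i]
    · rw [shp_sx, if_pos hi]; rfl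
    · intro j _ hj
      rw [shp_sx, if_neg]
      intro hx
      exact hj (h.2.2.2 _ _ _ (hσ x0).2 ((hx x0).trans (hi x0).symm))
    · simp
  have hsm : ∀ j {T' : Set E} {k : ℕ} {c' : Chn E}, c' ∈ Ch T' k → shp (s j) p c' ∈ Ch T' k := by
    intro j T' k c' hc'
    refine Ch_map _ _ ?_ hc'
    intro σ hσ
    rw [shp_sx]; split_ifs
    · exact sx_mem_Ch hσ
    · exact Submodule.zero_mem _
  have hsmT : ∀ j {T' : Set E} {c' : Chn E}, c' ∈ ChT T' → shp (s j) p c' ∈ ChT T' := by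
    intro j T' c' hc'
    refine ChT_map _ _ ?_ hc'
    intro n σ hσ
    rw [shp_sx]; split_ifs
    · exact sx_mem_ChT hσ
    · exact Submodule.zero_mem _
  have main : ∀ j, ∃ b ∈ Ch (M ∩ p ⁻¹' U) (i+1), shp (s j) p c - bd b ∈ ChT (M ∩ p ⁻¹' T) := by
    intro j
    have h1 : push p (shp (s j) p c) ∈ Ch U i := push_mem (fun x hx => hx.2) (hsm j hc)
    have h2 : bd (push p (shp (s j) p c)) ∈ ChT T := by
      rw [bd_push hpU (Ch_le_ChT _ _ (hsm j hc)), hbq]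
      exact push_memT (fun x hx => hx.2) (hsmT j hbc)
    obtain ⟨b, hb, hbe⟩ := hv _ h1 h2
    have hsj : ∀ y ∈ U, s j y ∈ M ∩ p ⁻¹' U := fun y hy => ⟨(h.2.1 j y hy).1, by
      show p (s j y) ∈ U
      rw [(h.2.1 j y hy).2]; exact hy⟩
    refine ⟨push (s j) b, push_mem hsj hb, ?_⟩
    have hsj' : ∀ y ∈ T, s j y ∈ M ∩ p ⁻¹' T := fun y hy => ⟨(h.2.1 j y (hT hy)).1, by
      show p (s j y) ∈ T
      rw [(h.2.1 j y (hT hy)).2]; exact hy⟩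
    rw [bd_push (h.1 j) (Ch_le_ChT _ _ hb), ← hq j, ← map_sub]
    exact push_memT hsj' hbe
  choose b hb hbe using main
  refine ⟨∑ j, b j, Submodule.sum_mem _ fun j _ => hb j, ?_⟩
  conv => enter [2, 1]; rw [← hsum]
  rw [map_sum, ← Finset.sum_sub_distrib]
  exact Submodule.sum_mem _ fun j _ => hbe j

lemma relOpen_preimage {M : Set E} {p : E → Fin m → ℝ} (hp : ContinuousOn p M)
    {U : Set (Fin m → ℝ)} (hU : IsOpen U) : RelOpen M (M ∩ p ⁻¹' U) := by
  obtain ⟨u, hu, e⟩ := continuousOn_iff'.1 hp U hU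
  exact ⟨u, hu, by rw [Set.inter_comm, e, Set.inter_comm]⟩

lemma vanRel_onebox {M : Set E} {G : Set (Fin m → ℝ)} {p : E → Fin m → ℝ} {d : ℕ}
    (h : FinCover M G p d) {U : Set (Fin m → ℝ)} (hU : IsOpen U) (hUc : Convex ℝ U)
    {s : Fin d → (Fin m → ℝ) → E} (hs : EC M p d U s)
    {a b : Fin m → ℝ} (hB : Set.Icc a b ⊆ U) {i : ℕ} (hi : m < i) :
    VanRel M (M ∩ p ⁻¹' (Set.Icc a b)ᶜ) i := by
  refine vanRel_excision (relOpen_preimage h.cont hU)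
    (relOpen_preimage h.cont isClosed_Icc.isOpen_compl) ?_ ?_
  · intro x hx
    by_cases hxb : p x ∈ Set.Icc a b
    · exact Or.inl ⟨hx, hB hxb⟩
    · exact Or.inr ⟨hx, hxb⟩
  · have := vanRel_sheets hs h.cont (T := U \ Set.Icc a b) Set.diff_subset (vanRel_box a b hU hUc hi)
    convert this using 1
    ext x; simp only [Set.mem_inter_iff, Set.mem_preimage, Set.mem_compl_iff, Set.mem_diff]; tauto

lemma vanRel_boxes {M : Set E} {G : Set (Fin m → ℝ)} {p : E → Fin m → ℝ} {d : ℕ}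
    (h : FinCover M G p d) {ι : Type} (t : Finset ι) : ∀ (a b : ι → Fin m → ℝ),
    (∀ l ∈ t, ∃ U, IsOpen U ∧ Convex ℝ U ∧ (∃ s, EC M p d U s) ∧ Set.Icc (a l) (b l) ⊆ U) →
    ∀ i, m < i → VanRel M (M ∩ p ⁻¹' (⋃ l ∈ t, Set.Icc (a l) (b l))ᶜ) i := by
  classical
  induction t using Finset.induction_on with
  | empty =>
    intro a b _ i _
    simpa using vanRel_self M i
  | insert l t hl ih =>
    intro a b hab i hi
    have hcl : IsClosed (⋃ k ∈ t, Set.Icc (a k) (b k)) :=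
      isClosed_biUnion_finset fun _ _ => isClosed_Icc
    obtain ⟨U, hU, hUc, ⟨s, hs⟩, hB⟩ := hab l (Finset.mem_insert_self _ _)
    have v1 := ih a b (fun k hk => hab k (Finset.mem_insert_of_mem hk)) i hi
    have v2 := vanRel_onebox h hU hUc hs hB hi
    have v3 := ih (fun k => a k ⊔ a l) (fun k => b k ⊓ b l) (fun k hk => by
      obtain ⟨U', h1, h2, h3, h4⟩ := hab k (Finset.mem_insert_of_mem hk)
      exact ⟨U', h1, h2, h3, (Set.Icc_subset_Icc le_sup_left inf_le_left).trans h4⟩) (i+1) (by omega)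
    have := vanRel_inter (relOpen_preimage h.cont isClosed_Icc.isOpen_compl)
      (relOpen_preimage h.cont hcl.isOpen_compl) v2 v1 (by
        convert v3 using 1
        simp only [← Set.Icc_inter_Icc]
        ext x
        simp only [Set.mem_union, Set.mem_inter_iff, Set.mem_preimage, Set.mem_compl_iff,
          Set.mem_iUnion, not_exists]
        constructor
        · rintro (⟨h1, h2⟩ | ⟨h1, h2⟩)
          · exact ⟨h1, fun k hk h3 => h2 h3.2⟩
          · exact ⟨h1, fun k hk h3 => h2 k hk h3.1⟩
        · rintro ⟨h1, h2⟩
          by_cases hx : p x ∈ Set.Icc (a l) (b l)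
          · exact Or.inr ⟨h1, fun k hk h3 => h2 k hk ⟨h3, hx⟩⟩
          · exact Or.inl ⟨h1, hx⟩)
    convert this using 1
    ext x
    simp only [Finset.mem_insert, Set.iUnion_iUnion_eq_or_left, Set.mem_inter_iff, Set.mem_preimage,
      Set.mem_compl_iff, Set.mem_union]
    tauto

end cover
end HV

namespace HV

section ndr
variable {V : Type} [NormedAddCommGroup V] [NormedSpace ℝ V]

lemma ndr {X A : Set V} (hAc : IsCompact A) (hX : ENR X) (hA : ENR A) (hAX : A ⊆ X)
    {O : Set V} (hO : IsOpen O) (hAO : A ⊆ O) :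
    ∃ O' : Set V, IsOpen O' ∧ A ⊆ O' ∧ ∃ h : V × ℝ → V,
      ContinuousOn h ((X ∩ O') ×ˢ Set.Icc (0:ℝ) 1) ∧
      (∀ x ∈ X ∩ O', ∀ t ∈ Set.Icc (0:ℝ) 1, h (x, t) ∈ X ∩ O) ∧
      (∀ x ∈ X ∩ O', h (x, 0) = x) ∧ (∀ x ∈ X ∩ O', h (x, 1) ∈ A) ∧
      (∀ x ∈ A, ∀ t, h (x, t) = x) := by
  obtain ⟨OX, hOX, hXO, rX, hrX, hrX1, hrX2⟩ := hX
  obtain ⟨OA, hOA, hAOA, rA, hrA, hrA1, hrA2⟩ := hA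
  let g : V × ℝ → V := fun q => (1 - q.2) • q.1 + q.2 • rA q.1
  have hg : ContinuousOn g (OA ×ˢ Set.univ) := by
    have h1 : ContinuousOn (fun q : V × ℝ => rA q.1) (OA ×ˢ Set.univ) :=
      hrA.comp continuousOn_fst fun q hq => hq.1
    have h2 : Continuous (fun q : V × ℝ => (1 - q.2) • q.1) := by fun_prop
    exact h2.continuousOn.add (continuousOn_snd.smul h1)
  have hop : IsOpen (OA ×ˢ (Set.univ : Set ℝ)) := hOA.prod isOpen_univ
  have hΩ1 : IsOpen ((OA ×ˢ (Set.univ : Set ℝ)) ∩ g ⁻¹' OX) := hg.isOpen_inter_preimage hop hOX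
  have hrg : ContinuousOn (fun q => rX (g q)) ((OA ×ˢ (Set.univ : Set ℝ)) ∩ g ⁻¹' OX) :=
    hrX.comp (hg.mono Set.inter_subset_left) fun q hq => hq.2
  have hΩ2 := hrg.isOpen_inter_preimage hΩ1 hO
  set Ω := ((OA ×ˢ (Set.univ : Set ℝ)) ∩ g ⁻¹' OX) ∩ (fun q => rX (g q)) ⁻¹' O
  have hgA : ∀ x ∈ A, ∀ t, g (x, t) = x := by
    intro x hx t
    show (1 - t) • x + t • rA x = x
    rw [hrA2 x hx, ← add_smul]; simp
  have hsub : A ×ˢ Set.Icc (0:ℝ) 1 ⊆ Ω := by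
    rintro ⟨x, t⟩ ⟨hx, ht⟩
    simp only at hx
    refine ⟨⟨⟨hAOA hx, trivial⟩, ?_⟩, ?_⟩
    · show g (x, t) ∈ OX
      rw [hgA x hx]; exact hXO (hAX hx)
    · show rX (g (x, t)) ∈ O
      rw [hgA x hx, hrX2 x (hAX hx)]; exact hAO hx
  obtain ⟨u, v, hu, hv, hAu, hIv, huv⟩ := generalized_tube_lemma hAc isCompact_Icc hΩ2 hsub
  refine ⟨u, hu, hAu, fun q => rX (g q), hrg.mono ?_, ?_, ?_, ?_, ?_⟩
  · exact fun q hq => (huv ⟨hq.1.2, hIv hq.2⟩).1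
  · intro x hx t ht
    have := huv (show (x, t) ∈ u ×ˢ v from ⟨hx.2, hIv ht⟩)
    exact ⟨hrX1 _ this.1.2, this.2⟩
  · intro x hx
    show rX ((1 - 0) • x + (0:ℝ) • rA x) = x
    simp [hrX2 x hx.1]
  · intro x hx
    have := huv (show (x, (1:ℝ)) ∈ u ×ˢ v from ⟨hx.2, hIv (by simp)⟩)
    have h2 := hrA1 x this.1.1.1
    show rX ((1 - 1) • x + (1:ℝ) • rA x) ∈ A
    simpa [hrX2 _ (hAX h2)] using h2
  · intro x hx t
    show rX (g (x, t)) = x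
    rw [hgA x hx, hrX2 x (hAX hx)]

variable {m : ℕ}

lemma Icc_sub_ball (y : Fin m → ℝ) {ε : ℝ} (hε : 0 < ε) :
    Set.Icc (fun i => y i - ε/2) (fun i => y i + ε/2) ⊆ Metric.ball y ε := by
  intro x hx
  rw [Metric.mem_ball, dist_pi_lt_iff hε]
  intro i
  have h1 := hx.1 i
  have h2 := hx.2 i
  simp only at h1 h2
  rw [Real.dist_eq, abs_lt]; constructor <;> linarith

lemma Icc_nhds (y : Fin m → ℝ) {ε : ℝ} (hε : 0 < ε) :
    Set.Icc (fun i => y i - ε/2) (fun i => y i + ε/2) ∈ nhds y := by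
  refine Filter.mem_of_superset (Metric.ball_mem_nhds y (half_pos hε)) ?_
  intro x hx
  rw [Metric.mem_ball, dist_pi_lt_iff (half_pos hε)] at hx
  constructor <;> intro i <;> have := hx i <;> rw [Real.dist_eq, abs_lt] at this <;> simp only <;> linarith

lemma vanRel_pair {X A : Set V} (hXc : IsCompact X) (hAc : IsCompact A) (hX : ENR X) (hA : ENR A)
    (hAX : A ⊆ X) {G : Set (Fin m → ℝ)} {p : V → Fin m → ℝ} {d : ℕ}
    (hM : FinCover (X \ A) G p d) {i : ℕ} (hi : m < i) : VanRel X A i := by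
  classical
  obtain ⟨O', hO', hAO', h, hh, hh1, hh2, hh3, hh4⟩ := ndr hAc hX hA hAX isOpen_univ (Set.subset_univ _)
  have hsub : X \ O' ⊆ X \ A := fun x hx => ⟨hx.1, fun hA => hx.2 (hAO' hA)⟩
  have hKc : IsCompact (p '' (X \ O')) := (hXc.diff hO').image_of_continuousOn (hM.cont.mono hsub)
  have hK : ∀ y ∈ p '' (X \ O'), ∃ ε : ℝ, 0 < ε ∧ ∃ s, EC (X \ A) p d (Metric.ball y ε) s := by
    rintro _ ⟨x, hx, rfl⟩
    obtain ⟨U, hU, hyU, -, s, hs⟩ := hM.loc _ (hM.maps x (hsub hx))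
    obtain ⟨ε, hε, hb⟩ := Metric.isOpen_iff.1 hU _ hyU
    exact ⟨ε, hε, s, hs.mono hb⟩
  choose! ε hε s hs using hK
  obtain ⟨t, ht1, ht2⟩ := hKc.elim_nhds_subcover (fun y => Set.Icc (fun i => y i - ε y/2)
    (fun i => y i + ε y/2)) (fun y hy => Icc_nhds y (hε y hy))
  set K := ⋃ l ∈ t, Set.Icc (fun i => l i - ε l/2) (fun i => l i + ε l/2) with hKdef
  have vM := vanRel_boxes hM t (fun y i => y i - ε y/2) (fun y i => y i + ε y/2) (fun y hy =>
    ⟨Metric.ball y (ε y), Metric.isOpen_ball, convex_ball _ _, ⟨s y, hs y (ht1 y hy)⟩,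
      Icc_sub_ball y (hε y (ht1 y hy))⟩) i hi
  -- the preimage of K is closed
  have hcl : IsClosed ((X \ A) ∩ p ⁻¹' K) := by
    have : (X \ A) ∩ p ⁻¹' K = ⋃ l ∈ t, ⋃ j, s l j '' (Set.Icc (fun i => l i - ε l/2) (fun i => l i + ε l/2)) := by
      ext x
      simp only [hKdef, Set.mem_inter_iff, Set.mem_preimage, Set.mem_iUnion, Set.mem_image, exists_prop]
      constructor
      · rintro ⟨hx, l, hl, hxl⟩
        obtain ⟨j, hj⟩ := (hs l (ht1 l hl)).2.2.1 x hx (Icc_sub_ball l (hε l (ht1 l hl)) hxl)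
        exact ⟨l, hl, j, p x, hxl, hj⟩
      · rintro ⟨l, hl, j, y, hy, rfl⟩
        have := (hs l (ht1 l hl)).2.1 j y (Icc_sub_ball l (hε l (ht1 l hl)) hy)
        exact ⟨this.1, l, hl, by rw [this.2]; exact hy⟩
    rw [this]
    refine isClosed_biUnion_finset fun l hl => isClosed_iUnion_of_finite fun j => ?_
    exact (isCompact_Icc.image_of_continuousOn (((hs l (ht1 l hl)).1 j).mono
      (Icc_sub_ball l (hε l (ht1 l hl))))).isClosed
  set T := X \ ((X \ A) ∩ p ⁻¹' K) with hT
  have hTO : RelOpen X T := ⟨_, hcl.isOpen_compl, rfl⟩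
  have hMO : RelOpen X (X \ A) := ⟨_, hAc.isClosed.isOpen_compl, rfl⟩
  have hAT : A ⊆ T := fun x hx => ⟨hAX hx, fun h => h.1.2 hx⟩
  have vX : VanRel X T i := by
    refine vanRel_excision hMO hTO ?_ ?_
    · intro x hx
      by_cases hxA : x ∈ A
      · exact Or.inr (hAT hxA)
      · exact Or.inl ⟨hx, hxA⟩
    · convert vM using 1
      ext x
      simp only [hT, Set.mem_inter_iff, Set.mem_diff, Set.mem_preimage, Set.mem_compl_iff]; tauto
  have hTO' : T ⊆ X ∩ O' := by
    intro x hx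
    refine ⟨hx.1, ?_⟩
    by_contra hxO
    exact hx.2 ⟨hsub ⟨hx.1, hxO⟩, ht2 ⟨x, ⟨hx.1, hxO⟩, rfl⟩⟩
  intro c hc hbc
  obtain ⟨b, hb, hbe⟩ := vX c hc (ChT_mono hAT hbc)
  set x := c - bd b with hx
  have hxX : x ∈ Ch (X ∩ O') i :=
    mem_Ch_of_ChT (Submodule.sub_mem _ hc (bd_mem_Ch hb)) (ChT_mono hTO' hbe)
  have hbx : bd x ∈ ChT A := by rw [hx, map_sub, bd_bd, sub_zero]; exact hbc
  have hl := homotopy_lemma hh (Ch_le_ChT _ _ hxX)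
  rw [push_id hh2 (Ch_le_ChT _ _ hxX)] at hl
  refine ⟨b - sop prismOp h x, Submodule.sub_mem _ hb (Ch_mono Set.inter_subset_left _
    (sop_mem prismOp (fun y hy t ht => hh1 y hy t ht) hxX)), ?_⟩
  have e : c - bd (b - sop prismOp h x) = push (fun x => h (x, 1)) x - sop prismOp h (bd x) := by
    rw [map_sub]
    have : bd (sop prismOp h x) = push (fun x => h (x, 1)) x - x - sop prismOp h (bd x) := by
      rw [← hl]; abel
    rw [this, hx]; abel
  rw [e]
  refine Submodule.sub_mem _ (push_memT (S := X ∩ O') (fun y hy => hh3 y hy) (Ch_le_ChT _ _ hxX)) ?_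
  exact sop_memT prismOp (fun y hy t _ => by rw [hh4 y hy]; exact hy) hbx

end ndr
end HV

namespace HV

section localdeg

/-- Augmentation. -/
noncomputable def augm {E : Type} [TopologicalSpace E] : Chn E →ₗ[ℂ] ℂ :=
  cext fun n _ => if n = 0 then 1 else 0

lemma augm_bd {E : Type} [TopologicalSpace E] {S : Set E} {e : Chn E} (he : e ∈ Ch S 1) :
    augm (bd e) = 0 := by
  have := Ch_map (augm ∘ₗ bd) (⊥ : Submodule ℂ ℂ) (fun σ _ => ?_) he
  · simpa using this
  · rw [Submodule.mem_bot, LinearMap.comp_apply, bd_sx_succ, map_sum]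
    simp [augm, Fin.sum_univ_two]

lemma local_deg (m : ℕ) : ∀ R : ℝ, 0 ≤ R → ∃ β ∈ Ch (Set.univ : Set (Fin m → ℝ)) m,
    bd β ∈ ChT {x | R < ‖x‖} ∧ ∀ e ∈ Ch (Set.univ : Set (Fin m → ℝ)) (m+1),
      β - bd e ∉ ChT {x | x ≠ 0} := by
  induction m with
  | zero =>
    intro R hR
    refine ⟨csx 0 0, csx_mem (Set.mem_univ _) 0, ?_, ?_⟩
    · rw [bd_Ch_zero (csx_mem (Set.mem_univ _) 0)]; exact Submodule.zero_mem _
    · intro e he h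
      have h0 : {x : Fin 0 → ℝ | x ≠ 0} = ∅ := by
        ext x; simp [Subsingleton.elim x 0]
      rw [h0] at h
      have h1 := congrArg augm (sub_eq_zero.1 (ChT_empty h))
      rw [augm_bd he] at h1
      simp [augm, csx] at h1
  | succ m ih =>
    intro R hR
    obtain ⟨β, hβ, hbβ, hn⟩ := ih R hR
    let h : (Fin m → ℝ) × ℝ → (Fin (m+1) → ℝ) := fun q => Fin.cons ((2 * q.2 - 1) * (R + 1)) q.1
    have hcont : Continuous h := by
      refine continuous_pi fun i => ?_
      refine Fin.cases ?_ (fun i => ?_) i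
      · simp only [h, Fin.cons_zero]; fun_prop
      · simp only [h, Fin.cons_succ]; fun_prop
    have hβT := Ch_le_ChT _ _ hβ
    have hl := homotopy_lemma (S := Set.univ) (h := h) hcont.continuousOn hβT
    set up := push (fun x => h (x, 1)) β
    set dn := push (fun x => h (x, 0)) β
    set s := sop prismOp h (bd β)
    have hup : up ∈ Ch {x | x 0 = R + 1} m := by
      refine push_mem (S := Set.univ) (fun x _ => ?_) hβ
      simp only [h, Fin.cons_zero, Set.mem_setOf_eq]; ring
    have hdn : dn ∈ Ch {x | x 0 = -(R + 1)} m := by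
      refine push_mem (S := Set.univ) (fun x _ => ?_) hβ
      simp only [h, Fin.cons_zero, Set.mem_setOf_eq]; ring
    have hs : s ∈ ChT {x | R < ‖Fin.tail x‖} := by
      refine sop_memT prismOp (fun x hx t _ => ?_) hbβ
      simpa [h, Fin.tail_cons] using hx
    have hB : sop prismOp h β ∈ Ch (Set.univ : Set (Fin (m+1) → ℝ)) (m+1) :=
      sop_mem prismOp (fun x _ t _ => Set.mem_univ _) hβ
    have hbB : bd (sop prismOp h β) = up - dn - s := by rw [← hl]; abel
    have hn0 : ∀ x : Fin (m+1) → ℝ, |x 0| ≤ ‖x‖ := fun x => norm_le_pi_norm x 0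
    have hnt : ∀ x : Fin (m+1) → ℝ, ‖Fin.tail x‖ ≤ ‖x‖ := fun x =>
      (pi_norm_le_iff_of_nonneg (norm_nonneg x)).2 fun i => norm_le_pi_norm x i.succ
    refine ⟨_, hB, ?_, ?_⟩
    · rw [hbB]
      refine Submodule.sub_mem _ (Submodule.sub_mem _ (ChT_mono ?_ (Ch_le_ChT _ _ hup))
        (ChT_mono ?_ (Ch_le_ChT _ _ hdn))) (ChT_mono ?_ hs)
      · intro x hx
        have := hn0 x
        rw [Set.mem_setOf_eq] at hx ⊢
        rw [hx] at this
        linarith [le_abs_self (R+1)]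
      · intro x hx
        have := hn0 x
        rw [Set.mem_setOf_eq] at hx ⊢
        rw [hx, abs_neg] at this
        linarith [le_abs_self (R+1)]
      · exact fun x hx => lt_of_lt_of_le hx (hnt x)
    · intro e he hf
      set f := sop prismOp h β - bd e with hfdef
      have hbf : bd f = up - dn - s := by rw [hfdef, map_sub, bd_bd, sub_zero, hbB]
      have hfC : f ∈ Ch {x : Fin (m+1) → ℝ | x ≠ 0} (m+1) :=
        mem_Ch_of_ChT (Submodule.sub_mem _ hB (bd_mem_Ch he)) hf
      let W : Set (Fin (m+1) → ℝ) := {x | Fin.tail x ≠ 0}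
      have htc : Continuous (Fin.tail : (Fin (m+1) → ℝ) → Fin m → ℝ) :=
        continuous_pi fun i => continuous_apply _
      have hW : IsOpen W := isOpen_ne.preimage htc
      let U : Set (Fin (m+1) → ℝ) := {x | 0 < x 0} ∪ W
      let V : Set (Fin (m+1) → ℝ) := {x | x 0 < 0} ∪ W
      have hU : IsOpen U := (isOpen_lt continuous_const (continuous_apply 0)).union hW
      have hV : IsOpen V := (isOpen_lt (continuous_apply 0) continuous_const).union hW
      have hW0 : ∀ x ∈ W, x ≠ 0 := by rintro x hx rfl; exact hx rfl
      have hUV : U ∩ V ⊆ W := by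
        rintro x ⟨h1 | h1, h2 | h2⟩
        · exact absurd (lt_trans (show 0 < x 0 from h1) h2) (lt_irrefl _)
        all_goals assumption
      obtain ⟨k, u, hu, v, hv, eq⟩ := subdivR (A := U) (B := V)
        (relOpen_of_isOpen hU (by
          rintro x (hx | hx)
          · rintro rfl; exact lt_irrefl _ (show (0:ℝ) < (0 : Fin (m+1) → ℝ) 0 from hx)
          · exact hW0 x hx))
        (relOpen_of_isOpen hV (by
          rintro x (hx | hx)
          · rintro rfl; exact lt_irrefl _ (show (0 : Fin (m+1) → ℝ) 0 < (0:ℝ) from hx)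
          · exact hW0 x hx))
        (by
          intro x hx
          by_cases ht : Fin.tail x = 0
          · rcases lt_trichotomy (x 0) 0 with h | h | h
            · exact Or.inr (Or.inl h)
            · refine absurd ?_ hx
              rw [← Fin.cons_self_tail x, h, ht]
              ext i; refine Fin.cases ?_ (fun i => ?_) i <;> simp
            · exact Or.inl (Or.inl h)
          · exact Or.inl (Or.inr ht)) hfC
      have hupU : up ∈ ChT U := ChT_mono (fun x hx => Or.inl (by
        rw [Set.mem_setOf_eq] at hx ⊢; rw [hx]; linarith)) (Ch_le_ChT _ _ hup)
      have hdnV : dn ∈ ChT V := ChT_mono (fun x hx => Or.inl (by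
        rw [Set.mem_setOf_eq] at hx ⊢; rw [hx]; linarith)) (Ch_le_ChT _ _ hdn)
      have hsV : s ∈ ChT V := ChT_mono (fun x hx => Or.inr (by
        intro h0
        rw [Set.mem_setOf_eq, h0, norm_zero] at hx
        exact absurd hx (not_lt.2 hR))) hs
      have e1 : up - bd (u + TS k up) = dn + s + bd v - bd (TS k dn) - bd (TS k s) := by
        have := congrArg bd eq
        rw [map_add, map_add, map_add, bd_bd, hbf, add_zero, map_sub, map_sub, map_sub, map_sub] at this
        rw [map_add]
        have h2 : up = bd u + bd v + (bd (TS k up) - bd (TS k dn) - bd (TS k s)) + dn + s := by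
          rw [← this]; abel
        conv_lhs => enter [1]; rw [h2]
        abel
      have hw1 : up - bd (u + TS k up) ∈ ChT U := Submodule.sub_mem _ hupU
        (bd_mem_ChT (Submodule.add_mem _ (Ch_le_ChT _ _ hu) (TS_memT k hupU)))
      have hw2 : up - bd (u + TS k up) ∈ ChT V := by
        rw [e1]
        exact Submodule.sub_mem _ (Submodule.sub_mem _ (Submodule.add_mem _ (Submodule.add_mem _
          hdnV hsV) (bd_mem_ChT (Ch_le_ChT _ _ hv))) (bd_mem_ChT (TS_memT k hdnV)))
          (bd_mem_ChT (TS_memT k hsV))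
      have hw := ChT_mono hUV (mem_ChT_inter hw1 hw2)
      have hu' : u + TS k up ∈ Ch (Set.univ : Set (Fin (m+1) → ℝ)) (m+1) :=
        Submodule.add_mem _ (Ch_mono (Set.subset_univ _) _ hu)
          (Ch_mono (Set.subset_univ _) _ (TS_mem k hup))
      refine hn (push Fin.tail (u + TS k up)) (push_mem (S := Set.univ) (fun _ _ => Set.mem_univ _) hu') ?_
      have e2 : push Fin.tail up = β := by
        rw [push_push (S := Set.univ) (by fun_prop) hβT]
        exact push_id (S := Set.univ) (fun x _ => by simp [h, Fin.tail_cons]) hβT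
      rw [bd_push (S := Set.univ) htc.continuousOn (Ch_le_ChT _ _ hu')]
      nth_rewrite 1 [← e2]
      rw [← map_sub]
      exact push_memT (g := Fin.tail) (S := W) (T := {x | x ≠ 0}) (fun x hx => hx) hw

lemma local_deg' (m : ℕ) (y : Fin m → ℝ) (R : ℝ) (hR : 0 ≤ R) :
    ∃ β ∈ Ch (Set.univ : Set (Fin m → ℝ)) m,
    bd β ∈ ChT {x | R < ‖x - y‖} ∧ ∀ e ∈ Ch (Set.univ : Set (Fin m → ℝ)) (m+1),
      β - bd e ∉ ChT {x | x ≠ y} := by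
  obtain ⟨β, h1, h2, h3⟩ := local_deg m R hR
  have c1 : Continuous (fun x : Fin m → ℝ => x + y) := by fun_prop
  have c2 : Continuous (fun x : Fin m → ℝ => x - y) := by fun_prop
  have hβT := Ch_le_ChT _ _ h1
  refine ⟨push (fun x => x + y) β, push_mem (S := Set.univ) (fun _ _ => Set.mem_univ _) h1, ?_, ?_⟩
  · rw [bd_push (S := Set.univ) c1.continuousOn hβT]
    exact push_memT (fun x hx => by simpa using hx) h2
  · intro e he h
    refine h3 (push (fun x => x - y) e) (push_mem (S := Set.univ) (fun _ _ => Set.mem_univ _) he) ?_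
    have e2 : push (fun x => x - y) (push (fun x => x + y) β) = β := by
      rw [push_push (S := Set.univ) c1.continuousOn hβT]
      exact push_id (S := Set.univ) (fun x _ => by simp) hβT
    rw [bd_push (S := Set.univ) c2.continuousOn (Ch_le_ChT _ _ he)]
    nth_rewrite 1 [← e2]
    rw [← map_sub]
    exact push_memT (fun x hx => by simpa [sub_eq_zero] using hx) h

end localdeg

section transfer
variable {E : Type} [TopologicalSpace E] [T2Space E] {m : ℕ}

/-- Lifts of a simplex. -/
def lifts (M : Set E) (p : E → Fin m → ℝ) {n : ℕ} (σ : C(stdSimplex ℝ (Fin (n+1)), Fin m → ℝ)) :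
    Set C(stdSimplex ℝ (Fin (n+1)), E) := {τ | ∀ x, τ x ∈ M ∧ p (τ x) = σ x}

/-- Transfer. -/
noncomputable def trf (M : Set E) (p : E → Fin m → ℝ) : Chn (Fin m → ℝ) →ₗ[ℂ] Chn E :=
  cext fun n σ => ∑ᶠ τ ∈ lifts M p σ, sx τ

lemma trf_memT (M : Set E) (p : E → Fin m → ℝ) {T : Set (Fin m → ℝ)} {c : Chn (Fin m → ℝ)}
    (hc : c ∈ ChT T) : trf M p c ∈ ChT (M ∩ p ⁻¹' T) := by
  refine ChT_map _ _ (fun n σ hσ => ?_) hc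
  rw [trf, cext_sx]
  refine finsum_mem_induction (fun x => x ∈ ChT (M ∩ p ⁻¹' T)) (Submodule.zero_mem _)
    (fun a b => Submodule.add_mem _) fun τ hτ => sx_mem_ChT fun x => ⟨(hτ x).1, ?_⟩
  show p (τ x) ∈ T
  rw [(hτ x).2]; exact hσ x

lemma trf_mem (M : Set E) (p : E → Fin m → ℝ) {T : Set (Fin m → ℝ)} {n : ℕ} {c : Chn (Fin m → ℝ)}
    (hc : c ∈ Ch T n) : trf M p c ∈ Ch (M ∩ p ⁻¹' T) n := by
  refine Ch_map _ _ (fun σ hσ => ?_) hc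
  rw [trf, cext_sx]
  refine finsum_mem_induction (fun x => x ∈ Ch (M ∩ p ⁻¹' T) n) (Submodule.zero_mem _)
    (fun a b => Submodule.add_mem _) fun τ hτ => sx_mem_Ch fun x => ⟨(hτ x).1, ?_⟩
  show p (τ x) ∈ T
  rw [(hτ x).2]; exact hσ x

lemma trf_EC {M : Set E} {p : E → Fin m → ℝ} {d : ℕ} {U : Set (Fin m → ℝ)}
    {s : Fin d → (Fin m → ℝ) → E} (h : EC M p d U s) (hp : ContinuousOn p M)
    {c : Chn (Fin m → ℝ)} (hc : c ∈ ChT U) : trf M p c = ∑ i, push (s i) c := by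
  rw [← LinearMap.sum_apply]
  refine ChT_ext (fun n σ hσ => ?_) hc
  have hcs : ∀ i, Continuous (s i ∘ σ) := fun i => cont_on_comp (h.1 i) hσ
  let L : Fin d → C(stdSimplex ℝ (Fin (n+1)), E) := fun i => ⟨s i ∘ σ, hcs i⟩
  have hLi : Function.Injective L := by
    intro i j hij
    let x0 : stdSimplex ℝ (Fin (n+1)) := ⟨_, vert_mem (n+1) 0⟩
    exact h.2.2.2 i j (σ x0) (hσ x0) (congrArg (fun τ : C(stdSimplex ℝ (Fin (n+1)), E) => τ x0) hij)
  have hL : lifts M p σ = Set.range L := by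
    ext τ
    constructor
    · intro hτ
      obtain ⟨i, hi⟩ := lift_sheet h hp τ (fun x => (hτ x).1)
        (fun x => by rw [(hτ x).2]; exact hσ x)
      refine ⟨i, ?_⟩
      ext x
      show s i (σ x) = τ x
      rw [← (hτ x).2]; exact hi x
    · rintro ⟨i, rfl⟩ x
      exact h.2.1 i _ (hσ x)
  rw [trf, cext_sx, hL, finsum_mem_range hLi, finsum_eq_sum_of_fintype, LinearMap.sum_apply]
  exact Finset.sum_congr rfl fun i _ => (push_sx (hcs i)).symm

lemma bd_trf_EC {M : Set E} {p : E → Fin m → ℝ} {d : ℕ} {U : Set (Fin m → ℝ)}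
    {s : Fin d → (Fin m → ℝ) → E} (h : EC M p d U s) (hp : ContinuousOn p M)
    {c : Chn (Fin m → ℝ)} (hc : c ∈ ChT U) : bd (trf M p c) = trf M p (bd c) := by
  rw [trf_EC h hp hc, trf_EC h hp (bd_mem_ChT hc), map_sum]
  exact Finset.sum_congr rfl fun i _ => bd_push (h.1 i) hc

lemma push_trf_EC {M : Set E} {p : E → Fin m → ℝ} {d : ℕ} {U : Set (Fin m → ℝ)}
    {s : Fin d → (Fin m → ℝ) → E} (h : EC M p d U s) (hp : ContinuousOn p M)
    {c : Chn (Fin m → ℝ)} (hc : c ∈ ChT U) : push p (trf M p c) = (d : ℂ) • c := by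
  rw [trf_EC h hp hc, map_sum, Finset.sum_congr rfl (fun i _ => (push_push (h.1 i) hc).trans
    (push_id (fun y hy => (h.2.1 i y hy).2) hc))]
  simp [← Nat.cast_smul_eq_nsmul ℂ]

end transfer

section cls
variable {V : Type} [NormedAddCommGroup V] [NormedSpace ℝ V] {m : ℕ}

lemma class_exists {X A : Set V} (hXc : IsCompact X) (hAc : IsCompact A) (hX : ENR X) (hA : ENR A)
    (hAX : A ⊆ X) {G : Set (Fin m → ℝ)} {p : V → Fin m → ℝ} {d : ℕ}
    (hM : FinCover (X \ A) G p d) (hd : 0 < d) (hG : G.Nonempty)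
    (hv : ∀ i, i + 1 = m → Van A i) :
    ∃ c ∈ Ch X m, bd c = 0 ∧ ∀ Y Y₁ : Set V, X ⊆ Y → RelOpen Y (X \ A) → Y₁ ⊆ Y \ (X \ A) →
      ∀ e ∈ Ch Y (m+1), c - bd e ∉ ChT Y₁ := by
  classical
  obtain ⟨y, hyG⟩ := hG
  set M := X \ A with hMdef
  let F : Set V := {x | x ∈ M ∧ p x = y}
  have hF : F.Finite := by
    obtain ⟨U, hU, hyU, -, s, hs⟩ := hM.loc y hyG
    refine (Set.finite_range fun i => s i y).subset ?_
    rintro x ⟨hx, hxy⟩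
    obtain ⟨i, hi⟩ := hs.2.2.1 x hx (by rw [hxy]; exact hyU)
    exact ⟨i, by rw [← hxy]; exact hi⟩
  have hFne : F.Nonempty := by
    obtain ⟨U, hU, hyU, -, s, hs⟩ := hM.loc y hyG
    exact ⟨s ⟨0, hd⟩ y, hs.2.1 _ y hyU⟩
  obtain ⟨O', hO', hAO', h, hh, hh1, hh2, hh3, hh4⟩ := ndr hAc hX hA hAX hF.isClosed.isOpen_compl
    (fun x hx hxF => hxF.1.2 hx)
  have hsub : X \ O' ⊆ M := fun x hx => ⟨hx.1, fun hA => hx.2 (hAO' hA)⟩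
  have hFO : F ⊆ X \ O' := by
    intro x hx
    refine ⟨hx.1.1, fun hxO => ?_⟩
    have := (hh1 x ⟨hx.1.1, hxO⟩ 0 (by simp)).2
    rw [hh2 x ⟨hx.1.1, hxO⟩] at this
    exact this hx
  set K := p '' (X \ O') with hKdef
  have hKc : IsCompact K := (hXc.diff hO').image_of_continuousOn (hM.cont.mono hsub)
  have hKG : K ⊆ G := by rintro _ ⟨x, hx, rfl⟩; exact hM.maps x (hsub hx)
  have hyK : y ∈ K := by
    obtain ⟨x, hx⟩ := hFne
    exact ⟨x, hFO hx, hx.2⟩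
  obtain ⟨R, hR⟩ := hKc.isBounded.subset_closedBall y
  have hR0 : 0 ≤ R := by simpa using (Metric.mem_closedBall.1 (hR hyK))
  have hout : {x | R < ‖x - y‖} ⊆ Kᶜ := by
    intro x hx hxK
    have := Metric.mem_closedBall.1 (hR hxK)
    rw [dist_eq_norm] at this
    exact absurd hx (not_lt.2 this)
  have hKy : Kᶜ ⊆ {x | x ≠ y} := by rintro x hx rfl; exact hx hyK
  obtain ⟨β, hβ, hbβ, hβn⟩ := local_deg' m y R hR0
  -- subdivision
  choose! U hU hyU hUG s hs using hM.loc
  let O : Option G → Set (Fin m → ℝ) := fun o => o.elim Kᶜ (fun g => U g)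
  have hO : ∀ i, IsOpen (O i) := by
    intro i
    cases i with
    | none => exact hKc.isClosed.isOpen_compl
    | some g => exact hU g g.2
  obtain ⟨k, hk⟩ := SS_small_gen hO (S := Set.univ) (by
    intro x _
    by_cases hx : x ∈ K
    · exact Set.mem_iUnion.2 ⟨some ⟨x, hKG hx⟩, hyU x (hKG hx)⟩
    · exact Set.mem_iUnion.2 ⟨none, hx⟩) hβ
  have hk := hk k le_rfl
  rw [iSup_option] at hk
  obtain ⟨β2, hβ2, β1, hβ1, hsum⟩ := Submodule.mem_sup.1 hk
  have heq := SS_eq k β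
  rw [← hsum] at heq
  simp only [Set.univ_inter] at hβ2 hβ1
  have hβ2T : β2 ∈ ChT Kᶜ := Ch_le_ChT _ _ hβ2
  have hβ1' : ∀ N : Submodule ℂ (Chn (Fin m → ℝ)), (∀ g : G, ChT (U g) ≤ N) → β1 ∈ N := by
    intro N hN
    have : (⨆ g : G, Ch (O (some g)) m) ≤ N :=
      iSup_le fun g => (Ch_le_ChT _ _).trans (hN g)
    exact this hβ1
  have hβ1C : β1 ∈ Ch G m := by
    have : (⨆ g : G, Ch (O (some g)) m) ≤ Ch G m := iSup_le fun g => Ch_mono (hUG g g.2) m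
    exact this hβ1
  have hbd1 : bd β1 ∈ ChT Kᶜ := by
    have e := congrArg bd heq
    rw [map_add, map_add, map_add, bd_bd, add_zero] at e
    have : bd β1 = bd β - bd β2 - bd (TS k (bd β)) := by
      conv_rhs => enter [1, 1]; rw [e]
      abel
    rw [this]
    have := ChT_mono hout hbβ
    exact Submodule.sub_mem _ (Submodule.sub_mem _ this (bd_mem_ChT hβ2T))
      (bd_mem_ChT (TS_memT k this))
  have htb : bd (trf M p β1) = trf M p (bd β1) := by
    have := hβ1' (LinearMap.ker (bd ∘ₗ trf M p - trf M p ∘ₗ bd)) (fun g c hc => by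
      rw [LinearMap.mem_ker, LinearMap.sub_apply, LinearMap.comp_apply, LinearMap.comp_apply,
        bd_trf_EC (hs g g.2) hM.cont hc, sub_self])
    rw [LinearMap.mem_ker, LinearMap.sub_apply] at this
    exact sub_eq_zero.1 this
  have htp : push p (trf M p β1) = (d:ℂ) • β1 := by
    have := hβ1' (LinearMap.ker (push p ∘ₗ trf M p - (d:ℂ) • LinearMap.id)) (fun g c hc => by
      rw [LinearMap.mem_ker, LinearMap.sub_apply, LinearMap.comp_apply,
        push_trf_EC (hs g g.2) hM.cont hc]; simp)
    rw [LinearMap.mem_ker, LinearMap.sub_apply] at this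
    exact sub_eq_zero.1 this
  set c0 := trf M p β1 with hc0
  have hc0M : c0 ∈ Ch M m := Ch_mono Set.inter_subset_left _ (trf_mem M p hβ1C)
  set z := bd c0 with hz
  have hzO : z ∈ ChT (X ∩ O') := by
    rw [htb]
    refine ChT_mono ?_ (trf_memT M p hbd1)
    rintro x ⟨hx, hxK⟩
    refine ⟨hx.1, ?_⟩
    by_contra hxO
    exact hxK ⟨x, ⟨hx.1, hxO⟩, rfl⟩
  have hbz : bd z = 0 := bd_bd _
  have hl := homotopy_lemma hh hzO
  rw [push_id hh2 hzO, hbz, map_zero, add_zero] at hl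
  have hPz : sop prismOp h z ∈ ChT (X ∩ Fᶜ) := sop_memT prismOp hh1 hzO
  have hz1 : push (fun x => h (x, 1)) z ∈ ChT A := push_memT hh3 hzO
  -- fill in A
  have hfill : ∃ a ∈ Ch A m, bd a = push (fun x => h (x, 1)) z ∧ sop prismOp h z ∈ Ch X m := by
    rcases Nat.eq_zero_or_pos m with hm | hm
    · have : z = 0 := by subst hm; exact bd_Ch_zero hc0M
      exact ⟨0, Submodule.zero_mem _, by simp [this], by simp [this]⟩
    · obtain ⟨i, hi⟩ : ∃ i, i + 1 = m := ⟨m-1, by omega⟩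
      have hzi : z ∈ Ch (X ∩ O') i := by
        refine mem_Ch_of_ChT (bd_mem_Ch (S := M) ?_) hzO
        rw [hi]; exact hc0M
      have hc1 : ContinuousOn (fun x => h (x, 1)) (X ∩ O') :=
        hh.comp (f := fun x : V => (x, (1:ℝ))) (by fun_prop) (fun x hx => ⟨hx, by simp⟩)
      obtain ⟨a, ha, hae⟩ := hv i hi _ (push_mem hh3 hzi) (by
        rw [bd_push (S := X ∩ O') hc1 hzO, hbz,
          map_zero])
      refine ⟨a, hi ▸ ha, hae, ?_⟩
      rw [← hi]
      exact Ch_mono Set.inter_subset_left _ (sop_mem prismOp hh1 hzi)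
  obtain ⟨a, ha, hae, hPX⟩ := hfill
  refine ⟨c0 + sop prismOp h z - a, Submodule.sub_mem _ (Submodule.add_mem _
    (Ch_mono Set.diff_subset _ hc0M) hPX) (Ch_mono hAX _ ha), ?_, ?_⟩
  · rw [map_sub, map_add, hae, hl, ← hz]; abel
  · intro Y Y₁ hXY hMY hY₁ e he hce
    have hMYs := hMY.subset
    have hw : c0 - bd e ∈ ChT (Y ∩ Fᶜ) := by
      have e1 : c0 - bd e = (c0 + sop prismOp h z - a - bd e) - sop prismOp h z + a := by abel
      rw [e1]
      refine Submodule.add_mem _ (Submodule.sub_mem _ (ChT_mono ?_ hce) (ChT_mono ?_ hPz))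
        (ChT_mono ?_ (Ch_le_ChT _ _ ha))
      · exact fun x hx => ⟨(hY₁ hx).1, fun hxF => (hY₁ hx).2 hxF.1⟩
      · exact fun x hx => ⟨hXY hx.1, hx.2⟩
      · exact fun x hx => ⟨hXY (hAX hx), fun hxF => hxF.1.2 hx⟩
    set w := c0 - bd e with hwdef
    obtain ⟨k', e1, he1, e2, he2, ee⟩ := subdivR (A := M) (B := Y ∩ Fᶜ) hMY
      ⟨_, hF.isClosed.isOpen_compl, rfl⟩ (by
        intro x hx
        by_cases hxF : x ∈ F
        · exact Or.inl hxF.1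
        · exact Or.inr ⟨hx, hxF⟩) he
    have hbe : bd e = c0 - w := by rw [hwdef]; abel
    have key : c0 - bd (e1 + TS k' c0) = w + bd e2 - bd (TS k' w) := by
      have := congrArg bd ee
      rw [map_add, map_add, map_add, bd_bd, hbe, map_sub, map_sub, add_zero] at this
      have h2 : c0 = bd e1 + bd e2 + (bd (TS k' c0) - bd (TS k' w)) + w := by rw [← this]; abel
      rw [map_add]
      conv_lhs => enter [1]; rw [h2]
      abel
    have he1' : e1 + TS k' c0 ∈ Ch M (m+1) := Submodule.add_mem _ he1 (TS_mem k' hc0M)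
    have k1 : c0 - bd (e1 + TS k' c0) ∈ ChT (M ∩ (Y ∩ Fᶜ)) := by
      refine mem_ChT_inter (Submodule.sub_mem _ (Ch_le_ChT _ _ hc0M)
        (bd_mem_ChT (Ch_le_ChT _ _ he1'))) ?_
      rw [key]
      exact Submodule.sub_mem _ (Submodule.add_mem _ hw (bd_mem_ChT (Ch_le_ChT _ _ he2)))
        (bd_mem_ChT (TS_memT k' hw))
    have k2 : push p (c0 - bd (e1 + TS k' c0)) ∈ ChT {x | x ≠ y} := by
      refine push_memT ?_ k1
      rintro x ⟨hx, hxF⟩ hxy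
      exact hxF.2 ⟨hx, hxy⟩
    rw [map_sub, htp, ← bd_push hM.cont (Ch_le_ChT _ _ he1')] at k2
    have hd' : (d:ℂ) ≠ 0 := Nat.cast_ne_zero.2 hd.ne'
    set q := push p (e1 + TS k' c0) with hq
    have hqC : q ∈ Ch Set.univ (m+1) := push_mem (S := M) (fun _ _ => Set.mem_univ _) he1'
    refine hβn ((d:ℂ)⁻¹ • q + TS k β) (Submodule.add_mem _ (Submodule.smul_mem _ _ hqC)
      (TS_mem k hβ)) ?_
    have e3 : β - bd ((d:ℂ)⁻¹ • q + TS k β) = β2 + TS k (bd β) + (d:ℂ)⁻¹ • ((d:ℂ) • β1 - bd q) := by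
      rw [map_add, map_smul, smul_sub, smul_smul, inv_mul_cancel₀ hd', one_smul]
      conv_lhs => enter [1]; rw [heq]
      abel
    rw [e3]
    exact Submodule.add_mem _ (Submodule.add_mem _ (ChT_mono hKy hβ2T)
      (ChT_mono (hout.trans hKy) (TS_memT k hbβ))) (Submodule.smul_mem _ _ k2)

end cls
end HV

namespace HV

/-- A discrete descent process gives a neighbourhood retraction. -/
lemma enr_descent {V : Type} [NormedAddCommGroup V] [NormedSpace ℝ V] [CompleteSpace V]
    {φ : V → ℝ} {S : V → V} (hφ : Continuous φ) (hS : Continuous S) (h0 : ∀ x, 0 ≤ φ x) {ρ : ℝ}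
    (hX : ∀ x, φ x = 0 → ‖x‖ < ρ)
    (hst : ∀ x, ‖x‖ < ρ + 2 → φ x < 1 → dist x (S x) ≤ φ x - φ (S x))
    (hfix : ∀ x, ‖x‖ < ρ + 2 → φ x < 1 → S x = x → φ x = 0) : ENR {x | φ x = 0} := by
  set O : Set V := {x | ‖x‖ < ρ + 1 ∧ φ x < 1} with hO
  have hOo : IsOpen O := (isOpen_lt continuous_norm continuous_const).inter
    (isOpen_lt hφ continuous_const)
  have hit : ∀ x ∈ O, ∀ j, φ (S^[j] x) < 1 ∧ dist x (S^[j] x) ≤ φ x - φ (S^[j] x) := by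
    intro x hx j
    induction j with
    | zero => simpa using hx.2
    | succ j ih =>
      obtain ⟨ih1, ih2⟩ := ih
      have hn : ‖S^[j] x‖ < ρ + 2 := by
        have h1 : ‖S^[j] x‖ ≤ ‖x‖ + dist x (S^[j] x) := by
          rw [dist_comm, dist_eq_norm]
          calc ‖S^[j] x‖ = ‖x + (S^[j] x - x)‖ := by congr 1; abel
            _ ≤ _ := norm_add_le _ _
        have := h0 (S^[j] x); have := hx.1; have := hx.2
        linarith
      have h3 := hst _ hn ih1
      rw [Function.iterate_succ_apply']
      have h4 : 0 ≤ dist (S^[j] x) (S (S^[j] x)) := dist_nonneg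
      refine ⟨by linarith, ?_⟩
      have := dist_triangle x (S^[j] x) (S (S^[j] x))
      linarith
  have hnb : ∀ x ∈ O, ∀ j, ‖S^[j] x‖ < ρ + 2 := by
    intro x hx j
    have h1 : ‖S^[j] x‖ ≤ ‖x‖ + dist x (S^[j] x) := by
      rw [dist_comm, dist_eq_norm]
      calc ‖S^[j] x‖ = ‖x + (S^[j] x - x)‖ := by congr 1; abel
        _ ≤ _ := norm_add_le _ _
    have := h0 (S^[j] x); have := hx.1; have := hx.2; have := (hit x hx j).2
    linarith
  have hstep : ∀ x ∈ O, ∀ j, dist (S^[j] x) (S^[j+1] x) ≤ φ (S^[j] x) - φ (S^[j+1] x) := by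
    intro x hx j
    rw [Function.iterate_succ_apply']
    exact hst _ (hnb x hx j) (hit x hx j).1
  have hdist : ∀ x ∈ O, ∀ i j, dist (S^[i] x) (S^[i+j] x) ≤ φ (S^[i] x) - φ (S^[i+j] x) := by
    intro x hx i j
    induction j with
    | zero => simp
    | succ j ih =>
      have := dist_triangle (S^[i] x) (S^[i+j] x) (S^[i+j+1] x)
      have := hstep x hx (i+j)
      rw [← add_assoc]; linarith
  have hanti : ∀ x ∈ O, Antitone fun j => φ (S^[j] x) := by
    intro x hx
    refine antitone_nat_of_succ_le fun j => ?_
    have := hstep x hx j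
    have := dist_nonneg (x := S^[j] x) (y := S^[j+1] x)
    linarith
  have hconv : ∀ x ∈ O, ∃ y, Filter.Tendsto (fun j => S^[j] x) Filter.atTop (nhds y) := by
    intro x hx
    have hbdd : BddBelow (Set.range fun j => φ (S^[j] x)) := ⟨0, by rintro _ ⟨j, rfl⟩; exact h0 _⟩
    have ht := tendsto_atTop_ciInf (hanti x hx) hbdd
    have hc := ht.cauchySeq
    refine cauchySeq_tendsto_of_complete ?_
    rw [Metric.cauchySeq_iff'] at hc ⊢
    intro ε hε
    obtain ⟨N, hN⟩ := hc ε hε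
    refine ⟨N, fun n hn => ?_⟩
    obtain ⟨j, rfl⟩ := Nat.exists_eq_add_of_le hn
    have h1 := hN (N+j) hn
    rw [dist_comm, Real.dist_eq] at h1
    rw [dist_comm]
    exact (hdist x hx N j).trans_lt ((le_abs_self _).trans_lt h1)
  classical
  let r : V → V := fun x => if hx : x ∈ O then (hconv x hx).choose else x
  have hr : ∀ x ∈ O, Filter.Tendsto (fun j => S^[j] x) Filter.atTop (nhds (r x)) := by
    intro x hx
    simp only [r, hx, dif_pos]
    exact (hconv x hx).choose_spec
  have hrd : ∀ x ∈ O, ∀ i, dist (S^[i] x) (r x) ≤ φ (S^[i] x) - φ (r x) := by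
    intro x hx i
    have h1 := (hr x hx).comp (Filter.tendsto_add_atTop_nat i)
    have h2 := (hφ.tendsto _).comp h1
    refine le_of_tendsto_of_tendsto (tendsto_const_nhds.dist h1) (tendsto_const_nhds.sub h2)
      (Filter.Eventually.of_forall fun j => ?_)
    have := hdist x hx i j
    simpa [add_comm] using this
  have hrX : ∀ x ∈ O, φ (r x) = 0 := by
    intro x hx
    have hd := hrd x hx 0
    simp only [Function.iterate_zero, id] at hd
    have h1 : ‖r x‖ ≤ ‖x‖ + dist x (r x) := by
      rw [dist_comm, dist_eq_norm]
      calc ‖r x‖ = ‖x + (r x - x)‖ := by congr 1; abel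
        _ ≤ _ := norm_add_le _ _
    have := h0 (r x); have := hx.1; have := hx.2; have := dist_nonneg (x := x) (y := r x)
    refine hfix _ (by linarith) (by linarith) ?_
    have h2 := (hS.tendsto _).comp (hr x hx)
    have h3 := (hr x hx).comp (Filter.tendsto_add_atTop_nat 1)
    refine tendsto_nhds_unique h2 (h3.congr fun j => ?_)
    simp only [Function.comp, Function.iterate_succ_apply']
  refine ⟨O, hOo, ?_, r, ?_, hrX, ?_⟩
  · intro x hx
    have hx' : φ x = 0 := hx
    exact ⟨by linarith [hX x hx'], by rw [hx']; norm_num⟩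
  · intro x hx
    refine ContinuousAt.continuousWithinAt ?_
    rw [Metric.continuousAt_iff']
    intro ε hε
    have h1 := ((hφ.tendsto _).comp (hr x hx))
    rw [hrX x hx] at h1
    obtain ⟨j, hj⟩ := (h1.eventually (gt_mem_nhds (show 0 < ε/3 by linarith))).exists
    have hcj : Continuous fun y => S^[j] y := hS.iterate j
    have e1 : ∀ᶠ y in nhds x, φ (S^[j] y) < ε/3 :=
      (hφ.comp hcj).continuousAt.eventually (gt_mem_nhds hj)
    have e2 : ∀ᶠ y in nhds x, dist (S^[j] y) (S^[j] x) < ε/3 :=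
      Metric.continuousAt_iff'.1 hcj.continuousAt _ (by linarith)
    filter_upwards [e1, e2, hOo.mem_nhds hx] with y h1 h2 h3
    have a1 := hrd y h3 j
    have a2 := hrd x hx j
    rw [hrX y h3] at a1
    rw [hrX x hx] at a2
    have := dist_triangle4 (r y) (S^[j] y) (S^[j] x) (r x)
    rw [dist_comm (r y) (S^[j] y)] at this
    simp only [Function.comp] at hj
    linarith
  · intro x hx
    have hx' : φ x = 0 := hx
    have hxO : x ∈ O := ⟨by linarith [hX x hx'], by rw [hx']; norm_num⟩
    have := hrd x hxO 0
    simp only [Function.iterate_zero, id, hx', hrX x hxO, sub_zero] at this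
    exact (dist_le_zero.1 this).symm

/-- Polynomials are bounded on bounded sets by powers. -/
lemma poly_bound {σ : Type} (Q : MvPolynomial σ ℝ) :
    ∃ C D, 0 < C ∧ ∀ (x : σ → ℝ) (M : ℝ), 1 ≤ M → (∀ i, |x i| ≤ M) → |eval x Q| ≤ C * M ^ (D:ℕ) := by
  induction Q using MvPolynomial.induction_on with
  | C a =>
    refine ⟨|a| + 1, 0, by positivity, fun x M _ _ => ?_⟩
    simp
  | add p q hp hq =>
    obtain ⟨C, D, hC, h⟩ := hp
    obtain ⟨C', D', hC', h'⟩ := hq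
    refine ⟨C + C', max D D', by positivity, fun x M hM hx => ?_⟩
    rw [map_add]
    refine (abs_add_le _ _).trans ?_
    have h1 := h x M hM hx
    have h2 := h' x M hM hx
    have h3 : M ^ D ≤ M ^ max D D' := pow_le_pow_right₀ hM (le_max_left _ _)
    have h4 : M ^ D' ≤ M ^ max D D' := pow_le_pow_right₀ hM (le_max_right _ _)
    nlinarith
  | mul_X p i hp =>
    obtain ⟨C, D, hC, h⟩ := hp
    refine ⟨C, D + 1, hC, fun x M hM hx => ?_⟩
    rw [map_mul, eval_X, abs_mul, pow_succ, ← mul_assoc]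
    exact mul_le_mul (h x M hM hx) (hx i) (abs_nonneg _) (by positivity)

/-- Second order Taylor estimate for polynomials. -/
lemma poly_taylor {σ : Type} [Fintype σ] (f : MvPolynomial (σ) ℝ) (ρ : ℝ) :
    ∃ L, 0 ≤ L ∧ ∀ x v : σ → ℝ, ‖x‖ ≤ ρ → ‖v‖ ≤ 1 →
      |eval (x + v) f - eval x f - ∑ j, eval x (pderiv j f) * v j| ≤ L * ‖v‖ ^ 2 := by
  classical
  induction f using MvPolynomial.induction_on with
  | C a => exact ⟨0, le_rfl, fun x v _ _ => by simp⟩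
  | add p q hp hq =>
    obtain ⟨L, hL, h⟩ := hp
    obtain ⟨L', hL', h'⟩ := hq
    refine ⟨L + L', by positivity, fun x v hx hv => ?_⟩
    have h1 := h x v hx hv
    have h2 := h' x v hx hv
    simp only [map_add, add_mul, Finset.sum_add_distrib]
    rw [abs_le] at *
    constructor <;> linarith [h1.1, h1.2, h2.1, h2.2]
  | mul_X p i hp =>
    obtain ⟨L, hL, h⟩ := hp
    choose C D hC hCD using fun j => poly_bound (pderiv j p)
    refine ⟨L * (|ρ| + 1) + ∑ j, C j * (|ρ|+1) ^ D j, ?_, fun x v hx hv => ?_⟩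
    · have : ∀ j, 0 ≤ C j * (|ρ|+1) ^ D j := fun j => mul_nonneg (hC j).le (by positivity)
      have := Finset.sum_nonneg fun j (_ : j ∈ Finset.univ) => this j
      positivity
    have h1 := h x v hx hv
    have hxi : ∀ i, |x i| ≤ |ρ| + 1 := fun i => by
      have := norm_le_pi_norm x i
      rw [Real.norm_eq_abs] at this
      linarith [le_abs_self ρ]
    have hvi : ∀ i, |v i| ≤ ‖v‖ := fun i => norm_le_pi_norm v i
    have hxv : |x i + v i| ≤ |ρ| + 1 := by
      have a1 := norm_le_pi_norm x i
      rw [Real.norm_eq_abs] at a1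
      have := abs_add_le (x i) (v i)
      linarith [le_abs_self ρ, hvi i]
    have e : eval (x + v) (p * X i) - eval x (p * X i) - ∑ j, eval x (pderiv j (p * X i)) * v j
      = (eval (x + v) p - eval x p - ∑ j, eval x (pderiv j p) * v j) * (x i + v i)
        + (∑ j, eval x (pderiv j p) * v j) * v i := by
      have : ∀ j, eval x (pderiv j (p * X i)) * v j
        = eval x (pderiv j p) * v j * x i + (if j = i then eval x p * v j else 0) := by
        intro j
        rw [Derivation.leibniz, pderiv_X]
        by_cases hji : j = i
        · subst hji; simp; ring
        · simp [hji, Pi.single_apply, Ne.symm hji]; ring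
      simp only [this, Finset.sum_add_distrib, Finset.sum_ite_eq', Finset.mem_univ, if_true,
        ← Finset.sum_mul, map_mul, eval_X, Pi.add_apply]
      ring
    rw [e]
    refine (abs_add_le _ _).trans ?_
    rw [abs_mul, abs_mul, add_mul]
    refine add_le_add ?_ ?_
    · calc _ ≤ (L * ‖v‖^2) * (|ρ| + 1) := mul_le_mul h1 hxv (abs_nonneg _) (by positivity)
        _ = _ := by ring
    · calc _ ≤ (∑ j, C j * (|ρ|+1) ^ D j * ‖v‖) * ‖v‖ := by
            refine mul_le_mul ?_ (hvi i) (abs_nonneg _) ?_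
            · refine (Finset.abs_sum_le_sum_abs _ _).trans (Finset.sum_le_sum fun j _ => ?_)
              rw [abs_mul]
              exact mul_le_mul (hCD j x _ (by linarith [abs_nonneg ρ]) hxi) (hvi j) (abs_nonneg _)
                (mul_nonneg (hC j).le (by positivity))
            · exact Finset.sum_nonneg fun j _ => mul_nonneg
                (mul_nonneg (hC j).le (by positivity)) (norm_nonneg _)
        _ = _ := by rw [← Finset.sum_mul]; ring



lemma dvr_aux {C V : Type} [CommRing C] [IsDomain C] [IsNoetherianRing C] [IsIntegrallyClosed C]
    {f : C} (hf : f ≠ 0) {P : Ideal C} (hP : P ∈ (Ideal.span {f}).minimalPrimes) [P.IsPrime]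
    [CommRing V] [IsDomain V] [IsLocalRing V] [Algebra C V] [IsLocalization.AtPrime V P] :
    IsDiscreteValuationRing V ∧ algebraMap C V f ≠ 0 ∧ ¬ IsUnit (algebraMap C V f) := by
  have hfP : f ∈ P := hP.1.2 (Ideal.mem_span_singleton_self _)
  have hh : P.height ≤ 1 := Ideal.height_le_one_of_isPrincipal_of_mem_minimalPrimes _ P hP
  haveI : IsNoetherianRing V := IsLocalization.isNoetherianRing P.primeCompl V inferInstance
  have hVinj : Function.Injective (algebraMap C V) :=
    IsLocalization.injective V P.primeCompl_le_nonZeroDivisors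
  haveI : IsIntegrallyClosed V :=
    isIntegrallyClosed_of_isLocalization V P.primeCompl P.primeCompl_le_nonZeroDivisors
  have hnu : ¬ IsUnit (algebraMap C V f) := by
    rw [IsLocalization.AtPrime.isUnit_to_map_iff V P]
    exact fun h => h hfP
  have hn0 : algebraMap C V f ≠ 0 := by
    rw [Ne, map_eq_zero_iff _ hVinj]; exact hf
  have hnf : ¬ IsField V := fun h => hnu (by
    letI := h.toField
    exact IsUnit.mk0 _ hn0)
  refine ⟨?_, hn0, hnu⟩
  refine ((IsDiscreteValuationRing.TFAE V hnf).out 3 0 rfl rfl).1 ⟨inferInstance,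
      IsLocalRing.maximalIdeal V, ⟨?_, inferInstance⟩, ?_⟩
  · exact fun h => hnf (IsLocalRing.isField_iff_maximalIdeal_eq.2 h)
  · rintro Q ⟨hQ0, hQ⟩
    by_contra hne
    have hlt : Q < IsLocalRing.maximalIdeal V :=
      lt_of_le_of_ne (IsLocalRing.le_maximalIdeal hQ.ne_top) hne
    have h1 : (IsLocalRing.maximalIdeal V).height ≤ 1 := by
      have h2 := IsLocalRing.maximalIdeal_height_eq_ringKrullDim (R := V)
      rw [IsLocalization.AtPrime.ringKrullDim_eq_height P V] at h2
      have h3 : (IsLocalRing.maximalIdeal V).height = P.height := by exact_mod_cast h2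
      rw [h3]; exact hh
    have h2 := Ideal.height_add_one_le_of_lt_of_isPrime hlt
    have h3 := Ideal.height_add_one_le_of_lt_of_isPrime (bot_lt_iff_ne_bot.2 hQ0)
    have h4 : (0 + 1 + 1 : ℕ∞) ≤ 1 := by
      calc (0 + 1 + 1 : ℕ∞) ≤ (⊥ : Ideal V).height + 1 + 1 := by gcongr; exact zero_le
        _ ≤ Q.height + 1 := by gcongr
        _ ≤ _ := h2
        _ ≤ 1 := h1
    norm_num at h4

lemma dvr_aux2 {k C : Type} [Field k] [CharZero k] [CommRing C] [IsDomain C] [IsNoetherianRing C]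
    [IsIntegrallyClosed C] [Algebra k C] [Algebra.FiniteType k C]
    (f : C) (hf : f ≠ 0) (hu : ¬ IsUnit f) :
    ∃ (V : Type) (_ : CommRing V) (_ : IsDomain V) (_ : IsDiscreteValuationRing V)
      (_ : Algebra k V) (_ : Algebra.FormallySmooth k (IsLocalRing.ResidueField V))
      (φ : C →ₐ[k] V), φ f ≠ 0 ∧ ¬ IsUnit (φ f) := by
  obtain ⟨P, hP⟩ := Ideal.nonempty_minimalPrimes (I := Ideal.span {f})
    (by rwa [Ne, Ideal.span_singleton_eq_top])
  haveI : P.IsPrime := hP.isPrime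
  let V := Localization.AtPrime P
  haveI : IsDomain V := IsLocalization.isDomain_localization (P.primeCompl_le_nonZeroDivisors)
  obtain ⟨h1, h2, h3⟩ := dvr_aux (V := V) hf hP
  haveI : Algebra.EssFiniteType C V := Algebra.EssFiniteType.of_isLocalization V P.primeCompl
  haveI : Algebra.EssFiniteType k V := Algebra.EssFiniteType.comp k C V
  haveI : Algebra.EssFiniteType V (IsLocalRing.ResidueField V) := inferInstance
  haveI : Algebra.EssFiniteType k (IsLocalRing.ResidueField V) :=
    Algebra.EssFiniteType.comp k V _
  exact ⟨V, inferInstance, inferInstance, h1, inferInstance, inferInstance,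
    IsScalarTower.toAlgHom k C V, h2, h3⟩

lemma exists_dvr {k A : Type} [Field k] [CharZero k] [CommRing A] [IsDomain A] [Algebra k A]
    [Algebra.FiniteType k A] (f : A) (hf : f ≠ 0) (hu : ¬ IsUnit f) :
    ∃ (V : Type) (_ : CommRing V) (_ : IsDomain V) (_ : IsDiscreteValuationRing V)
      (_ : Algebra k V) (_ : Algebra.FormallySmooth k (IsLocalRing.ResidueField V))
      (φ : A →ₐ[k] V), φ f ≠ 0 ∧ ¬ IsUnit (φ f) := by
  obtain ⟨s, g, hg, hgi⟩ := exists_integral_inj_algHom_of_fg k A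
  let B := MvPolynomial (Fin s) k
  letI : Algebra B A := g.toRingHom.toAlgebra
  haveI : IsScalarTower k B A := IsScalarTower.of_algebraMap_eq fun x => (g.commutes x).symm
  haveI : Algebra.IsIntegral B A := ⟨hgi⟩
  haveI : Algebra.FiniteType B A := Algebra.FiniteType.of_restrictScalars_finiteType k B A
  haveI : Module.Finite B A := Algebra.IsIntegral.finite
  haveI : FaithfulSMul B A := (faithfulSMul_iff_algebraMap_injective B A).2 hg
  let L := FractionRing A
  let K := FractionRing B
  letI : Algebra K L := FractionRing.liftAlgebra B L
  haveI : FiniteDimensional K L := .of_isLocalization B A (nonZeroDivisors B)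
  haveI : CharZero B := inferInstance
  haveI : CharZero K := charZero_of_injective_algebraMap (IsFractionRing.injective B K)
  haveI : Algebra.IsSeparable K L := inferInstance
  let C := integralClosure B L
  haveI : IsNoetherian B C := IsIntegralClosure.isNoetherian B K L C
  haveI : IsNoetherianRing C := IsIntegralClosure.isNoetherianRing B K L C
  haveI : IsIntegrallyClosed C := integralClosure.isIntegrallyClosedOfFiniteExtension K
  let ι : A →ₐ[B] C := IsIntegralClosure.lift B C L (S := A)
  have hι : ∀ a, ((ι a : C) : L) = algebraMap A L a := fun a => by
    exact IsIntegralClosure.algebraMap_lift B C L a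
  have hιinj : Function.Injective ι := by
    intro a b hab
    apply IsFractionRing.injective A L
    rw [← hι, ← hι, hab]
  have hιint : (ι : A →+* C).IsIntegral := by
    refine RingHom.IsIntegral.tower_top (algebraMap B A) (ι : A →+* C) ?_
    have : (ι : A →+* C).comp (algebraMap B A) = algebraMap B C := ι.comp_algebraMap
    rw [this]
    exact fun x => Algebra.IsIntegral.isIntegral x
  have hfC : ¬ IsUnit (ι f) := by
    haveI := RingHom.IsIntegral.isLocalHom hιint hιinj
    intro h
    exact hu ((isUnit_map_iff (ι : A →+* C) f).1 h)
  have hf0 : ι f ≠ 0 := by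
    rw [Ne, map_eq_zero_iff ι hιinj]; exact hf
  haveI : Algebra.FiniteType k C := by
    haveI : Module.Finite B C := ⟨IsNoetherian.noetherian ⊤⟩
    exact Algebra.FiniteType.trans (R := k) (S := B) (A := C) inferInstance inferInstance
  obtain ⟨V, h1, h2, h3, h4, h5, φ, h6, h7⟩ := dvr_aux2 (k := k) (ι f) hf0 hfC
  exact ⟨V, h1, h2, h3, h4, h5, φ.comp (ι.restrictScalars k), h6, h7⟩


lemma derivative_aeval {k κ : Type} [Field k] [Field κ] [Algebra k κ] {σ : Type} [Fintype σ]
    (x : σ → Polynomial κ) (f : MvPolynomial (σ) k) :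
    Polynomial.derivative (aeval x f) = ∑ j, aeval x (pderiv j f) * Polynomial.derivative (x j) := by
  classical
  induction f using MvPolynomial.induction_on with
  | C a => simp [IsScalarTower.algebraMap_apply k κ (Polynomial κ)]
  | add p q hp hq => simp [hp, hq, add_mul, Finset.sum_add_distrib]
  | mul_X p i hp =>
    have : ∀ j, aeval x (pderiv j (p * X i)) * Polynomial.derivative (x j)
        = aeval x (pderiv j p) * Polynomial.derivative (x j) * x i
          + (if j = i then aeval x p * Polynomial.derivative (x j) else 0) := by
      intro j
      rw [Derivation.leibniz, pderiv_X]
      by_cases hji : j = i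
      · subst hji; simp; ring
      · simp [hji, Pi.single_apply, Ne.symm hji]; ring
    simp only [this, Finset.sum_add_distrib, Finset.sum_ite_eq', Finset.mem_univ, if_true,
        ← Finset.sum_mul, map_mul, aeval_X, Polynomial.derivative_mul, hp]

lemma dvr_no {k V : Type} [Field k] [CharZero k] [CommRing V] [IsDomain V]
    [IsDiscreteValuationRing V] [Algebra k V]
    [Algebra.FormallySmooth k (IsLocalRing.ResidueField V)] {σ : Type} [Fintype σ] (x g : σ → V)
    (f : MvPolynomial (σ) k) (h0 : aeval x f ≠ 0) (hu : ¬ IsUnit (aeval x f))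
    (hg : ∀ j, aeval x (pderiv j f) = aeval x f * g j) : False := by
  obtain ⟨u, hirr⟩ := IsDiscreteValuationRing.exists_irreducible V
  have hu0 : u ≠ 0 := hirr.ne_zero
  have hmax := hirr.maximalIdeal_eq
  obtain ⟨e, ε, hfe⟩ := IsDiscreteValuationRing.eq_unit_mul_pow_irreducible h0 hirr
  have he : e ≠ 0 := by
    rintro rfl
    apply hu; rw [hfe]; simp
  let κ := IsLocalRing.ResidueField V
  let I : Ideal V := Ideal.span {u ^ (e+1)}
  let V' := V ⧸ I
  let π : V →ₐ[k] V' := Ideal.Quotient.mkₐ k I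
  let res : V →ₐ[k] κ := IsScalarTower.toAlgHom k V κ
  have hres : ∀ v, res v = 0 ↔ u ∣ v := fun v => by
    rw [← Ideal.mem_span_singleton, ← hmax]
    exact IsLocalRing.residue_eq_zero_iff v
  have hπ0 : ∀ v, π v = 0 ↔ u ^ (e+1) ∣ v := fun v => by
    rw [← Ideal.mem_span_singleton]
    exact Ideal.Quotient.eq_zero_iff_mem
  have hπs : Function.Surjective π := Ideal.Quotient.mk_surjective
  let q : V' →ₐ[k] κ := Ideal.Quotient.liftₐ I res (fun a ha => by
    rw [hres]
    exact (dvd_pow_self u (by omega)).trans (Ideal.mem_span_singleton.1 ha))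
  have hq : ∀ v, q (π v) = res v := fun v => rfl
  have hqs : Function.Surjective q := fun y => by
    obtain ⟨v, hv⟩ := IsLocalRing.residue_surjective (R := V) y
    exact ⟨π v, hv⟩
  have hqn : IsNilpotent (RingHom.ker (q : V' →+* κ)) := by
    refine ⟨e+1, ?_⟩
    have h1 : RingHom.ker (q : V' →+* κ) ≤ Ideal.span {π u} := by
      intro a ha
      obtain ⟨v, rfl⟩ := hπs a
      have ha' : res v = 0 := ha
      obtain ⟨w, rfl⟩ := (hres v).1 ha'
      rw [map_mul]
      exact Ideal.mem_span_singleton.2 ⟨_, rfl⟩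
    refine le_antisymm ((Ideal.pow_right_mono h1 _).trans ?_) bot_le
    rw [Ideal.span_singleton_pow, ← map_pow, (hπ0 _).2 dvd_rfl]
    simp
  let s : κ →ₐ[k] V' := Algebra.FormallySmooth.liftOfSurjective (AlgHom.id k κ) q hqs hqn
  have hs : ∀ y, q (s y) = y := fun y =>
    Algebra.FormallySmooth.liftOfSurjective_apply (AlgHom.id k κ) q hqs hqn y
  let φ : Polynomial κ →ₐ[k] V' := Polynomial.eval₂AlgHom s (π u) (fun a => Commute.all _ _)
  have hφX : φ Polynomial.X = π u := Polynomial.eval₂_X _ _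
  have hφC : ∀ a, φ (Polynomial.C a) = s a := fun a => Polynomial.eval₂_C _ _
  have hqφ : ∀ p, q (φ p) = p.coeff 0 := by
    intro p
    have h1 := Polynomial.X_mul_divX_add p
    conv_lhs => rw [← h1]
    rw [map_add, map_add, map_mul, map_mul, hφX, hφC, hs, hq, (hres u).2 dvd_rfl, zero_mul,
      zero_add]
  have hφs : Function.Surjective φ := by
    have key : ∀ v, ∀ j, ∃ p w, v = φ p + π (u ^ j) * w := by
      intro v j
      induction j with
      | zero => exact ⟨0, v, by simp⟩
      | succ j ih =>
        obtain ⟨p, w, hp⟩ := ih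
        have h1 : q (w - s (q w)) = 0 := by rw [map_sub, hs, sub_self]
        obtain ⟨y, hy⟩ := hπs (w - s (q w))
        rw [← hy, hq, hres] at h1
        obtain ⟨z, rfl⟩ := h1
        refine ⟨p + Polynomial.C (q w) * Polynomial.X ^ j, π z, ?_⟩
        have hw : w = s (q w) + π u * π z := by rw [← map_mul, hy]; ring
        conv_lhs => rw [hp, hw]
        rw [map_add, map_mul, hφC, map_pow, map_pow, map_pow, hφX]
        ring
    intro v
    obtain ⟨p, w, h⟩ := key v (e+1)
    exact ⟨p, by rw [h, (hπ0 _).2 dvd_rfl, zero_mul, add_zero]⟩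
  have hdiv : ∀ i j, i ≤ j → j ≤ e + 1 → ∀ w r, φ (Polynomial.X ^ i * r) = π (u ^ j * w) →
      ∃ v, φ r = π v ∧ u ∣ v - u ^ (j - i) * w ∨ i = e+1 := by
    intro i j hij hj w r hr
    obtain ⟨v, hv⟩ := hπs (φ r)
    by_cases hi : i = e + 1
    · exact ⟨0, Or.inr hi⟩
    refine ⟨v, Or.inl ⟨hv.symm, ?_⟩⟩
    rw [map_mul, map_pow, hφX, ← hv, ← map_pow, ← map_mul, ← sub_eq_zero, ← map_sub, hπ0] at hr
    have e1 : u ^ i * v - u ^ j * w = u ^ i * (v - u ^ (j - i) * w) := by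
      rw [mul_sub, ← mul_assoc, ← pow_add, Nat.add_sub_cancel' hij]
    rw [e1, show e + 1 = i + (e + 1 - i) by omega, pow_add] at hr
    have := (mul_dvd_mul_iff_left (pow_ne_zero i hu0)).1 hr
    exact (dvd_pow_self u (by omega)).trans this
  have hX : ∀ p j w, j ≤ e + 1 → φ p = π (u ^ j * w) → Polynomial.X ^ j ∣ p := by
    intro p j w hj hp
    have : ∀ i ≤ j, Polynomial.X ^ i ∣ p := by
      intro i
      induction i with
      | zero => intro _; simp
      | succ i ih =>
        intro hi
        obtain ⟨r, rfl⟩ := ih (by omega)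
        obtain ⟨v, h | h⟩ := hdiv i j (by omega) hj w r hp
        · have h2 : u ∣ v := by
            have h3 : u ∣ u ^ (j - i) * w := (dvd_pow_self u (by omega)).mul_right _
            exact (dvd_sub_left h3).1 h.2
          have h3 := hqφ r
          rw [h.1, hq, (hres v).2 h2] at h3
          rw [pow_succ]
          exact mul_dvd_mul_left _ (Polynomial.X_dvd_iff.2 h3.symm)
        · omega
    exact this j le_rfl
  choose x' hx' using fun j => hφs (π (x j))
  choose g' hg' using fun j => hφs (π (g j))
  have hae : ∀ P : MvPolynomial (σ) k, φ (aeval x' P) = π (aeval x P) := by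
    intro P
    have h1 : φ.comp (aeval x') = π.comp (aeval x) := by
      ext j; simp [hx']
    exact DFunLike.congr_fun h1 P
  set F := aeval x' f with hF
  have hφF : φ F = π (u ^ e * ε) := by rw [hF, hae, hfe, mul_comm]
  obtain ⟨Q, hQ⟩ := hX F e ε (by omega) hφF
  have hQ0 : Q.coeff 0 ≠ 0 := by
    rw [hQ] at hφF
    obtain ⟨v, h | h⟩ := hdiv e e le_rfl (by omega) ε Q hφF
    · rw [Nat.sub_self, pow_zero, one_mul] at h
      rw [← hqφ, h.1, hq]
      intro h3
      have h4 : u ∣ (ε : V) := (dvd_sub_right ((hres v).1 h3)).1 h.2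
      exact hirr.not_isUnit (isUnit_of_dvd_unit h4 ε.isUnit)
    · omega
  have hdF : Polynomial.X ^ e ∣ Polynomial.derivative F := by
    rw [hF, derivative_aeval]
    refine Finset.dvd_sum fun j _ => Dvd.dvd.mul_right ?_ _
    have h1 : Polynomial.X ^ (e+1) ∣ aeval x' (pderiv j f) - F * g' j := by
      refine hX _ _ 0 le_rfl ?_
      rw [map_sub, map_mul, hae, hae, hg', hg, mul_zero, map_zero, ← map_mul, sub_self]
    have h2 : Polynomial.X ^ e ∣ aeval x' (pderiv j f) - F * g' j :=
      (pow_dvd_pow _ (by omega)).trans h1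
    have h3 : Polynomial.X ^ e ∣ F * g' j := by rw [hQ]; exact (dvd_mul_right _ _).mul_right _
    exact (dvd_sub_left h3).1 h2
  rw [hQ, Polynomial.derivative_mul, Polynomial.derivative_X_pow,
    dvd_add_left (dvd_mul_right _ _)] at hdF
  obtain ⟨e', rfl⟩ := Nat.exists_eq_succ_of_ne_zero he
  rw [Nat.succ_sub_one, Nat.succ_eq_add_one, pow_succ, mul_comm (Polynomial.C _), mul_assoc] at hdF
  have h5 := (mul_dvd_mul_iff_left (pow_ne_zero e' Polynomial.X_ne_zero)).1 hdF
  rw [Polynomial.X_dvd_iff, Polynomial.mul_coeff_zero, Polynomial.coeff_C_zero] at h5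
  haveI : CharZero κ := charZero_of_injective_algebraMap (algebraMap k κ).injective
  rcases mul_eq_zero.1 h5 with h | h
  · have : ((e' + 1 : ℕ) : κ) = 0 := h
    exact absurd this (Nat.cast_ne_zero.2 (by omega))
  · exact hQ0 h


lemma loj_alg {σ : Type} [Fintype σ] (f : MvPolynomial (σ) ℝ) (hf : f ≠ 0) :
    ∃ Q : MvPolynomial (σ ⊕ σ) ℝ, ∀ x : σ → ℝ, eval x f ≠ 0 →
      eval x f * eval (Sum.elim x (fun j => eval x (pderiv j f) / eval x f)) Q = 1 := by
  let R := MvPolynomial (σ) ℝ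
  let L := Localization.Away f
  haveI : IsDomain L := IsLocalization.isDomain_localization (powers_le_nonZeroDivisors_of_noZeroDivisors hf)
  have hinj : Function.Injective (algebraMap R L) := IsLocalization.injective L
    (powers_le_nonZeroDivisors_of_noZeroDivisors hf)
  let iv : L := IsLocalization.Away.invSelf f
  have hiv : algebraMap R L f * iv = 1 := IsLocalization.Away.mul_invSelf f
  let gen : σ ⊕ σ → L := Sum.elim (fun i => algebraMap R L (X i))
    (fun j => algebraMap R L (pderiv j f) * iv)
  let W : Subalgebra ℝ L := (aeval gen : MvPolynomial (σ ⊕ σ) ℝ →ₐ[ℝ] L).range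
  haveI : Algebra.FiniteType ℝ W := Algebra.FiniteType.of_surjective
    (aeval gen : MvPolynomial (σ ⊕ σ) ℝ →ₐ[ℝ] L).rangeRestrict
    (AlgHom.rangeRestrict_surjective _)
  let xW : σ → W := fun i => ⟨gen (Sum.inl i), X (Sum.inl i), by simp⟩
  let gW : σ → W := fun i => ⟨gen (Sum.inr i), X (Sum.inr i), by simp⟩
  have hval : ∀ P : R, ((aeval xW P : W) : L) = algebraMap R L P := by
    intro P
    have h1 : W.val.comp (aeval xW) = IsScalarTower.toAlgHom ℝ R L := by
      ext j; simp [xW, gen]; rfl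
    exact DFunLike.congr_fun h1 P
  by_cases hu : IsUnit (aeval xW f : W)
  · obtain ⟨⟨w, Q, hQ⟩, hw⟩ := hu.exists_right_inv
    refine ⟨Q, fun x hx => ?_⟩
    let ev : L →+* ℝ := IsLocalization.Away.lift (g := (eval x : R →+* ℝ)) f (IsUnit.mk0 _ hx)
    have hev : ∀ P, ev (algebraMap R L P) = eval x P := fun P =>
      IsLocalization.Away.lift_eq (g := (eval x : R →+* ℝ)) f (IsUnit.mk0 _ hx) P
    have hevi : ev iv = (eval x f)⁻¹ := by
      have := congrArg ev hiv
      rw [map_mul, hev, map_one] at this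
      exact (eq_inv_of_mul_eq_one_right this)
    have hw' : algebraMap R L f * w = 1 := by
      have := congrArg Subtype.val hw
      rw [← hval]; exact this
    have h2 := congrArg ev hw'
    rw [map_mul, hev, map_one] at h2
    rw [← h2]
    congr 1
    have hQ' : aeval gen Q = w := hQ
    rw [← hQ']
    have h3 : ev.comp (aeval gen : MvPolynomial (σ ⊕ σ) ℝ →ₐ[ℝ] L).toRingHom
        = (eval (Sum.elim x (fun j => eval x (pderiv j f) / eval x f))) := by
      refine MvPolynomial.ringHom_ext (fun r => ?_) (fun i => ?_)
      · have : (algebraMap ℝ L r) = algebraMap R L (C r) := by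
          rw [IsScalarTower.algebraMap_apply ℝ R L]; rfl
        simp [this, hev]
      · rcases i with i | i
        · simp [gen, hev]
        · simp [gen, hev, hevi, div_eq_mul_inv]
    exact (DFunLike.congr_fun h3 Q).symm
  · exfalso
    have hne : (aeval xW f : W) ≠ 0 := by
      intro h
      have := hval f
      rw [h] at this
      exact hf (hinj (by rw [← this, map_zero]; rfl))
    obtain ⟨V, i1, i2, i3, i4, i5, φ, h6, h7⟩ := exists_dvr (k := ℝ) (aeval xW f : W) hne hu
    have hae : ∀ P : R, aeval (fun j => φ (xW j)) P = φ (aeval xW P) := fun P =>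
      (MvPolynomial.comp_aeval_apply xW φ P).symm
    refine dvr_no (k := ℝ) (V := V) (fun j => φ (xW j)) (fun j => φ (gW j)) f ?_ ?_ ?_
    · rw [hae]; exact h6
    · rw [hae]; exact h7
    · intro j
      rw [hae, hae, ← map_mul]
      congr 1
      apply Subtype.ext
      rw [hval]
      have : ((aeval xW f * gW j : W) : L) = algebraMap R L f * (algebraMap R L (pderiv j f) * iv) := by
        rw [← hval]; rfl
      rw [this, mul_left_comm, hiv, mul_one]

set_option maxHeartbeats 2000000 in
lemma enr_zero {σ : Type} [Fintype σ] (f : MvPolynomial (σ) ℝ) (h0 : ∀ x, 0 ≤ eval x f) {ρ : ℝ}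
    (hX : ∀ x, eval x f = 0 → ‖x‖ < ρ) : ENR {x : σ → ℝ | eval x f = 0} := by
  by_cases hf : f = 0
  · refine ⟨Set.univ, isOpen_univ, Set.subset_univ _, id, continuousOn_id, ?_, fun _ _ => rfl⟩
    intro x _; simp [hf]
  obtain ⟨Q, hQ⟩ := loj_alg f hf
  obtain ⟨C, D, hC, hCD⟩ := poly_bound Q
  obtain ⟨L, hL, hTay⟩ := poly_taylor f (ρ + 2)
  set R : ℝ := |ρ| + 3 with hR
  have hR3 : 3 ≤ R := by linarith [abs_nonneg ρ]
  have hxR : ∀ x : σ → ℝ, ‖x‖ < ρ + 2 → ∀ i, |x i| ≤ R := fun x hx i => by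
    have := norm_le_pi_norm x i
    rw [Real.norm_eq_abs] at this
    linarith [le_abs_self ρ]
  obtain ⟨B, hB0, hB⟩ : ∃ B, 0 ≤ B ∧ ∀ x : σ → ℝ, ‖x‖ < ρ + 2 → ∀ j, |eval x (pderiv j f)| ≤ B := by
    choose C D hC hCD using fun j => poly_bound (pderiv j f)
    have h1 : ∀ j, 0 ≤ C j * R ^ D j := fun j => mul_nonneg (hC j).le (by positivity)
    refine ⟨∑ j, C j * R ^ D j, Finset.sum_nonneg fun j _ => h1 j, fun x hx j => ?_⟩
    refine (hCD j x R (by linarith) (hxR x hx)).trans ?_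
    exact Finset.single_le_sum (f := fun j => C j * R ^ D j) (fun j _ => h1 j) (Finset.mem_univ j)
  set η : ℝ := 1 / (2 * L + B + 1) with hη
  have hη0 : 0 < η := by positivity
  have hηL : L * η ≤ 1 / 2 := by
    rw [hη, mul_one_div, div_le_iff₀ (by positivity)]; linarith
  have hηB : η * B ≤ 1 := by
    rw [hη, one_div_mul_eq_div, div_le_iff₀ (by positivity)]; linarith
  let S : (σ → ℝ) → σ → ℝ := fun x j => x j - η * eval x (pderiv j f)
  let G : (σ → ℝ) → ℝ := fun x => ∑ j, (eval x (pderiv j f)) ^ 2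
  have hG0 : ∀ x, 0 ≤ G x := fun x => Finset.sum_nonneg fun j _ => sq_nonneg _
  have hGj : ∀ x j, |eval x (pderiv j f)| ≤ √(G x) := fun x j => by
    apply Real.abs_le_sqrt
    exact Finset.single_le_sum (f := fun j => (eval x (pderiv j f)) ^ 2)
      (fun j _ => sq_nonneg _) (Finset.mem_univ j)
  have hvn : ∀ x, ‖S x - x‖ ≤ η * √(G x) := fun x => by
    rw [pi_norm_le_iff_of_nonneg (by positivity)]
    intro j
    have : (S x - x) j = - (η * eval x (pderiv j f)) := by simp [S]
    rw [this, norm_neg, Real.norm_eq_abs, abs_mul, abs_of_pos hη0]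
    exact mul_le_mul_of_nonneg_left (hGj x j) hη0.le
  have hdec : ∀ x, ‖x‖ < ρ + 2 → eval (S x) f ≤ eval x f - η / 2 * G x := by
    intro x hx
    have hv1 : ‖S x - x‖ ≤ 1 := by
      rw [pi_norm_le_iff_of_nonneg (by positivity)]
      intro j
      have : (S x - x) j = - (η * eval x (pderiv j f)) := by simp [S]
      rw [this, norm_neg, Real.norm_eq_abs, abs_mul, abs_of_pos hη0]
      exact (mul_le_mul_of_nonneg_left (hB x hx j) hη0.le).trans hηB
    have h1 := (abs_le.1 (hTay x (S x - x) hx.le hv1)).2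
    have h2 : x + (S x - x) = S x := by abel
    rw [h2] at h1
    have h3 : ∑ j, eval x (pderiv j f) * (S x - x) j = - (η * G x) := by
      simp only [S, G, Pi.sub_apply, Finset.mul_sum, ← Finset.sum_neg_distrib]
      exact Finset.sum_congr rfl fun j _ => by ring
    rw [h3] at h1
    have h4 : ‖S x - x‖ ^ 2 ≤ η ^ 2 * G x := by
      calc ‖S x - x‖ ^ 2 ≤ (η * √(G x)) ^ 2 := pow_le_pow_left₀ (norm_nonneg _) (hvn x) 2
        _ = _ := by rw [mul_pow, Real.sq_sqrt (hG0 x)]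
    have h5 : L * ‖S x - x‖ ^ 2 ≤ η / 2 * G x := by
      calc L * ‖S x - x‖ ^ 2 ≤ L * (η ^ 2 * G x) := mul_le_mul_of_nonneg_left h4 hL
        _ = (L * η) * (η * G x) := by ring
        _ ≤ 1 / 2 * (η * G x) := mul_le_mul_of_nonneg_right hηL (mul_nonneg hη0.le (hG0 x))
        _ = _ := by ring
    linarith
  -- Lojasiewicz
  set E : ℕ := D + 1 with hE
  have hloj : ∀ x, ‖x‖ < ρ + 2 → 0 < eval x f → C * (eval x f) * (2 * R) ^ E < 1 →
      R < √(G x) / eval x f ∧ (eval x f) ^ D ≤ C * 2 ^ E * √(G x) ^ E := by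
    intro x hx hy hs
    set y := eval x f with hyd
    set g := √(G x) with hg
    have hg0 : 0 ≤ g := Real.sqrt_nonneg _
    have h1 := hQ x hy.ne'
    have h2 := hCD (Sum.elim x (fun j => eval x (pderiv j f) / eval x f)) (R + g / y)
      (by have : 0 ≤ g / y := div_nonneg hg0 hy.le
          linarith) (by
      rintro (i | i)
      · have : 0 ≤ g / y := div_nonneg hg0 hy.le
        simp only [Sum.elim_inl]
        linarith [hxR x hx i]
      · simp only [Sum.elim_inr]
        rw [abs_div, abs_of_pos hy]
        have := div_le_div_of_nonneg_right (hGj x i) hy.le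
        linarith)
    have hM1 : 1 ≤ R + g / y := by
      have : 0 ≤ g / y := div_nonneg hg0 hy.le
      linarith
    have h3 : 1 ≤ C * y * (R + g / y) ^ E := by
      have h4 : y * eval (Sum.elim x (fun j => eval x (pderiv j f) / eval x f)) Q
          ≤ y * (C * (R + g / y) ^ D) := mul_le_mul_of_nonneg_left ((le_abs_self _).trans h2) hy.le
      rw [h1] at h4
      have h5 : (R + g / y) ^ D ≤ (R + g / y) ^ E := pow_le_pow_right₀ hM1 (by omega)
      calc (1:ℝ) ≤ y * (C * (R + g / y) ^ D) := h4
        _ ≤ y * (C * (R + g / y) ^ E) := by gcongr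
        _ = _ := by ring
    have hRg : R < g / y := by
      by_contra hcon
      push Not at hcon
      have : C * y * (R + g / y) ^ E ≤ C * y * (2 * R) ^ E := by
        have : R + g / y ≤ 2 * R := by linarith
        gcongr
      linarith
    refine ⟨hRg, ?_⟩
    have h6 : 1 ≤ C * y * (2 * (g / y)) ^ E := by
      refine h3.trans ?_
      have : R + g / y ≤ 2 * (g / y) := by linarith
      gcongr
    have h7 : C * y * (2 * (g / y)) ^ E = C * 2 ^ E * g ^ E / y ^ D := by
      rw [mul_pow, div_pow, hE, pow_succ y]; field_simp
    rw [h7, le_div_iff₀ (pow_pos hy _), one_mul] at h6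
    exact h6
  set θ : ℝ := 1 / E with hθ
  have hE1 : (1:ℝ) ≤ E := by rw [hE]; push_cast; linarith [Nat.cast_nonneg (α := ℝ) D]
  have hθ0 : 0 < θ := by positivity
  have hθ1 : θ ≤ 1 := by rw [hθ, div_le_one (by linarith)]; exact hE1
  set c : ℝ := (C * 2 ^ E) ^ θ with hc
  have hc0 : 0 < c := Real.rpow_pos_of_pos (by positivity) _
  set A : ℝ := (C + 1) * (2 * R) + 2 * c * E with hA
  have hA0 : 0 < A := by positivity
  let φ : (σ → ℝ) → ℝ := fun x => A * (eval x f) ^ θ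
  have hφ0 : ∀ x, φ x = 0 ↔ eval x f = 0 := fun x => by
    simp only [φ, mul_eq_zero, hA0.ne', false_or]
    rw [Real.rpow_eq_zero (h0 x) hθ0.ne']
  have hsmall : ∀ x, φ x < 1 → C * (eval x f) * (2 * R) ^ E < 1 := by
    intro x hx
    have h1 : (φ x) ^ E < 1 := pow_lt_one₀ (mul_nonneg hA0.le (Real.rpow_nonneg (h0 x) _)) hx (by omega)
    have h2 : (φ x) ^ E = A ^ E * eval x f := by
      simp only [φ]
      rw [mul_pow, ← Real.rpow_natCast ((eval x f) ^ θ), ← Real.rpow_mul (h0 x), hθ,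
        one_div_mul_cancel (by positivity), Real.rpow_one]
    rw [h2] at h1
    refine lt_of_le_of_lt ?_ h1
    have h3 : C * (2 * R) ^ E ≤ A ^ E := by
      calc C * (2 * R) ^ E ≤ (C + 1) ^ E * (2 * R) ^ E := by
            gcongr
            calc C ≤ C + 1 := by linarith
              _ ≤ (C + 1) ^ E := le_self_pow₀ (by linarith) (by omega)
        _ = ((C + 1) * (2 * R)) ^ E := (mul_pow _ _ _).symm
        _ ≤ A ^ E := by
            apply pow_le_pow_left₀ (by positivity)
            rw [hA]; linarith [show 0 ≤ 2 * c * E by positivity]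
    calc C * eval x f * (2 * R) ^ E = (C * (2 * R) ^ E) * eval x f := by ring
      _ ≤ A ^ E * eval x f := mul_le_mul_of_nonneg_right h3 (h0 x)
  have hSx : ∀ x, G x = 0 → S x = x := by
    intro x hx
    have := hvn x
    rw [hx, Real.sqrt_zero, mul_zero] at this
    exact sub_eq_zero.1 (norm_le_zero_iff.1 this)
  have hpc : ∀ p : MvPolynomial (σ) ℝ, Continuous fun x => eval x p := fun p =>
    MvPolynomial.continuous_eval p
  have hfin := enr_descent (φ := φ) (S := S) (ρ := ρ) ?_ ?_ ?_ ?_ ?_ ?_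
  · have : {x | φ x = 0} = {x : σ → ℝ | eval x f = 0} := by ext x; exact hφ0 x
    rwa [this] at hfin
  · exact continuous_const.mul ((hpc f).rpow_const fun x => Or.inr hθ0.le)
  · exact continuous_pi fun j => (continuous_apply j).sub (continuous_const.mul (hpc _))
  · exact fun x => mul_nonneg hA0.le (Real.rpow_nonneg (h0 x) _)
  · exact fun x hx => hX x ((hφ0 x).1 hx)
  · intro x hx hφx
    rcases (h0 x).eq_or_lt with hy | hy
    · have h1 := hdec x hx
      have h2 := h0 (S x)
      have h3 : G x = 0 := by
        refine le_antisymm ?_ (hG0 x)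
        by_contra hcon
        push Not at hcon
        have : 0 < η / 2 * G x := by positivity
        linarith
      rw [hSx x h3]; simp
    · obtain ⟨h1, h2⟩ := hloj x hx hy (hsmall x hφx)
      set y := eval x f with hyd
      set g := √(G x) with hg
      have hgG : G x = g ^ 2 := (Real.sq_sqrt (hG0 x)).symm
      have h3 : y ^ (1 - θ) ≤ c * g := by
        have h4 := Real.rpow_le_rpow (pow_nonneg hy.le _) h2 hθ0.le
        have hg0 : 0 ≤ g := Real.sqrt_nonneg _
        rw [Real.mul_rpow (by positivity) (pow_nonneg hg0 _), ← Real.rpow_natCast g,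
          ← Real.rpow_mul hg0, ← Real.rpow_natCast y, ← Real.rpow_mul hy.le] at h4
        have e1 : (E:ℝ) * θ = 1 := by rw [hθ]; field_simp
        have e2 : (D:ℝ) * θ = 1 - θ := by
          have : (E:ℝ) = D + 1 := by rw [hE]; push_cast; ring
          rw [this] at e1; linarith
        rw [e1, e2, Real.rpow_one] at h4
        exact h4
      have hb := h0 (S x)
      have hd := hdec x hx
      have hber : (eval (S x) f) ^ θ ≤ y ^ θ * (1 + θ * (eval (S x) f / y - 1)) := by
        have h5 := rpow_one_add_le_one_add_mul_self (s := eval (S x) f / y - 1) (p := θ)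
          (by have : 0 ≤ eval (S x) f / y := div_nonneg hb hy.le
              linarith) hθ0.le hθ1
        have h6 : eval (S x) f = y * (eval (S x) f / y) := by field_simp
        conv_lhs => rw [h6]
        rw [Real.mul_rpow hy.le (div_nonneg hb hy.le)]
        refine mul_le_mul_of_nonneg_left ?_ (Real.rpow_nonneg hy.le _)
        rwa [add_sub_cancel] at h5
      rw [dist_comm, dist_eq_norm]
      refine (hvn x).trans ?_
      have h7 : y ^ θ * (θ * (η / 2 * g ^ 2 / y)) ≤ y ^ θ - (eval (S x) f) ^ θ := by
        have h8 : eval (S x) f / y - 1 ≤ - (η / 2 * g ^ 2 / y) := by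
          rw [div_sub_one hy.ne', ← neg_div]
          apply div_le_div_of_nonneg_right _ hy.le
          rw [← hgG]; linarith
        have h9 : y ^ θ * (1 + θ * (eval (S x) f / y - 1)) ≤ y ^ θ * (1 + θ * (- (η / 2 * g ^ 2 / y))) := by
          gcongr
        linarith
      have h10 : y ^ θ = y / y ^ (1 - θ) := by
        rw [eq_div_iff (Real.rpow_pos_of_pos hy _).ne', ← Real.rpow_add hy]; simp
      have hg1 : 0 < g := by
        have : 0 < g / y := lt_trans (by linarith) h1
        exact (div_pos_iff_of_pos_right hy).1 this
      have h11 : θ * (η / 2) * g / c ≤ y ^ θ * (θ * (η / 2 * g ^ 2 / y)) := by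
        rw [h10]
        have : y / y ^ (1 - θ) * (θ * (η / 2 * g ^ 2 / y)) = θ * (η / 2) * g ^ 2 / y ^ (1 - θ) := by
          have : 0 < y ^ (1 - θ) := Real.rpow_pos_of_pos hy _
          field_simp
        rw [this, div_le_div_iff₀ hc0 (Real.rpow_pos_of_pos hy _)]
        calc θ * (η / 2) * g * y ^ (1 - θ) ≤ θ * (η / 2) * g * (c * g) := by gcongr
          _ = _ := by ring
      have h12 : φ x - φ (S x) = A * (y ^ θ - (eval (S x) f) ^ θ) := by simp only [φ]; ring
      rw [h12]
      calc η * g = (2 * c * E) * (θ * (η / 2) * g / c) := by rw [hθ]; field_simp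
        _ ≤ A * (θ * (η / 2) * g / c) := by
          gcongr
          rw [hA]; linarith [show 0 ≤ (C + 1) * (2 * R) by positivity]
        _ ≤ _ := by gcongr; exact h11.trans h7
  · intro x hx hφx hS
    rw [hφ0]
    by_contra hne
    have hy : 0 < eval x f := lt_of_le_of_ne (h0 x) (Ne.symm hne)
    obtain ⟨h1, -⟩ := hloj x hx hy (hsmall x hφx)
    have hG : G x = 0 := by
      refine Finset.sum_eq_zero fun j _ => ?_
      have := congrFun hS j
      simp only [S, sub_eq_self, mul_eq_zero, hη0.ne', false_or] at this
      rw [this]; simp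
    rw [hG, Real.sqrt_zero, zero_div] at h1
    linarith
end HV

namespace HV

/-- Real algebraic sets, presented by one nonnegative polynomial. -/
def RAS {σ : Type} (S : Set (σ → ℝ)) : Prop :=
  ∃ f : MvPolynomial σ ℝ, (∀ x, 0 ≤ eval x f) ∧ S = {x | eval x f = 0}

lemma ras_all {σ ι : Type} [Fintype ι] {S : ι → Set (σ → ℝ)} (h : ∀ i, RAS (S i)) :
    RAS {x | ∀ i, x ∈ S i} := by
  choose f h0 hf using h
  refine ⟨∑ i, f i, fun x => ?_, ?_⟩
  · rw [map_sum]; exact Finset.sum_nonneg fun i _ => h0 i x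
  · ext x
    simp only [Set.mem_setOf_eq, map_sum]
    rw [Finset.sum_eq_zero_iff_of_nonneg fun i _ => h0 i x]
    simp [hf]

lemma ras_inter {σ : Type} {S T : Set (σ → ℝ)} (hS : RAS S) (hT : RAS T) : RAS (S ∩ T) := by
  obtain ⟨f, f0, rfl⟩ := hS
  obtain ⟨g, g0, rfl⟩ := hT
  refine ⟨f + g, fun x => ?_, ?_⟩
  · rw [map_add]; exact add_nonneg (f0 x) (g0 x)
  · ext x
    simp only [Set.mem_setOf_eq, map_add, Set.mem_inter_iff]
    rw [add_eq_zero_iff_of_nonneg (f0 x) (g0 x)]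

lemma ras_real {σ : Type} (f : MvPolynomial σ ℝ) : RAS {x | eval x f = 0} :=
  ⟨f ^ 2, fun x => by rw [map_pow]; positivity, by ext x; simp⟩

lemma re_im_poly {σ : Type} (q : MvPolynomial σ ℂ) : ∃ u v : MvPolynomial σ ℝ, ∀ x : σ → ℝ,
    eval (fun i => (x i : ℂ)) q = (eval x u : ℂ) + (eval x v : ℂ) * Complex.I := by
  induction q using MvPolynomial.induction_on with
  | C a => exact ⟨C a.re, C a.im, fun x => by simp⟩
  | add p q hp hq =>
    obtain ⟨u, v, h⟩ := hp
    obtain ⟨u', v', h'⟩ := hq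
    refine ⟨u + u', v + v', fun x => ?_⟩
    rw [map_add, h, h']; simp only [map_add, Complex.ofReal_add]; ring
  | mul_X p i hp =>
    obtain ⟨u, v, h⟩ := hp
    refine ⟨u * X i, v * X i, fun x => ?_⟩
    rw [map_mul, h]; simp only [map_mul, eval_X, Complex.ofReal_mul]; ring

lemma ras_complex {σ : Type} (q : MvPolynomial σ ℂ) :
    RAS {x | eval (fun i => (x i : ℂ)) q = 0} := by
  obtain ⟨u, v, h⟩ := re_im_poly q
  convert ras_inter (ras_real u) (ras_real v) using 1
  ext x
  simp only [Set.mem_setOf_eq, h, Set.mem_inter_iff, Complex.ext_iff]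
  simp

variable {N : ℕ}

/-- The index type of the ambient real vector space. -/
abbrev EI (N : ℕ) := Fin N × Fin N × Bool

/-- Squared norm. -/
noncomputable def nn (z : Fin N → ℂ) : ℝ := ∑ i, Complex.normSq (z i)

lemma nn_eq (z : Fin N → ℂ) : ((nn z : ℝ) : ℂ) = ∑ i, z i * (starRingEnd ℂ) (z i) := by
  simp [nn, Complex.mul_conj]

lemma nn_pos {z : Fin N → ℂ} (hz : z ≠ 0) : 0 < nn z := by
  obtain ⟨i, hi⟩ := Function.ne_iff.1 hz
  exact Finset.sum_pos' (fun i _ => Complex.normSq_nonneg _) ⟨i, Finset.mem_univ _,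
    Complex.normSq_pos.2 hi⟩

/-- The projector on a line, as a complex matrix. -/
noncomputable def prj (z : Fin N → ℂ) (i j : Fin N) : ℂ := z i * (starRingEnd ℂ) (z j) / (nn z : ℂ)

/-- The embedding of projective space in a real vector space. -/
noncomputable def Psi (z : Fin N → ℂ) : EI N → ℝ := fun t =>
  if t.2.2 then (prj z t.1 t.2.1).im else (prj z t.1 t.2.1).re

/-- Matrix entries. -/
noncomputable def ent (x : EI N → ℝ) (i j : Fin N) : ℂ :=
  (x (i, j, false) : ℂ) + (x (i, j, true) : ℂ) * Complex.I

lemma ent_Psi (z : Fin N → ℂ) (i j : Fin N) : ent (Psi z) i j = prj z i j := by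
  simp [ent, Psi, Complex.re_add_im]

lemma ent_ext {x y : EI N → ℝ} (h : ∀ i j, ent x i j = ent y i j) : x = y := by
  funext ⟨i, j, b⟩
  have := h i j
  simp only [ent, Complex.ext_iff] at this
  simp at this
  cases b
  · exact this.1
  · exact this.2

lemma continuous_ent (i j : Fin N) : Continuous fun x : EI N → ℝ => ent x i j := by
  unfold ent; fun_prop

lemma Psi_smul (z : Fin N → ℂ) {l : ℂ} (hl : l ≠ 0) : Psi (l • z) = Psi z := by
  apply ent_ext
  intro i j
  rw [ent_Psi, ent_Psi]
  have hn : nn (l • z) = Complex.normSq l * nn z := by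
    simp [nn, Finset.mul_sum]
  have : (Complex.normSq l : ℂ) ≠ 0 := by simpa using hl
  unfold prj
  rw [hn]
  simp only [Pi.smul_apply, smul_eq_mul, map_mul, Complex.ofReal_mul]
  rw [show l * z i * ((starRingEnd ℂ) l * (starRingEnd ℂ) (z j)) =
    (Complex.normSq l : ℂ) * (z i * (starRingEnd ℂ) (z j)) by rw [← Complex.mul_conj]; ring]
  rw [mul_div_mul_left _ _ this]

lemma prj_ratio {z : Fin N → ℂ} (hz : z ≠ 0) {i : Fin N} (hi : z i ≠ 0) (j : Fin N) :
    prj z j i / prj z i i = z j / z i := by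
  have h := (nn_pos hz).ne'
  have h' : (nn z : ℂ) ≠ 0 := by exact_mod_cast h
  have h3 : (starRingEnd ℂ) (z i) ≠ 0 := by simpa using hi
  unfold prj
  field_simp

lemma Psi_inj {z w : Fin N → ℂ} (hz : z ≠ 0) (hw : w ≠ 0) (h : Psi z = Psi w) :
    ∃ l : ℂ, l ≠ 0 ∧ w = l • z := by
  obtain ⟨i, hi⟩ := Function.ne_iff.1 hz
  have hp : ∀ j k, prj z j k = prj w j k := fun j k => by rw [← ent_Psi, h, ent_Psi]
  have h0 : prj z i i ≠ 0 := by
    have h := (nn_pos hz).ne'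
    have h' : (nn z : ℂ) ≠ 0 := by exact_mod_cast h
    have h3 : (starRingEnd ℂ) (z i) ≠ 0 := by simpa using hi
    unfold prj
    exact div_ne_zero (mul_ne_zero hi h3) h'
  have hwi : w i ≠ 0 := by
    intro hw0
    rw [hp] at h0
    simp [prj, hw0] at h0
  refine ⟨w i / z i, div_ne_zero hwi hi, ?_⟩
  funext j
  have h1 := prj_ratio hz hi j
  have h2 := prj_ratio hw hwi j
  rw [hp, hp, h2] at h1
  have hi' : z i ≠ 0 := hi
  simp only [Pi.smul_apply, smul_eq_mul]
  field_simp at h1 ⊢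
  linear_combination h1

lemma continuousOn_Psi : ContinuousOn (Psi (N := N)) {z | z ≠ 0} := by
  have hp : ∀ i j, ContinuousOn (fun z : Fin N → ℂ => prj z i j) {z | z ≠ 0} := by
    intro i j
    unfold prj
    apply ContinuousOn.div
    · exact ((continuous_apply i).mul
        (Complex.continuous_conj.comp (continuous_apply j))).continuousOn
    · apply Continuous.continuousOn
      apply Complex.continuous_ofReal.comp
      unfold nn
      exact continuous_finset_sum _ fun i _ => Complex.continuous_normSq.comp (continuous_apply i)
    · intro z hz
      exact_mod_cast (nn_pos hz).ne'
  apply continuousOn_pi.2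
  rintro ⟨i, j, b⟩
  cases b
  · exact Complex.continuous_re.comp_continuousOn (hp i j)
  · exact Complex.continuous_im.comp_continuousOn (hp i j)

lemma exists_finset_zero {σ : Type} [Finite σ] (T : Set (MvPolynomial σ ℂ)) :
    ∃ T' : Finset (MvPolynomial σ ℂ), (T' : Set _) ⊆ T ∧
      ∀ z : σ → ℂ, (∀ q ∈ T', eval z q = 0) → ∀ q ∈ T, eval z q = 0 := by
  have : (Ideal.span T).FG := Ideal.fg_of_isNoetherianRing _
  obtain ⟨T', hT', h⟩ := (Submodule.fg_span_iff_fg_span_finset_subset T).1 this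
  refine ⟨T', hT', fun z hz q hq => ?_⟩
  have h1 : q ∈ Ideal.span (T' : Set (MvPolynomial σ ℂ)) := by
    have := Ideal.subset_span hq
    unfold Ideal.span at this ⊢
    rwa [h] at this
  have h2 : Ideal.span (T' : Set (MvPolynomial σ ℂ)) ≤ RingHom.ker (eval z) := by
    rw [Ideal.span_le]
    exact fun q hq => hz q hq
  exact h2 h1

/-- Algebraic cones. -/
structure AC (K : Set (Fin N → ℂ)) : Prop where
  zero : (0 : Fin N → ℂ) ∈ K
  smul : ∀ z ∈ K, ∀ l : ℂ, l • z ∈ K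
  alg : ∃ T : Finset (MvPolynomial (Fin N) ℂ), K = {z | ∀ q ∈ T, eval z q = 0}

/-- The projective variety of a cone. -/
def PV (K : Set (Fin N → ℂ)) : Set (EI N → ℝ) := {x | ∃ z, z ≠ 0 ∧ z ∈ K ∧ Psi z = x}

lemma AC.union {K L : Set (Fin N → ℂ)} (hK : AC K) (hL : AC L) : AC (K ∪ L) := by
  classical
  refine ⟨Or.inl hK.zero, ?_, ?_⟩
  · rintro z (hz | hz) l
    · exact Or.inl (hK.smul z hz l)
    · exact Or.inr (hL.smul z hz l)
  · obtain ⟨T, hT⟩ := hK.alg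
    obtain ⟨U, hU⟩ := hL.alg
    refine ⟨(T ×ˢ U).image fun t => t.1 * t.2, ?_⟩
    ext z
    simp only [Set.mem_union, hT, hU, Set.mem_setOf_eq, Finset.mem_image, Finset.mem_product]
    constructor
    · rintro (h | h) _ ⟨⟨a, b⟩, ⟨ha, hb⟩, rfl⟩
      · simp [h a ha]
      · simp [h b hb]
    · intro h
      by_contra hc
      push Not at hc
      obtain ⟨⟨a, ha, ha'⟩, b, hb, hb'⟩ := hc
      have := h _ ⟨(a, b), ⟨ha, hb⟩, rfl⟩
      simp [ha', hb'] at this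

lemma AC.inter {K L : Set (Fin N → ℂ)} (hK : AC K) (hL : AC L) : AC (K ∩ L) := by
  classical
  refine ⟨⟨hK.zero, hL.zero⟩, fun z hz l => ⟨hK.smul z hz.1 l, hL.smul z hz.2 l⟩, ?_⟩
  obtain ⟨T, hT⟩ := hK.alg
  obtain ⟨U, hU⟩ := hL.alg
  refine ⟨T ∪ U, ?_⟩
  ext z
  simp only [Set.mem_inter_iff, hT, hU, Set.mem_setOf_eq, Finset.mem_union]
  exact ⟨fun h q hq => hq.elim (h.1 q) (h.2 q), fun h => ⟨fun q hq => h q (Or.inl hq),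
    fun q hq => h q (Or.inr hq)⟩⟩

lemma ac_zero : AC ({0} : Set (Fin N → ℂ)) := by
  classical
  refine ⟨rfl, ?_, Finset.univ.image X, ?_⟩
  · rintro z rfl l; simp
  · ext z
    simp [funext_iff]

lemma PV_union (K L : Set (Fin N → ℂ)) : PV (K ∪ L) = PV K ∪ PV L := by
  ext x
  constructor
  · rintro ⟨z, h0, h | h, e⟩
    · exact Or.inl ⟨z, h0, h, e⟩
    · exact Or.inr ⟨z, h0, h, e⟩
  · rintro (⟨z, h0, h, e⟩ | ⟨z, h0, h, e⟩)
    · exact ⟨z, h0, Or.inl h, e⟩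
    · exact ⟨z, h0, Or.inr h, e⟩

lemma PV_mono {K L : Set (Fin N → ℂ)} (h : K ⊆ L) : PV K ⊆ PV L := by
  rintro x ⟨z, h0, hz, e⟩
  exact ⟨z, h0, h hz, e⟩

lemma Psi_mem_PV {K : Set (Fin N → ℂ)} (hK : AC K) {z : Fin N → ℂ} (hz : z ≠ 0) :
    Psi z ∈ PV K ↔ z ∈ K := by
  constructor
  · rintro ⟨w, hw, hwK, e⟩
    obtain ⟨l, hl, rfl⟩ := Psi_inj hw hz e
    exact hK.smul _ hwK _
  · exact fun h => ⟨z, hz, h, rfl⟩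

lemma PV_inter {K L : Set (Fin N → ℂ)} (hK : AC K) (hL : AC L) : PV (K ∩ L) = PV K ∩ PV L := by
  ext x
  constructor
  · rintro ⟨z, h0, h, e⟩
    exact ⟨⟨z, h0, h.1, e⟩, ⟨z, h0, h.2, e⟩⟩
  · rintro ⟨⟨z, h0, h, rfl⟩, h2⟩
    exact ⟨z, h0, ⟨h, (Psi_mem_PV hL h0).1 h2⟩, rfl⟩

lemma PV_subset {K L : Set (Fin N → ℂ)} (hK : AC K) (hL : AC L) : PV K ⊆ PV L ↔ K ⊆ L := by
  refine ⟨fun h z hz => ?_, PV_mono⟩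
  by_cases h0 : z = 0
  · rw [h0]; exact hL.zero
  · exact (Psi_mem_PV hL h0).1 (h ⟨z, h0, hz, rfl⟩)

lemma PV_zero : PV ({0} : Set (Fin N → ℂ)) = ∅ := by
  ext x
  simp only [PV, Set.mem_singleton_iff, Set.mem_setOf_eq, Set.mem_empty_iff_false, iff_false]
  rintro ⟨z, h, h', -⟩
  exact h h'

lemma PV_char {K : Set (Fin N → ℂ)} {T : Finset (MvPolynomial (Fin N) ℂ)} (hK : AC K)
    (hT : K = {z | ∀ q ∈ T, eval z q = 0}) (x : EI N → ℝ) :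
    x ∈ PV K ↔ (∀ i j, ent x i j = (starRingEnd ℂ) (ent x j i)) ∧ (∑ i, ent x i i = 1) ∧
      (∀ i j k l, ent x i j * ent x k l = ent x i l * ent x k j) ∧
      ∀ q ∈ T, ∀ k, eval (fun i => ent x i k) q = 0 := by
  constructor
  · rintro ⟨z, h0, hz, rfl⟩
    have h' : (nn z : ℂ) ≠ 0 := by exact_mod_cast (nn_pos h0).ne'
    simp only [ent_Psi]
    refine ⟨fun i j => ?_, ?_, fun i j k l => ?_, fun q hq k => ?_⟩
    · simp [prj, mul_comm]
    · simp only [prj]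
      rw [← Finset.sum_div, ← nn_eq, div_self h']
    · simp only [prj]; ring
    · have := hK.smul z hz ((starRingEnd ℂ) (z k) / (nn z : ℂ))
      rw [hT] at this
      have h2 := this q hq
      have e : (fun i => prj z i k) = ((starRingEnd ℂ) (z k) / (nn z : ℂ)) • z := by
        funext i
        simp only [prj, Pi.smul_apply, smul_eq_mul]; ring
      rw [e]; exact h2
  · rintro ⟨hh, ht, hr, hq⟩
    obtain ⟨k, -, hk⟩ : ∃ k ∈ Finset.univ, ent x k k ≠ 0 := by
      apply Finset.exists_ne_zero_of_sum_ne_zero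
      rw [ht]; exact one_ne_zero
    have hz0 : (fun i => ent x i k) ≠ 0 := fun h => hk (congrFun h k)
    have hp : ∀ i j, ent x i k * (starRingEnd ℂ) (ent x j k) = ent x i j * ent x k k := by
      intro i j
      rw [← hh k j, hr i k k j]
    refine ⟨fun i => ent x i k, hz0, ?_, ?_⟩
    · rw [hT]; exact fun q h => hq q h k
    · apply ent_ext
      intro i j
      rw [ent_Psi]
      unfold prj
      rw [nn_eq, hp]
      simp_rw [hp]
      rw [← Finset.sum_mul, ht, one_mul, mul_div_assoc, div_self hk, mul_one]

/-- Matrix entries as complex polynomials. -/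
noncomputable def entP (i j : Fin N) : MvPolynomial (EI N) ℂ :=
  X (i, j, false) + X (i, j, true) * C Complex.I

lemma eval_entP (x : EI N → ℝ) (i j : Fin N) :
    eval (fun t => (x t : ℂ)) (entP i j) = ent x i j := by
  simp [entP, ent]

lemma PV_ras {K : Set (Fin N → ℂ)} (hK : AC K) : RAS (PV K) := by
  obtain ⟨T, hT⟩ := hK.alg
  have h1 : RAS {x : EI N → ℝ | ∀ i j, ent x i j = (starRingEnd ℂ) (ent x j i)} := by
    have : ∀ i j : Fin N, RAS {x : EI N → ℝ | ent x i j = (starRingEnd ℂ) (ent x j i)} := by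
      intro i j
      convert ras_inter (ras_real (X (i, j, false) - X (j, i, false) : MvPolynomial (EI N) ℝ))
        (ras_real (X (i, j, true) + X (j, i, true) : MvPolynomial (EI N) ℝ)) using 1
      ext x
      simp only [Set.mem_setOf_eq, ent, Complex.ext_iff, Set.mem_inter_iff]
      simp [sub_eq_zero, eq_neg_iff_add_eq_zero]
    exact ras_all fun i => ras_all fun j => this i j
  have h2 : RAS {x : EI N → ℝ | ∑ i, ent x i i = 1} := by
    convert ras_complex (∑ i, entP i i - 1 : MvPolynomial (EI N) ℂ) using 1
    ext x
    simp [eval_entP, sub_eq_zero]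
  have h3 : RAS {x : EI N → ℝ | ∀ i j k l, ent x i j * ent x k l = ent x i l * ent x k j} := by
    refine ras_all fun i => ras_all fun j => ras_all fun k => ras_all fun l => ?_
    have : {x : EI N → ℝ | ent x i j * ent x k l = ent x i l * ent x k j} =
        {x | eval (fun t => (x t : ℂ)) (entP i j * entP k l - entP i l * entP k j) = 0} := by
      ext x
      simp [eval_entP, sub_eq_zero]
    show RAS {x : EI N → ℝ | ent x i j * ent x k l = ent x i l * ent x k j}
    exact this ▸ ras_complex _
  have h4 : RAS {x : EI N → ℝ | ∀ q : T, ∀ k, eval (fun i => ent x i k) q.1 = 0} := by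
    refine ras_all fun q => ras_all fun k => ?_
    suffices h : {x : EI N → ℝ | eval (fun i => ent x i k) q.1 = 0} =
        {x | eval (fun t => (x t : ℂ)) (bind₁ (fun i => entP i k) q.1) = 0} by
      show RAS {x : EI N → ℝ | eval (fun i => ent x i k) q.1 = 0}
      exact h ▸ ras_complex _
    ext x
    simp only [Set.mem_setOf_eq]
    have : eval (fun t => (x t : ℂ)) (bind₁ (fun i => entP i k) q.1) =
        eval (fun i => ent x i k) q.1 := by
      rw [← MvPolynomial.coe_aeval_eq_eval, RingHom.coe_coe, aeval_bind₁,
        ← MvPolynomial.coe_aeval_eq_eval, RingHom.coe_coe]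
      congr 2
      funext i
      rw [← eval_entP, ← MvPolynomial.coe_aeval_eq_eval, RingHom.coe_coe]
    rw [this]
  convert ras_inter h1 (ras_inter h2 (ras_inter h3 h4)) using 1
  ext x
  rw [PV_char hK hT]
  simp only [Set.mem_inter_iff, Set.mem_setOf_eq, Subtype.forall]

lemma PV_bdd {K : Set (Fin N → ℂ)} (hK : AC K) {x : EI N → ℝ} (hx : x ∈ PV K) : ‖x‖ < 2 := by
  obtain ⟨z, h0, hz, rfl⟩ := hx
  have hp : ∀ i j, ‖prj z i j‖ ≤ 1 := by
    intro i j
    unfold prj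
    rw [norm_div, norm_mul, RCLike.norm_conj]
    have h1 := nn_pos h0
    rw [Complex.norm_real, Real.norm_of_nonneg h1.le, div_le_one h1]
    have hi : ∀ i, ‖z i‖ ^ 2 ≤ nn z := fun i => by
      rw [← Complex.normSq_eq_norm_sq]
      exact Finset.single_le_sum (f := fun i => Complex.normSq (z i))
        (fun i _ => Complex.normSq_nonneg _) (Finset.mem_univ i)
    nlinarith [hi i, hi j, sq_nonneg (‖z i‖ - ‖z j‖)]
  have : ‖Psi z‖ ≤ 1 := by
    rw [pi_norm_le_iff_of_nonneg zero_le_one]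
    rintro ⟨i, j, b⟩
    cases b
    · exact (Complex.abs_re_le_norm _).trans (hp i j)
    · exact (Complex.abs_im_le_norm _).trans (hp i j)
  linarith

lemma PV_compact {K : Set (Fin N → ℂ)} (hK : AC K) : IsCompact (PV K) := by
  apply Metric.isCompact_of_isClosed_isBounded
  · obtain ⟨f, h0, hf⟩ := PV_ras hK
    rw [hf]
    exact isClosed_eq (MvPolynomial.continuous_eval f) continuous_const
  · exact (Metric.isBounded_iff_subset_closedBall 0).2 ⟨2, fun x hx => by
      simpa using (PV_bdd hK hx).le⟩

lemma PV_enr {K : Set (Fin N → ℂ)} (hK : AC K) : ENR (PV K) := by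
  obtain ⟨f, h0, hf⟩ := PV_ras hK
  rw [hf]
  refine enr_zero f h0 (ρ := 2) fun x hx => PV_bdd hK ?_
  rw [hf]; exact hx

end HV

namespace HV

lemma trdeg_lt {A B : Type} [CommRing A] [IsDomain A] [CommRing B] [IsDomain B] [Algebra ℂ A]
    [Algebra ℂ B] [Algebra.FiniteType ℂ A] (f : A →ₐ[ℂ] B) (hf : Function.Surjective f)
    {e : A} (he : e ≠ 0) (hfe : f e = 0) :
    Cardinal.toNat (Algebra.trdeg ℂ B) < Cardinal.toNat (Algebra.trdeg ℂ A) := by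
  have hA : Algebra.trdeg ℂ A < Cardinal.aleph0 := trdeg_lt_aleph0_of_finiteType
  by_contra hc
  push Not at hc
  have hBA : Algebra.trdeg ℂ B ≤ Algebra.trdeg ℂ A := trdeg_le_of_surjective f hf
  have hB := hBA.trans_lt hA
  have hAB : Algebra.trdeg ℂ A ≤ Algebra.trdeg ℂ B :=
    (Cardinal.toNat_le_iff_le_of_lt_aleph0 hA hB).1 hc
  obtain ⟨ι, y, hy⟩ := exists_isTranscendenceBasis' ℂ B
  choose g hg using hf
  have hx : AlgebraicIndependent ℂ (fun i => g (y i)) := by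
    have h1 := hy.1
    rw [algebraicIndependent_iff] at h1 ⊢
    intro p hp
    apply h1
    have := congrArg f hp
    rw [map_zero, ← AlgHom.comp_apply, MvPolynomial.comp_aeval] at this
    simpa [hg] using this
  have hb : IsTranscendenceBasis ℂ (fun i => g (y i)) :=
    hx.isTranscendenceBasis_of_trdeg_le hA (by rw [hy.cardinalMk_eq_trdeg]; exact hAB)
  have halg := hb.isAlgebraic
  obtain ⟨r, hr0, hr⟩ := (halg.isAlgebraic e).exists_nonzero_dvd (mem_nonZeroDivisors_of_ne_zero he)
  obtain ⟨⟨r, hrm⟩, hrr⟩ : ∃ r', r' = r := ⟨r, rfl⟩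
  have hfr : f r = 0 := by
    obtain ⟨u, hu⟩ := hr
    have : (algebraMap (Algebra.adjoin ℂ (Set.range fun i => g (y i))) A) ⟨r, hrm⟩ = r := rfl
    rw [← hrr, this] at hu
    rw [hu, map_mul, hfe, zero_mul]
  rw [Algebra.adjoin_range_eq_range_aeval] at hrm
  obtain ⟨q, hq⟩ := hrm
  have hq' : aeval (fun i => g (y i)) q = r := hq
  have hq0 : q = 0 := by
    have h1 := hy.1
    rw [algebraicIndependent_iff] at h1
    apply h1
    have := congrArg f hq'
    rw [hfr, ← AlgHom.comp_apply, MvPolynomial.comp_aeval] at this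
    simpa [hg] using this
  apply hr0
  rw [← hrr]
  ext
  show r = 0
  rw [← hq', hq0, map_zero]

lemma prim_struct {R S : Type} [CommRing R] [IsDomain R] [IsIntegrallyClosed R] [CharZero R]
    [CommRing S] [IsDomain S] [Algebra R S] [FaithfulSMul R S] [Algebra.IsIntegral R S]
    [Algebra.FiniteType R S] :
    ∃ α : S, (∀ x : S, ∃ g : R, g ≠ 0 ∧ ∃ q : Polynomial R, Polynomial.aeval α q = g • x) ∧
      ∃ (a b : Polynomial R) (r : R), r ≠ 0 ∧
        a * minpoly R α + b * Polynomial.derivative (minpoly R α) = Polynomial.C r := by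
  let L := FractionRing R
  let F := FractionRing S
  let _ : Algebra L F := FractionRing.liftAlgebra R F
  have hfin : Module.Finite R S := Algebra.IsIntegral.finite
  have : FiniteDimensional L F := inferInstance
  have : CharZero L := charZero_of_injective_algebraMap (IsFractionRing.injective R L)
  obtain ⟨α₀, hα₀⟩ := Field.exists_primitive_element L F
  obtain ⟨x, y, hy, hxy⟩ := IsFractionRing.div_surjective (A := S) α₀
  obtain ⟨r, hr0, u, hu⟩ := ((Algebra.IsAlgebraic.isAlgebraic (R := R) y).exists_nonzero_dvd hy)
  have hy0 : algebraMap S F y ≠ 0 := by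
    simpa using nonZeroDivisors.ne_zero hy
  have hrL : algebraMap R L r ≠ 0 := by simpa using hr0
  obtain ⟨α, hα⟩ : ∃ α : S, α = x * u := ⟨_, rfl⟩
  have hαα : algebraMap S F α = algebraMap L F (algebraMap R L r) * α₀ := by
    rw [← IsScalarTower.algebraMap_apply, IsScalarTower.algebraMap_apply R S F, hu, ← hxy, hα,
      map_mul, map_mul, mul_div_assoc', eq_div_iff hy0]
    ring
  have htop : IntermediateField.adjoin L {algebraMap S F α} = ⊤ := by
    rw [eq_top_iff, ← hα₀, IntermediateField.adjoin_simple_le_iff]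
    have h1 := IntermediateField.mem_adjoin_simple_self L (algebraMap S F α)
    have h2 : α₀ = algebraMap L F (algebraMap R L r)⁻¹ * algebraMap S F α := by
      rw [hαα, ← mul_assoc, ← map_mul, inv_mul_cancel₀ hrL, map_one, one_mul]
    rw [h2]
    exact mul_mem (IntermediateField.algebraMap_mem _ _) h1
  have clear : ∀ p : Polynomial L, ∃ g : R, g ≠ 0 ∧ ∃ q : Polynomial R,
      q.map (algebraMap R L) = Polynomial.C (algebraMap R L g) * p := by
    intro p
    obtain ⟨b, hb⟩ := IsLocalization.integerNormalization_map_to_map (nonZeroDivisors R) p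
    refine ⟨b, nonZeroDivisors.ne_zero b.2, _, hb.trans ?_⟩
    rw [Polynomial.C_mul']
    ext n
    simp [Algebra.smul_def]
  refine ⟨α, fun x => ?_, ?_⟩
  · have hx : algebraMap S F x ∈ IntermediateField.adjoin L {algebraMap S F α} := by
      rw [htop]; trivial
    have hx' : algebraMap S F x ∈ Algebra.adjoin L {algebraMap S F α} := by
      rw [← IntermediateField.adjoin_simple_toSubalgebra_of_isAlgebraic
        (Algebra.IsAlgebraic.isAlgebraic _)]
      exact hx
    rw [Algebra.adjoin_singleton_eq_range_aeval] at hx'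
    obtain ⟨p, hp⟩ := hx'
    obtain ⟨g, hg, q, hq⟩ := clear p
    refine ⟨g, hg, q, ?_⟩
    apply IsFractionRing.injective S F
    have h1 : algebraMap S F (Polynomial.aeval α q) =
        Polynomial.aeval (algebraMap S F α) (q.map (algebraMap R L)) := by
      rw [Polynomial.aeval_map_algebraMap, Polynomial.aeval_algebraMap_apply]
    have hp' : Polynomial.aeval (algebraMap S F α) p = algebraMap S F x := hp
    rw [h1, hq, map_mul, Polynomial.aeval_C, hp', Algebra.smul_def, map_mul,
      ← IsScalarTower.algebraMap_apply, ← IsScalarTower.algebraMap_apply]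
  · have hitg : IsIntegral R α := Algebra.IsIntegral.isIntegral α
    have hm := minpoly.isIntegrallyClosed_eq_field_fractions L F hitg
    have hirr : Irreducible (minpoly L (algebraMap S F α)) :=
      minpoly.irreducible (Algebra.IsIntegral.isIntegral _)
    obtain ⟨a, b, hab⟩ := hirr.separable
    obtain ⟨g₁, h₁, q₁, e₁⟩ := clear a
    obtain ⟨g₂, h₂, q₂, e₂⟩ := clear b
    refine ⟨Polynomial.C g₂ * q₁, Polynomial.C g₁ * q₂, g₁ * g₂, mul_ne_zero h₁ h₂, ?_⟩
    apply Polynomial.map_injective _ (IsFractionRing.injective R L)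
    rw [Polynomial.map_add, Polynomial.map_mul, Polynomial.map_mul, Polynomial.map_mul,
      Polynomial.map_mul, e₁, e₂, ← Polynomial.derivative_map, ← hm, Polynomial.map_C,
      Polynomial.map_C, Polynomial.map_C, map_mul (algebraMap R L), Polynomial.C_mul]
    linear_combination (Polynomial.C (algebraMap R L g₁) * Polynomial.C (algebraMap R L g₂)) * hab

/-- The dimension attached to a prime ideal. -/
noncomputable def dm {N : ℕ} (P : Ideal (MvPolynomial (Fin N) ℂ)) : ℕ :=
  Cardinal.toNat (Algebra.trdeg ℂ (MvPolynomial (Fin N) ℂ ⧸ P))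

lemma dm_lt {N : ℕ} {P P' : Ideal (MvPolynomial (Fin N) ℂ)} [P.IsPrime] [P'.IsPrime] (h : P < P') :
    dm P' < dm P := by
  obtain ⟨hle, hn⟩ := h
  obtain ⟨e, he, he'⟩ := Set.not_subset.1 hn
  refine trdeg_lt (Ideal.Quotient.factorₐ ℂ hle) (Ideal.Quotient.factor_surjective hle)
    (e := Ideal.Quotient.mk P e) ?_ ?_
  · rwa [Ne, Ideal.Quotient.eq_zero_iff_mem]
  · rw [Ideal.Quotient.factorₐ_apply_mk, Ideal.Quotient.eq_zero_iff_mem]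
    exact he

/-- Evaluation at a point of the base and a value of the primitive element. -/
noncomputable def tht {k : ℕ} (t : Fin k → ℂ) (w : ℂ) :
    Polynomial (MvPolynomial (Fin k) ℂ) →+* ℂ := Polynomial.eval₂RingHom (eval t) w

lemma noether_dim {S : Type} [CommRing S] [IsDomain S] [Algebra ℂ S] {k : ℕ}
    (φ : MvPolynomial (Fin k) ℂ →ₐ[ℂ] S) (hinj : Function.Injective φ) (hitg : φ.IsIntegral) :
    Cardinal.toNat (Algebra.trdeg ℂ S) = k := by
  letI : Algebra (MvPolynomial (Fin k) ℂ) S := φ.toRingHom.toAlgebra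
  haveI : IsScalarTower ℂ (MvPolynomial (Fin k) ℂ) S :=
    IsScalarTower.of_algebraMap_eq fun x => (φ.commutes x).symm
  haveI : FaithfulSMul (MvPolynomial (Fin k) ℂ) S :=
    (faithfulSMul_iff_algebraMap_injective _ _).2 hinj
  haveI : Algebra.IsIntegral (MvPolynomial (Fin k) ℂ) S := ⟨hitg⟩
  rw [← trdeg_add_eq ℂ (MvPolynomial (Fin k) ℂ), trdeg_eq_zero (R := MvPolynomial (Fin k) ℂ) (A := S), add_zero,
    MvPolynomial.trdeg_of_isDomain]
  simp

lemma alg_struct_aux {N k : ℕ} {S : Type} [CommRing S] [IsDomain S] [Algebra ℂ S]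
    (π : MvPolynomial (Fin N) ℂ →ₐ[ℂ] S) (hπ : Function.Surjective π)
    (φ : MvPolynomial (Fin k) ℂ →ₐ[ℂ] S) (hinj : Function.Injective φ) (hitg : φ.IsIntegral)
    (h : MvPolynomial (Fin N) ℂ) (hh : π h ≠ 0) :
    ∃ (τ : Fin k → MvPolynomial (Fin N) ℂ) (s : MvPolynomial (Fin N) ℂ)
      (Q : Polynomial (MvPolynomial (Fin k) ℂ)) (g : MvPolynomial (Fin k) ℂ)
      (c : Fin N → Polynomial (MvPolynomial (Fin k) ℂ)),
      Q.Monic ∧ 0 < Q.natDegree ∧ g ≠ 0 ∧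
      (∀ t, eval t g ≠ 0 → (Q.map (eval t)).Separable) ∧
      (∀ z : Fin N → ℂ, (∀ f, π f = 0 → eval z f = 0) → eval (fun j => eval z (τ j)) g ≠ 0 →
        eval z h ≠ 0 ∧ tht (fun j => eval z (τ j)) (eval z s) Q = 0 ∧
        ∀ j, z j = tht (fun j => eval z (τ j)) (eval z s) (c j) /
          eval (fun j => eval z (τ j)) g) ∧
      (∀ t w, eval t g ≠ 0 → tht t w Q = 0 → ∀ z : Fin N → ℂ,
        (∀ j, z j = tht t w (c j) / eval t g) →
        (∀ f, π f = 0 → eval z f = 0) ∧ (∀ j, eval z (τ j) = t j) ∧ eval z s = w) := by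
  classical
  letI : Algebra (MvPolynomial (Fin k) ℂ) S := φ.toRingHom.toAlgebra
  haveI : IsScalarTower ℂ (MvPolynomial (Fin k) ℂ) S :=
    IsScalarTower.of_algebraMap_eq fun x => (φ.commutes x).symm
  haveI : FaithfulSMul (MvPolynomial (Fin k) ℂ) S :=
    (faithfulSMul_iff_algebraMap_injective _ _).2 hinj
  haveI : Module.IsTorsionFree (MvPolynomial (Fin k) ℂ) S := inferInstance
  haveI : Algebra.IsIntegral (MvPolynomial (Fin k) ℂ) S := ⟨hitg⟩
  haveI : Algebra.FiniteType ℂ S := Algebra.FiniteType.of_surjective π hπ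
  haveI : Algebra.FiniteType (MvPolynomial (Fin k) ℂ) S :=
    Algebra.FiniteType.of_restrictScalars_finiteType ℂ _ S
  have halg : ∀ r : MvPolynomial (Fin k) ℂ, algebraMap _ S r = φ r := fun r => rfl
  obtain ⟨α, hden, a, b, r, hr0, hab⟩ := prim_struct (R := MvPolynomial (Fin k) ℂ) (S := S)
  have hαi : IsIntegral (MvPolynomial (Fin k) ℂ) α := Algebra.IsIntegral.isIntegral α
  set Q := minpoly (MvPolynomial (Fin k) ℂ) α with hQ
  choose G hG q hq using fun j : Fin N => hden (π (X j))
  obtain ⟨e, he0, he⟩ := (Algebra.IsAlgebraic.isAlgebraic (R := MvPolynomial (Fin k) ℂ)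
    (π h)).exists_nonzero_dvd (mem_nonZeroDivisors_of_ne_zero hh)
  obtain ⟨u, hu⟩ := he
  choose τ hτ using fun j : Fin k => hπ (φ (X j))
  obtain ⟨s, hs⟩ := hπ α
  obtain ⟨v, hv⟩ := hπ u
  obtain ⟨g, hg⟩ : ∃ g, g = r * e * ∏ j, G j := ⟨_, rfl⟩
  have hg0 : g ≠ 0 := by
    rw [hg]
    exact mul_ne_zero (mul_ne_zero hr0 he0) (Finset.prod_ne_zero_iff.2 fun j _ => hG j)
  have hc : ∀ j, ∃ c : Polynomial (MvPolynomial (Fin k) ℂ),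
      Polynomial.aeval α c = g • π (X j) := by
    intro j
    refine ⟨Polynomial.C (r * e * ∏ i ∈ Finset.univ.erase j, G i) * q j, ?_⟩
    rw [map_mul, hq, Polynomial.aeval_C, ← Algebra.smul_def, smul_smul, hg,
      ← Finset.mul_prod_erase _ _ (Finset.mem_univ j)]
    congr 1
    ring
  choose c hc using hc
  have hQm : Q.Monic := minpoly.monic hαi
  -- transfer of identities to points
  have key : ∀ t w, eval t g ≠ 0 → tht t w Q = 0 → ∀ z : Fin N → ℂ,
      (∀ j, z j = tht t w (c j) / eval t g) → ∀ f u, π f = Polynomial.aeval α u →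
      eval z f = tht t w u := by
    intro t w ht hw z hz
    have tC : ∀ p, tht t w (Polynomial.C p) = eval t p := fun p => by simp [tht]
    have h1 : ∀ f, ∃ (D : ℕ) (F : Polynomial (MvPolynomial (Fin k) ℂ)),
        Polynomial.aeval α F = (g ^ D) • π f ∧ tht t w F = eval t g ^ D * eval z f := by
      intro f
      induction f using MvPolynomial.induction_on with
      | C x =>
        refine ⟨0, Polynomial.C (C x), ?_, ?_⟩
        · rw [Polynomial.aeval_C, pow_zero, one_smul, halg]
          exact (φ.commutes x).trans (π.commutes x).symm
        · rw [tC]; simp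
      | add f₁ f₂ i₁ i₂ =>
        obtain ⟨D₁, F₁, a₁, b₁⟩ := i₁
        obtain ⟨D₂, F₂, a₂, b₂⟩ := i₂
        refine ⟨D₁ + D₂, Polynomial.C (g ^ D₂) * F₁ + Polynomial.C (g ^ D₁) * F₂, ?_, ?_⟩
        · rw [map_add, map_mul, map_mul, a₁, a₂, Polynomial.aeval_C, Polynomial.aeval_C,
            ← Algebra.smul_def, ← Algebra.smul_def, smul_smul, smul_smul, map_add, smul_add,
            pow_add, mul_comm (g ^ D₂)]
        · rw [map_add, map_mul, map_mul, b₁, b₂, tC, tC, map_pow, map_pow, map_add]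
          ring
      | mul_X f j i₁ =>
        obtain ⟨D, F, a₁, b₁⟩ := i₁
        refine ⟨D + 1, F * c j, ?_, ?_⟩
        · rw [map_mul, a₁, hc, map_mul, pow_succ, smul_mul_smul_comm]
        · rw [map_mul, b₁, map_mul, eval_X, hz j, pow_succ]
          field_simp
    intro f u hfu
    obtain ⟨D, F, a₁, b₁⟩ := h1 f
    have h2 : Polynomial.aeval α (F - Polynomial.C (g ^ D) * u) = 0 := by
      rw [map_sub, map_mul, a₁, hfu, Polynomial.aeval_C, ← Algebra.smul_def, sub_self]
    obtain ⟨F', hF'⟩ := minpoly.isIntegrallyClosed_dvd hαi h2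
    have h3 := congrArg (tht t w) hF'
    rw [map_mul, ← hQ, hw, zero_mul, map_sub, map_mul, b₁, tC, map_pow] at h3
    have h4 := pow_ne_zero D ht
    have h5 : eval t g ^ D * (eval z f - tht t w u) = 0 := by linear_combination h3
    rcases mul_eq_zero.1 h5 with h6 | h6
    · exact absurd h6 h4
    · exact sub_eq_zero.1 h6
  refine ⟨τ, s, Q, g, c, hQm, minpoly.natDegree_pos hαi, hg0, ?_, ?_, ?_⟩
  · intro t ht
    have hrt : eval t r ≠ 0 := by
      intro h0; apply ht; rw [hg]; simp [h0]
    have h1 := congrArg (Polynomial.map (eval t)) hab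
    rw [Polynomial.map_add, Polynomial.map_mul, Polynomial.map_mul, ← Polynomial.derivative_map,
      Polynomial.map_C] at h1
    refine ⟨Polynomial.C (eval t r)⁻¹ * a.map (eval t), Polynomial.C (eval t r)⁻¹ * b.map (eval t),
      ?_⟩
    rw [mul_assoc, mul_assoc, ← mul_add, h1, ← Polynomial.C_mul, inv_mul_cancel₀ hrt,
      Polynomial.C_1]
  · intro z hz
    have hex : ∀ f f', π f = π f' → eval z f = eval z f' := by
      intro f f' hff
      have := hz (f - f') (by rw [map_sub, hff, sub_self])
      rwa [map_sub, sub_eq_zero] at this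
    choose ρ hρ using hπ
    have hχ : ∀ f, eval z (ρ (π f)) = eval z f := fun f => hex _ _ (hρ _)
    let χ : S →+* ℂ :=
      { toFun := fun x => eval z (ρ x)
        map_one' := by
          have := hχ 1
          rwa [map_one, map_one] at this
        map_zero' := by
          have := hχ 0
          rwa [map_zero, map_zero] at this
        map_mul' := fun x y => by
          rw [← map_mul]; exact hex _ _ (by rw [hρ, map_mul, hρ, hρ])
        map_add' := fun x y => by
          rw [← map_add]; exact hex _ _ (by rw [hρ, map_add, hρ, hρ]) }
    have hχπ : ∀ f, χ (π f) = eval z f := hχ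
    set t : Fin k → ℂ := fun j => eval z (τ j) with ht
    have hχφ : χ.comp (algebraMap _ S) = eval t := by
      apply MvPolynomial.ringHom_ext
      · intro x
        rw [RingHom.comp_apply, halg, ← MvPolynomial.algebraMap_eq, AlgHom.commutes,
          ← π.commutes x, hχπ]
        simp
      · intro j
        rw [RingHom.comp_apply, halg, ← hτ, hχπ, eval_X]
    have hχr : ∀ p, χ (algebraMap _ S p) = eval t p := fun p => by
      rw [← hχφ]; rfl
    have hχα : ∀ p, χ (Polynomial.aeval α p) = tht t (eval z s) p := by
      intro p
      rw [Polynomial.aeval_def, Polynomial.hom_eval₂, hχφ, ← hs, hχπ]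
      rfl
    intro hgt
    refine ⟨?_, ?_, fun j => ?_⟩
    · intro h0
      have h1 := congrArg χ hu
      rw [hχr, map_mul, hχπ, h0, zero_mul] at h1
      apply hgt
      rw [hg]; simp [h1]
    · rw [← hχα, hQ, minpoly.aeval, map_zero]
    · rw [← hχα, hc, Algebra.smul_def, map_mul, hχr, hχπ, eval_X]
      field_simp
  · intro t w ht hw z hz
    refine ⟨fun f hf => ?_, fun j => ?_, ?_⟩
    · rw [key t w ht hw z hz f 0 (by rw [hf, map_zero]), map_zero]
    · rw [key t w ht hw z hz (τ j) (Polynomial.C (X j)) (by rw [hτ, Polynomial.aeval_C, halg])]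
      simp [tht]
    · rw [key t w ht hw z hz s Polynomial.X (by rw [hs, Polynomial.aeval_X])]
      simp [tht]

lemma alg_struct {N : ℕ} (P : Ideal (MvPolynomial (Fin N) ℂ)) [hP : P.IsPrime]
    (h : MvPolynomial (Fin N) ℂ) (hh : h ∉ P) :
    ∃ (τ : Fin (dm P) → MvPolynomial (Fin N) ℂ) (s : MvPolynomial (Fin N) ℂ)
      (Q : Polynomial (MvPolynomial (Fin (dm P)) ℂ)) (g : MvPolynomial (Fin (dm P)) ℂ)
      (c : Fin N → Polynomial (MvPolynomial (Fin (dm P)) ℂ)),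
      Q.Monic ∧ 0 < Q.natDegree ∧ g ≠ 0 ∧
      (∀ t, eval t g ≠ 0 → (Q.map (eval t)).Separable) ∧
      (∀ z : Fin N → ℂ, (∀ f ∈ P, eval z f = 0) → eval (fun j => eval z (τ j)) g ≠ 0 →
        eval z h ≠ 0 ∧ tht (fun j => eval z (τ j)) (eval z s) Q = 0 ∧
        ∀ j, z j = tht (fun j => eval z (τ j)) (eval z s) (c j) /
          eval (fun j => eval z (τ j)) g) ∧
      (∀ t w, eval t g ≠ 0 → tht t w Q = 0 → ∀ z : Fin N → ℂ,
        (∀ j, z j = tht t w (c j) / eval t g) →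
        (∀ f ∈ P, eval z f = 0) ∧ (∀ j, eval z (τ j) = t j) ∧ eval z s = w) := by
  obtain ⟨k, φ, hinj, hitg⟩ := exists_integral_inj_algHom_of_fg ℂ (MvPolynomial (Fin N) ℂ ⧸ P)
  have hk : dm P = k := noether_dim φ hinj hitg
  rw [hk]
  have := alg_struct_aux (Ideal.Quotient.mkₐ ℂ P) (Ideal.Quotient.mkₐ_surjective ℂ P) φ hinj hitg h
    (by rwa [Ne, Ideal.Quotient.mkₐ_eq_mk, Ideal.Quotient.eq_zero_iff_mem])
  simp only [Ideal.Quotient.mkₐ_eq_mk, Ideal.Quotient.eq_zero_iff_mem] at this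
  exact this

end HV

namespace HV

lemma root_near {p : Polynomial ℂ} (hp : p.Monic) {w : ℂ} {δ : ℝ} (hδ : 0 < δ)
    (h : ‖p.eval w‖ < δ ^ p.natDegree) : ∃ ρ, p.IsRoot ρ ∧ dist ρ w < δ := by
  by_contra hc
  push Not at hc
  have hs := IsAlgClosed.splits p
  have h1 : p.eval w = (p.roots.map fun a => w - a).prod := by
    conv_lhs => rw [hs.eq_prod_roots_of_monic hp]
    rw [Polynomial.eval_multiset_prod, Multiset.map_map]
    simp
  have h2 : ∀ s : Multiset ℂ, (∀ a ∈ s, δ ≤ ‖w - a‖) →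
      δ ^ Multiset.card s ≤ ‖(s.map fun a => w - a).prod‖ := by
    intro s
    induction s using Multiset.induction_on with
    | empty => simp
    | cons a s ih =>
      intro hs
      rw [Multiset.card_cons, Multiset.map_cons, Multiset.prod_cons, norm_mul, pow_succ, mul_comm]
      exact mul_le_mul (hs a (by simp)) (ih fun b hb => hs b (by simp [hb])) (by positivity)
        (norm_nonneg _)
  have h3 := h2 p.roots fun a ha => by
    have := hc a ((Polynomial.mem_roots hp.ne_zero).1 ha)
    rwa [dist_comm, dist_eq_norm] at this
  rw [← h1, ← hs.natDegree_eq_card_roots] at h3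
  linarith

lemma tht_eq {k : ℕ} (t : Fin k → ℂ) (w : ℂ) (Q : Polynomial (MvPolynomial (Fin k) ℂ)) :
    tht t w Q = (Q.map (eval t)).eval w := by
  rw [Polynomial.eval_map]; rfl

lemma tht_cont {k : ℕ} (Q : Polynomial (MvPolynomial (Fin k) ℂ)) :
    Continuous fun x : (Fin k → ℂ) × ℂ => tht x.1 x.2 Q := by
  have : (fun x : (Fin k → ℂ) × ℂ => tht x.1 x.2 Q) =
      fun x => ∑ i ∈ Finset.range (Q.natDegree + 1), eval x.1 (Q.coeff i) * x.2 ^ i := by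
    funext x
    exact Polynomial.eval₂_eq_sum_range _ _
  rw [this]
  exact continuous_finset_sum _ fun i _ =>
    ((MvPolynomial.continuous_eval _).comp continuous_fst).mul (continuous_snd.pow i)

lemma local_roots {k : ℕ} {Q : Polynomial (MvPolynomial (Fin k) ℂ)} (hQ : Q.Monic)
    {G : Set (Fin k → ℂ)} (hG : IsOpen G) (hsep : ∀ t ∈ G, (Q.map (eval t)).Separable)
    {t₀ : Fin k → ℂ} (ht₀ : t₀ ∈ G) :
    ∃ U, IsOpen U ∧ t₀ ∈ U ∧ U ⊆ G ∧ ∃ w : Fin Q.natDegree → (Fin k → ℂ) → ℂ,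
      (∀ i, ContinuousOn (w i) U) ∧ (∀ i, ∀ t ∈ U, tht t (w i t) Q = 0) ∧
      (∀ t ∈ U, ∀ ρ, tht t ρ Q = 0 → ∃ i, w i t = ρ) ∧
      (∀ i j, ∀ t ∈ U, w i t = w j t → i = j) := by
  classical
  set d := Q.natDegree with hd
  have hmon : ∀ t, (Q.map (eval t)).Monic := fun t => hQ.map _
  have hdeg : ∀ t, (Q.map (eval t)).natDegree = d := fun t => hQ.natDegree_map _
  have hcard : ∀ t ∈ G, (Q.map (eval t)).roots.toFinset.card = d := by
    intro t ht
    rw [Multiset.toFinset_card_of_nodup (Polynomial.nodup_roots (hsep t ht)),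
      ← (IsAlgClosed.splits _).natDegree_eq_card_roots, hdeg]
  have hmem : ∀ t ρ, ρ ∈ (Q.map (eval t)).roots.toFinset ↔ tht t ρ Q = 0 := by
    intro t ρ
    rw [Multiset.mem_toFinset, Polynomial.mem_roots (hmon t).ne_zero, tht_eq]; rfl
  have hnear : ∀ t w δ, 0 < δ → ‖tht t w Q‖ < δ ^ d → ∃ ρ, tht t ρ Q = 0 ∧ dist ρ w < δ := by
    intro t w δ hδ h
    rw [tht_eq] at h
    obtain ⟨ρ, h1, h2⟩ := root_near (hmon t) hδ (by rwa [hdeg])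
    exact ⟨ρ, by rw [tht_eq]; exact h1, h2⟩
  let e := (Finset.equivFinOfCardEq (hcard t₀ ht₀)).symm
  let r : Fin d → ℂ := fun i => (e i).1
  have hrinj : Function.Injective r := Subtype.val_injective.comp e.injective
  have hr : ∀ i, tht t₀ (r i) Q = 0 := fun i => (hmem _ _).1 (e i).2
  obtain ⟨ε, hε, hdis⟩ : ∃ ε > 0, ∀ i j, i ≠ j → 2 * ε ≤ dist (r i) (r j) := by
    have : ∀ q : Fin d × Fin d, ∃ ε > 0, q.1 ≠ q.2 → 2 * ε ≤ dist (r q.1) (r q.2) := by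
      intro q
      by_cases hq : q.1 = q.2
      · exact ⟨1, one_pos, fun h => absurd hq h⟩
      · exact ⟨dist (r q.1) (r q.2) / 2, half_pos (dist_pos.2 fun h => hq (hrinj h)),
          fun _ => by linarith⟩
    choose ε hε h using this
    rcases isEmpty_or_nonempty (Fin d × Fin d) with hem | hne
    · exact ⟨1, one_pos, fun i => (hem.false (i, i)).elim⟩
    · obtain ⟨q, hq⟩ := Finite.exists_min ε
      exact ⟨ε q, hε q, fun i j hij => le_trans (by linarith [hq (i, j)]) (h (i, j) hij)⟩
  have hball : ∀ i j ρ, dist ρ (r i) < ε → dist ρ (r j) < ε → i = j := by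
    intro i j ρ h1 h2
    by_contra hij
    have := hdis i j hij
    have h3 := dist_triangle_left (r i) (r j) ρ
    linarith
  have hct : ∀ w, Continuous fun t => ‖tht t w Q‖ := fun w =>
    ((tht_cont Q).comp (continuous_id.prodMk continuous_const)).norm
  refine ⟨G ∩ ⋂ i, {t | ‖tht t (r i) Q‖ < ε ^ d}, ?_, ?_, Set.inter_subset_left, ?_⟩
  · exact hG.inter (isOpen_iInter_of_finite fun i => isOpen_lt (hct _) continuous_const)
  · refine ⟨ht₀, Set.mem_iInter.2 fun i => ?_⟩
    show ‖tht t₀ (r i) Q‖ < _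
    rw [hr, norm_zero]; positivity
  set U := G ∩ ⋂ i, {t | ‖tht t (r i) Q‖ < ε ^ d} with hU
  have hUo : IsOpen U :=
    hG.inter (isOpen_iInter_of_finite fun i => isOpen_lt (hct _) continuous_const)
  have hex : ∀ i t, ∃ ρ, t ∈ U → tht t ρ Q = 0 ∧ dist ρ (r i) < ε := by
    intro i t
    by_cases ht : t ∈ U
    · obtain ⟨ρ, h⟩ := hnear t (r i) ε hε (Set.mem_iInter.1 ht.2 i)
      exact ⟨ρ, fun _ => h⟩
    · exact ⟨0, fun h => absurd h ht⟩
  choose w hw using hex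
  have hinj : ∀ i j, ∀ t ∈ U, w i t = w j t → i = j := by
    intro i j t ht h
    exact hball i j (w i t) (hw i t ht).2 (h ▸ (hw j t ht).2)
  have hsurj : ∀ t ∈ U, ∀ ρ, tht t ρ Q = 0 → ∃ i, w i t = ρ := by
    intro t ht ρ hρ
    have h1 : (Finset.univ.image fun i => w i t) = (Q.map (eval t)).roots.toFinset := by
      apply Finset.eq_of_subset_of_card_le
      · intro x hx
        obtain ⟨i, -, rfl⟩ := Finset.mem_image.1 hx
        exact (hmem _ _).2 (hw i t ht).1
      · rw [hcard t ht.1, Finset.card_image_of_injective _ (fun i j h => hinj i j t ht h)]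
        simp
    have h2 := (hmem t ρ).2 hρ
    rw [← h1] at h2
    obtain ⟨i, -, h⟩ := Finset.mem_image.1 h2
    exact ⟨i, h⟩
  have huniq : ∀ t ∈ U, ∀ i ρ, tht t ρ Q = 0 → dist ρ (r i) < ε → w i t = ρ := by
    intro t ht i ρ h1 h2
    obtain ⟨j, rfl⟩ := hsurj t ht ρ h1
    rw [hball i j _ h2 (hw j t ht).2]
  refine ⟨w, fun i t₁ ht₁ => ?_, fun i t ht => (hw i t ht).1, hsurj, hinj⟩
  rw [Metric.continuousWithinAt_iff']
  intro η hη
  set δ := min η (ε - dist (w i t₁) (r i)) with hδ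
  have hδ0 : 0 < δ := lt_min hη (sub_pos.2 (hw i t₁ ht₁).2)
  have h1 : ∀ᶠ t in nhds t₁, ‖tht t (w i t₁) Q‖ < δ ^ d := by
    apply (hct (w i t₁)).continuousAt.eventually_lt continuousAt_const
    show ‖tht t₁ (w i t₁) Q‖ < _
    rw [(hw i t₁ ht₁).1, norm_zero]; positivity
  filter_upwards [nhdsWithin_le_nhds h1, self_mem_nhdsWithin] with t h2 h3
  obtain ⟨ρ, h4, h5⟩ := hnear t _ δ hδ0 h2
  have h6 : w i t = ρ := huniq t h3 i ρ h4 (by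
    have := dist_triangle ρ (w i t₁) (r i)
    have := min_le_right η (ε - dist (w i t₁) (r i))
    linarith)
  rw [h6]
  exact h5.trans_le (min_le_left _ _)

variable {N : ℕ}

lemma homogenize (i : Fin N) (q : MvPolynomial (Fin N) ℂ) : ∃ (D : ℕ) (F : MvPolynomial (Fin N) ℂ),
    (∀ (l : ℂ) z, eval (l • z) F = l ^ D * eval z F) ∧
    ∀ z, z i = 1 → eval z F = eval z q := by
  induction q using MvPolynomial.induction_on with
  | C a => exact ⟨0, C a, by simp, by simp⟩
  | add p q hp hq =>
    obtain ⟨D, F, h1, h2⟩ := hp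
    obtain ⟨D', F', h1', h2'⟩ := hq
    refine ⟨D + D', F * X i ^ D' + F' * X i ^ D, fun l z => ?_, fun z hz => ?_⟩
    · simp only [map_add, map_mul, map_pow, eval_X, h1, h1', Pi.smul_apply, smul_eq_mul]
      ring
    · simp [h2 z hz, h2' z hz, hz]
  | mul_X p j hp =>
    obtain ⟨D, F, h1, h2⟩ := hp
    refine ⟨D + 1, F * X j, fun l z => ?_, fun z hz => ?_⟩
    · simp only [map_mul, eval_X, h1, Pi.smul_apply, smul_eq_mul]
      ring
    · simp [h2 z hz]

/-- The cone cut out by the vanishing of `x_i` or of `q` in the chart `x_i = 1`. -/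
lemma exists_hyp (i : Fin N) (q : MvPolynomial (Fin N) ℂ) : ∃ H : Set (Fin N → ℂ), AC H ∧
    (∀ z, z i = 0 → z ∈ H) ∧ ∀ z, z i = 1 → (z ∈ H ↔ eval z q = 0) := by
  obtain ⟨D, F, h1, h2⟩ := homogenize i q
  refine ⟨{z | eval z (X i * F) = 0}, ⟨?_, ?_, {X i * F}, ?_⟩, ?_, ?_⟩
  · simp
  · intro z hz l
    simp only [Set.mem_setOf_eq, map_mul, eval_X, h1, Pi.smul_apply, smul_eq_mul] at hz ⊢
    linear_combination l * l ^ D * hz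
  · ext z; simp
  · intro z hz; simp [hz]
  · intro z hz
    simp [hz, h2 z hz]

/-- Irreducible cones. -/
structure Irr (K : Set (Fin N → ℂ)) : Prop where
  ac : AC K
  irr : ∀ A B, AC A → AC B → K ⊆ A ∪ B → K ⊆ A ∨ K ⊆ B

/-- The ideal of the affine chart `x_i = 1`. -/
def AI (K : Set (Fin N → ℂ)) (i : Fin N) : Ideal (MvPolynomial (Fin N) ℂ) where
  carrier := {f | ∀ z ∈ K, z i = 1 → eval z f = 0}
  zero_mem' := fun z _ _ => map_zero _
  add_mem' := fun {a b} ha hb z hz hi => by rw [map_add, ha z hz hi, hb z hz hi, add_zero]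
  smul_mem' := fun c {a} ha z hz hi => by rw [smul_eq_mul, map_mul, ha z hz hi, mul_zero]

lemma mem_AI {K : Set (Fin N → ℂ)} {i : Fin N} {f : MvPolynomial (Fin N) ℂ} :
    f ∈ AI K i ↔ ∀ z ∈ K, z i = 1 → eval z f = 0 := Iff.rfl

/-- Rescaling into the chart. -/
lemma chart {K : Set (Fin N → ℂ)} (hK : AC K) {i : Fin N} {z : Fin N → ℂ} (hz : z ∈ K)
    (hi : z i ≠ 0) : ((z i)⁻¹ • z) ∈ K ∧ ((z i)⁻¹ • z) i = 1 :=
  ⟨hK.smul z hz _, by simp [hi]⟩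

lemma unchart {K : Set (Fin N → ℂ)} (hK : AC K) {i : Fin N} {z : Fin N → ℂ}
    (hi : z i ≠ 0) (h : (z i)⁻¹ • z ∈ K) : z ∈ K := by
  have := hK.smul _ h (z i)
  rwa [smul_smul, mul_inv_cancel₀ hi, one_smul] at this

lemma AI_prime {K : Set (Fin N → ℂ)} (hK : Irr K) {i : Fin N} (hi : ∃ z ∈ K, z i ≠ 0) :
    (AI K i).IsPrime := by
  obtain ⟨z₀, hz₀, hi₀⟩ := hi
  refine ⟨fun h => ?_, fun {a b} hab => ?_⟩
  · have h1 : (1 : MvPolynomial (Fin N) ℂ) ∈ AI K i := by rw [h]; trivial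
    obtain ⟨h2, h3⟩ := chart hK.ac hz₀ hi₀
    simpa using h1 _ h2 h3
  · obtain ⟨A, hA, hA0, hA1⟩ := exists_hyp i a
    obtain ⟨B, hB, hB0, hB1⟩ := exists_hyp i b
    have hsub : K ⊆ A ∪ B := by
      intro z hz
      by_cases h0 : z i = 0
      · exact Or.inl (hA0 z h0)
      · obtain ⟨h2, h3⟩ := chart hK.ac hz h0
        have h4 := hab _ h2 h3
        rw [map_mul, mul_eq_zero] at h4
        rcases h4 with h4 | h4
        · exact Or.inl (unchart hA h0 ((hA1 _ h3).2 h4))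
        · exact Or.inr (unchart hB h0 ((hB1 _ h3).2 h4))
    rcases hK.irr A B hA hB hsub with h | h
    · exact Or.inl fun z hz h1 => (hA1 z h1).1 (h hz)
    · exact Or.inr fun z hz h1 => (hB1 z h1).1 (h hz)

lemma zero_AI {K : Set (Fin N → ℂ)} (hK : AC K) (i : Fin N) (z : Fin N → ℂ) :
    (∀ f ∈ AI K i, eval z f = 0) ↔ z ∈ K ∧ z i = 1 := by
  constructor
  · intro h
    obtain ⟨T, hT⟩ := hK.alg
    constructor
    · rw [hT]
      intro q hq
      apply h
      intro w hw _
      rw [hT] at hw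
      exact hw q hq
    · have := h (X i - 1) (fun w _ hw => by simp [hw])
      simpa [sub_eq_zero] using this
  · rintro ⟨h1, h2⟩ f hf
    exact hf z h1 h2

lemma dm_AI_lt {K K' : Set (Fin N → ℂ)} (hK : Irr K) (hK' : Irr K') (hs : K' ⊆ K) (hn : ¬ K ⊆ K')
    {i : Fin N} (hi : ∃ z ∈ K', z i ≠ 0) : dm (AI K' i) < dm (AI K i) := by
  have hi' : ∃ z ∈ K, z i ≠ 0 := by
    obtain ⟨z, h1, h2⟩ := hi
    exact ⟨z, hs h1, h2⟩
  haveI := AI_prime hK hi'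
  haveI := AI_prime hK' hi
  apply dm_lt
  refine ⟨fun f hf z hz h1 => hf z (hs hz) h1, fun hle => ?_⟩
  obtain ⟨A, hA, hA0, hA1⟩ := exists_hyp i (1 : MvPolynomial (Fin N) ℂ)
  have hsub : K ⊆ K' ∪ A := by
    intro z hz
    by_cases h0 : z i = 0
    · exact Or.inr (hA0 z h0)
    · obtain ⟨h2, h3⟩ := chart hK.ac hz h0
      have := (zero_AI hK'.ac i ((z i)⁻¹ • z)).1 fun f hf => hle hf _ h2 h3
      exact Or.inl (unchart hK'.ac h0 this.1)
  rcases hK.irr _ _ hK'.ac hA hsub with h | h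
  · exact hn h
  · obtain ⟨z, h1, h2⟩ := hi'
    obtain ⟨h3, h4⟩ := chart hK.ac h1 h2
    simpa using (hA1 _ h4).1 (h h3)

lemma dm_AI_le {K K' : Set (Fin N → ℂ)} (hK : Irr K) (hK' : Irr K') (hs : K' ⊆ K)
    {i : Fin N} (hi : ∃ z ∈ K', z i ≠ 0) : dm (AI K' i) ≤ dm (AI K i) := by
  by_cases hn : K ⊆ K'
  · rw [hn.antisymm hs]
  · exact (dm_AI_lt hK hK' hs hn hi).le

lemma ac_induction {motive : Set (Fin N → ℂ) → Prop}
    (h : ∀ K, AC K → (∀ K', AC K' → K' ⊂ K → motive K') → motive K) : ∀ K, AC K → motive K := by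
  let I : Set (Fin N → ℂ) → Ideal (MvPolynomial (Fin N) ℂ) := fun K =>
    { carrier := {f | ∀ z ∈ K, eval z f = 0}
      zero_mem' := fun z _ => map_zero _
      add_mem' := fun {a b} ha hb z hz => by rw [map_add, ha z hz, hb z hz, add_zero]
      smul_mem' := fun c {a} ha z hz => by rw [smul_eq_mul, map_mul, ha z hz, mul_zero] }
  have hwf : WellFounded ((· > ·) : Ideal (MvPolynomial (Fin N) ℂ) → _ → Prop) := wellFounded_gt
  have : ∀ J, ∀ K, AC K → I K = J → motive K := by
    intro J
    induction J using hwf.induction with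
    | _ J ih =>
      rintro K hK rfl
      refine h K hK fun K' hK' hs => ih (I K') ?_ K' hK' rfl
      refine ⟨fun f hf z hz => hf z (hs.1 hz), fun hle => hs.2 fun z hz => ?_⟩
      obtain ⟨T, hT⟩ := hK'.alg
      rw [hT]
      intro q hq
      refine hle (show q ∈ I K' from fun w hw => ?_) z hz
      rw [hT] at hw
      exact hw q hq
  exact fun K hK => this _ K hK rfl

end HV

namespace HV
variable {N : ℕ}

noncomputable def cz (i : Fin N) (x : EI N → ℝ) : Fin N → ℂ := fun l => ent x l i / ent x i i

lemma ne_zero_of_one {i : Fin N} {z : Fin N → ℂ} (h : z i = 1) : z ≠ 0 := by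
  rintro rfl; simp at h

lemma cz_Psi {i : Fin N} {z : Fin N → ℂ} (h : z i = 1) : cz i (Psi z) = z := by
  funext l
  have := prj_ratio (ne_zero_of_one h) (i := i) (by rw [h]; exact one_ne_zero) l
  rw [h, div_one] at this
  simp only [cz, ent_Psi]; exact this

lemma ent_ne {i : Fin N} {z : Fin N → ℂ} (h : z i = 1) : ent (Psi z) i i ≠ 0 := by
  intro h0
  have := congrFun (cz_Psi h) i
  rw [cz, h0, h] at this; simp at this

lemma exists_chart_pt {Z W : Set (Fin N → ℂ)} {i : Fin N} (hZ : Irr Z) (hi : ∃ z ∈ Z, z i ≠ 0)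
    (hW : AC W) (hn : ¬ Z ⊆ W) : ∃ u ∈ Z, u i = 1 ∧ u ∉ W := by
  by_contra hcon
  push Not at hcon
  obtain ⟨H, hH, h0, h1⟩ := exists_hyp i (1 : MvPolynomial (Fin N) ℂ)
  rcases hZ.irr W H hW hH (fun z hz => by
    by_cases hzi : z i = 0
    · exact Or.inr (h0 z hzi)
    · obtain ⟨ha, hb⟩ := chart hZ.ac hz hzi
      exact Or.inl (unchart hW hzi (hcon _ ha hb))) with h | h
  · exact hn h
  · obtain ⟨z, hz, hzi⟩ := hi
    obtain ⟨ha, hb⟩ := chart hZ.ac hz hzi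
    have := (h1 _ hb).1 (h ha)
    simp at this

lemma struct_pair {Z W : Set (Fin N → ℂ)} {i : Fin N} (hZ : Irr Z) (hi : ∃ z ∈ Z, z i ≠ 0)
    (hW : AC W) (hn : ¬ Z ⊆ W) : ∃ A, AC A ∧ A ⊆ Z ∧ Z ∩ W ⊆ A ∧ ¬ Z ⊆ A ∧
      ∃ (G : Set (Fin (2 * dm (AI Z i)) → ℝ)) (p : (EI N → ℝ) → Fin (2 * dm (AI Z i)) → ℝ) (d : ℕ),
        0 < d ∧ G.Nonempty ∧ FinCover (PV Z \ PV A) G p d := by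
  classical
  obtain ⟨u, huZ, hu1, huW⟩ := exists_chart_pt hZ hi hW hn
  obtain ⟨T, hT⟩ := hW.alg
  have : ∃ h ∈ T, eval u h ≠ 0 := by
    by_contra hcon
    push Not at hcon
    exact huW (by rw [hT]; exact hcon)
  obtain ⟨h, hhT, hhu⟩ := this
  haveI := AI_prime hZ hi
  have hhP : h ∉ AI Z i := fun hm => hhu (hm u huZ hu1)
  obtain ⟨τ, s, Q, g, c, hQ, hdeg, hg, hsep, hA, hB⟩ := alg_struct (AI Z i) h hhP
  obtain ⟨H, hH, hH0, hH1⟩ := exists_hyp i (bind₁ τ g)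
  have hev : ∀ z : Fin N → ℂ, eval z (bind₁ τ g) = eval (fun j => eval z (τ j)) g := by
    intro z
    rw [← aeval_eq_eval, aeval_bind₁, ← aeval_eq_eval]
  have hH2 : ∀ z, z i = 1 → (z ∈ H ↔ eval (fun j => eval z (τ j)) g = 0) := by
    intro z hz; rw [hH1 z hz, hev]
  generalize dm (AI Z i) = k at *
  have hM : ∀ x, x ∈ PV Z \ PV (Z ∩ H) ↔ ∃ z ∈ Z, z i = 1 ∧ Psi z = x ∧
      eval (fun j => eval z (τ j)) g ≠ 0 := by
    intro x
    constructor
    · rintro ⟨⟨z, hz, hzZ, rfl⟩, hx⟩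
      rw [Psi_mem_PV (hZ.ac.inter hH) hz] at hx
      have hzi : z i ≠ 0 := fun h0 => hx ⟨hzZ, hH0 z h0⟩
      obtain ⟨ha, hb⟩ := chart hZ.ac hzZ hzi
      refine ⟨_, ha, hb, Psi_smul z (inv_ne_zero hzi), fun h0 => hx ⟨hzZ, ?_⟩⟩
      exact unchart hH hzi ((hH2 _ hb).2 h0)
    · rintro ⟨z, hz, hz1, rfl, h0⟩
      refine ⟨⟨z, ne_zero_of_one hz1, hz, rfl⟩, ?_⟩
      rw [Psi_mem_PV (hZ.ac.inter hH) (ne_zero_of_one hz1)]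
      exact fun hz' => h0 ((hH2 z hz1).1 hz'.2)
  have hB' : ∀ t w, eval t g ≠ 0 → tht t w Q = 0 → ∃ z ∈ Z, z i = 1 ∧
      z = (fun j => tht t w (c j) / eval t g) ∧ (∀ j, eval z (τ j) = t j) ∧ eval z s = w := by
    intro t w h1 h2
    obtain ⟨h3, h4, h5⟩ := hB t w h1 h2 _ (fun j => rfl)
    obtain ⟨h6, h7⟩ := (zero_AI hZ.ac i _).1 h3
    exact ⟨_, h6, h7, rfl, h4, h5⟩
  have hgt : ∃ t, eval t g ≠ 0 := by
    by_contra hcon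
    push Not at hcon
    exact hg (MvPolynomial.funext (by simpa using hcon))
  obtain ⟨t₀, ht₀⟩ := hgt
  have hGo : IsOpen {t : Fin k → ℂ | eval t g ≠ 0} :=
    isOpen_ne_fun (MvPolynomial.continuous_eval g) continuous_const
  have hpt : ∃ z ∈ Z, z i = 1 ∧ eval (fun j => eval z (τ j)) g ≠ 0 := by
    have hd : (Q.map (eval t₀)).degree ≠ 0 := by
      rw [hQ.degree_map]
      exact (Polynomial.natDegree_pos_iff_degree_pos.1 hdeg).ne'
    obtain ⟨w, hw⟩ := IsAlgClosed.exists_root _ hd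
    obtain ⟨z, hz, hz1, -, hz2, -⟩ := hB' t₀ w ht₀ (by rw [tht_eq]; exact hw)
    refine ⟨z, hz, hz1, ?_⟩
    rwa [show (fun j => eval z (τ j)) = t₀ from funext hz2]
  let e : (Fin (2 * k) → ℝ) ≃L[ℝ] (Fin k → ℂ) := ContinuousLinearEquiv.ofFinrankEq (by
    rw [Module.finrank_pi, Module.finrank_pi_fintype]; simp [Complex.finrank_real_complex, mul_comm])
  refine ⟨Z ∩ H, hZ.ac.inter hH, Set.inter_subset_left, ?_, ?_, e ⁻¹' {t | eval t g ≠ 0},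
    fun x => e.symm (fun j => eval (cz i x) (τ j)), Q.natDegree, hdeg, ⟨e.symm t₀, by simpa using ht₀⟩,
    ?_, ?_, hGo.preimage e.continuous, ?_⟩
  · rintro z ⟨hz, hzW⟩
    refine ⟨hz, ?_⟩
    by_cases hzi : z i = 0
    · exact hH0 z hzi
    obtain ⟨ha, hb⟩ := chart hZ.ac hz hzi
    refine unchart hH hzi ((hH2 _ hb).2 ?_)
    by_contra h0
    refine (hA _ ((zero_AI hZ.ac i _).2 ⟨ha, hb⟩) h0).1 ?_
    have := (chart hW hzW hzi).1
    rw [hT] at this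
    exact this h hhT
  · intro hs
    obtain ⟨z, hz, hz1, hz2⟩ := hpt
    exact hz2 ((hH2 z hz1).1 (hs hz).2)
  · have hc : ContinuousOn (cz i) (PV Z \ PV (Z ∩ H)) := by
      refine continuousOn_pi.2 fun l => ?_
      refine ContinuousOn.div (continuous_ent l i).continuousOn (continuous_ent i i).continuousOn ?_
      intro x hx
      obtain ⟨z, hz, hz1, rfl, -⟩ := (hM x).1 hx
      exact ent_ne hz1
    refine e.symm.continuous.comp_continuousOn (continuousOn_pi.2 fun j => ?_)
    exact (MvPolynomial.continuous_eval (τ j)).comp_continuousOn hc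
  · intro x hx
    obtain ⟨z, hz, hz1, rfl, h0⟩ := (hM x).1 hx
    simp only [Set.mem_preimage, ContinuousLinearEquiv.apply_symm_apply, cz_Psi hz1]
    exact h0
  · intro y hy
    obtain ⟨U, hU, hyU, hUG, w, hw1, hw2, hw3, hw4⟩ := local_roots hQ hGo hsep hy
    have hpp : ∀ l, ∀ y ∈ e ⁻¹' U, ∃ z ∈ Z, z i = 1 ∧
        z = (fun j => tht (e y) (w l (e y)) (c j) / eval (e y) g) ∧
        (∀ j, eval z (τ j) = e y j) ∧ eval z s = w l (e y) := fun l y hy =>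
      hB' _ _ (hUG hy) (hw2 l _ hy)
    refine ⟨e ⁻¹' U, hU.preimage e.continuous, hyU, fun y hy => hUG hy,
      fun l y => Psi (fun j => tht (e y) (w l (e y)) (c j) / eval (e y) g), ?_, ?_, ?_, ?_⟩
    · intro l
      refine continuousOn_Psi.comp ?_ ?_
      · refine continuousOn_pi.2 fun j => ?_
        refine ContinuousOn.div ?_ ?_ (fun y hy => hUG hy)
        · have := (tht_cont (c j)).comp_continuousOn (s := e ⁻¹' U)
            (f := fun y => (e y, w l (e y)))
            (e.continuous.continuousOn.prodMk ((hw1 l).comp e.continuous.continuousOn (fun y hy => hy)))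
          exact this
        · exact ((MvPolynomial.continuous_eval g).comp e.continuous).continuousOn
      · intro y hy
        obtain ⟨z, hz, hz1, rfl, -⟩ := hpp l y hy
        exact ne_zero_of_one hz1
    · intro l y hy
      obtain ⟨z, hz, hz1, hze, hz2, hz3⟩ := hpp l y hy
      simp only [← hze]
      have hz4 : (fun j => eval z (τ j)) = e y := funext hz2
      refine ⟨(hM _).2 ⟨z, hz, hz1, rfl, ?_⟩, ?_⟩
      · rw [hz4]; exact hUG hy
      · rw [cz_Psi hz1, hz4]; simp
    · intro x hx hpx
      obtain ⟨z, hz, hz1, rfl, h0⟩ := (hM x).1 hx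
      simp only [Set.mem_preimage, cz_Psi hz1, ContinuousLinearEquiv.apply_symm_apply] at hpx ⊢
      obtain ⟨-, h2, h3⟩ := hA z ((zero_AI hZ.ac i z).2 ⟨hz, hz1⟩) h0
      obtain ⟨l, hl⟩ := hw3 _ hpx _ h2
      refine ⟨l, ?_⟩
      rw [hl]
      congr 1
      exact (funext h3).symm
    · intro l l' y hy heq
      obtain ⟨z, hz, hz1, hze, hz2, hz3⟩ := hpp l y hy
      obtain ⟨z', hz', hz1', hze', hz2', hz3'⟩ := hpp l' y hy
      simp only [← hze, ← hze'] at heq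
      have : z = z' := by rw [← cz_Psi hz1, heq, cz_Psi hz1']
      refine hw4 l l' (e y) hy ?_
      rw [← hz3, ← hz3', this]

end HV

namespace HV
variable {N : ℕ}

lemma exists_coord {Z W : Set (Fin N → ℂ)} (hW : AC W) (h : ¬ Z ⊆ W) : ∃ i, ∃ z ∈ Z, z i ≠ 0 := by
  by_contra hcon
  push Not at hcon
  refine h fun z hz => ?_
  rw [show z = 0 from funext fun i => hcon i z hz]
  exact hW.zero

lemma red_split {K : Set (Fin N → ℂ)} (hK : AC K) (h : ¬ Irr K) : ∃ A B, AC A ∧ AC B ∧ A ⊂ K ∧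
    B ⊂ K ∧ K = A ∪ B := by
  by_contra hcon
  refine h ⟨hK, fun A B hA hB hs => ?_⟩
  by_contra hh
  push Not at hh
  refine hcon ⟨K ∩ A, K ∩ B, hK.inter hA, hK.inter hB, ⟨Set.inter_subset_left, fun hk => hh.1 fun z hz => (hk hz).2⟩,
    ⟨Set.inter_subset_left, fun hk => hh.2 fun z hz => (hk hz).2⟩, ?_⟩
  rw [← Set.inter_union_distrib_left]
  exact (Set.inter_eq_left.2 hs).symm

lemma vanish {m n : ℕ} (hmn : 2 * m < n + 2) : ∀ T : Set (Fin N → ℂ), AC T →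
    ∀ Y₁, AC Y₁ → (∀ Z, Irr Z → Z ⊆ T → ¬ Z ⊆ Y₁ → ∀ i, (∃ z ∈ Z, z i ≠ 0) → dm (AI Z i) < m) →
    VanRel (PV (Y₁ ∪ T)) (PV Y₁) n := by
  refine ac_induction fun T hT ih Y₁ hY hd => ?_
  by_cases hI : Irr T
  · by_cases hs : T ⊆ Y₁
    · rw [Set.union_eq_left.2 hs]; exact vanRel_self _ _
    obtain ⟨i, hi⟩ := exists_coord hY hs
    have hk := hd T hI subset_rfl hs i hi
    obtain ⟨A, hA, hAT, hWA, hTA, G, p, d, hd0, hG, hF⟩ := struct_pair hI hi hY hs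
    refine vanRel_trans' (S := PV (Y₁ ∪ A)) (PV_mono (Set.union_subset_union_right _ hAT))
      (PV_mono Set.subset_union_left) ?_ ?_
    · have hU := hY.union hT
      have hU' := hY.union hA
      refine vanRel_pair (PV_compact hU) (PV_compact hU') (PV_enr hU) (PV_enr hU')
        (PV_mono (Set.union_subset_union_right _ hAT)) (G := G) (p := p) (d := d) ?_
        (by omega : 2 * dm (AI T i) < n)
      suffices e : PV (Y₁ ∪ T) \ PV (Y₁ ∪ A) = PV T \ PV A by rw [e]; exact hF
      ext x
      rw [PV_union, PV_union]
      have h1 : x ∈ PV T → x ∈ PV Y₁ → x ∈ PV A := fun h h' =>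
        PV_mono hWA (by rw [PV_inter hT hY]; exact ⟨h, h'⟩)
      simp only [Set.mem_diff, Set.mem_union]
      tauto
    · exact ih A hA ⟨hAT, hTA⟩ Y₁ hY fun Z hZ hZA => hd Z hZ (hZA.trans hAT)
  · obtain ⟨A, B, hA, hB, hAT, hBT, rfl⟩ := red_split hT hI
    refine vanRel_trans' (S := PV (Y₁ ∪ A)) (PV_mono (Set.union_subset_union_right _ hAT.1))
      (PV_mono Set.subset_union_left) ?_ ?_
    · rw [← Set.union_assoc]
      exact ih B hB hBT _ (hY.union hA) fun Z hZ hZB hZn => hd Z hZ (hZB.trans hBT.1)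
        fun hs => hZn (hs.trans Set.subset_union_left)
    · exact ih A hA hAT Y₁ hY fun Z hZ hZA => hd Z hZ (hZA.trans hAT.1)

lemma decomp : ∀ K : Set (Fin N → ℂ), AC K → ∃ F : Set (Set (Fin N → ℂ)), F.Finite ∧
    (∀ Z ∈ F, Irr Z) ∧ K = ⋃₀ F := by
  refine ac_induction fun K hK ih => ?_
  by_cases hI : Irr K
  · exact ⟨{K}, Set.finite_singleton _, by simpa using hI, by simp⟩
  · obtain ⟨A, B, hA, hB, hAT, hBT, rfl⟩ := red_split hK hI
    obtain ⟨F, hF1, hF2, hF3⟩ := ih A hA hAT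
    obtain ⟨F', hF1', hF2', hF3'⟩ := ih B hB hBT
    refine ⟨F ∪ F', hF1.union hF1', ?_, ?_⟩
    · rintro Z (h | h)
      exacts [hF2 _ h, hF2' _ h]
    · rw [Set.sUnion_union, ← hF3, ← hF3']

lemma ac_sUnion {W : Set (Fin N → ℂ)} (hW : AC W) {F : Set (Set (Fin N → ℂ))} (hF : F.Finite)
    (h : ∀ Z ∈ F, Irr Z) : AC (W ∪ ⋃₀ F) ∧ ∀ Z, Irr Z → Z ⊆ W ∪ ⋃₀ F → Z ⊆ W ∨ ∃ Z' ∈ F, Z ⊆ Z' := by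
  induction F, hF using Set.Finite.induction_on with
  | empty => exact ⟨by simpa using hW, fun Z _ h => Or.inl (by simpa using h)⟩
  | @insert a s ha hs ih =>
    obtain ⟨h1, h2⟩ := ih fun Z hZ => h Z (Or.inr hZ)
    have e : W ∪ ⋃₀ (insert a s) = (W ∪ ⋃₀ s) ∪ a := by
      rw [Set.sUnion_insert, Set.union_assoc, Set.union_comm a]
    rw [e]
    refine ⟨h1.union (h a (Or.inl rfl)).ac, fun Z hZ hs => ?_⟩
    rcases hZ.irr _ _ h1 (h a (Or.inl rfl)).ac hs with h' | h'
    · rcases h2 Z hZ h' with h' | ⟨Z', hZ', h'⟩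
      exacts [Or.inl h', Or.inr ⟨Z', Or.inr hZ', h'⟩]
    · exact Or.inr ⟨a, Or.inl rfl, h'⟩

lemma topo_main {Y Y₁ : Set (Fin N → ℂ)} (hY : AC Y) (hY₁ : AC Y₁) (hs : Y₁ ⊆ Y) (hn : ¬ Y ⊆ Y₁) :
    ∃ n, FD (PV Y₁) n ∧
      (∀ c ∈ Ch (PV Y₁) n, ∀ b ∈ Ch (PV Y) (n+1), bd b = c → ∃ b' ∈ Ch (PV Y₁) (n+1), bd b' = c) ∧
      ∃ c ∈ Ch (PV Y) n, bd c = 0 ∧ ∀ e ∈ Ch (PV Y) (n+1), c - bd e ∉ ChT (PV Y₁) := by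
  obtain ⟨F, hF1, hF2, hF3⟩ := decomp Y hY
  let S : Set (Set (Fin N → ℂ) × Fin N) := {q | q.1 ∈ F ∧ ¬ q.1 ⊆ Y₁ ∧ ∃ z ∈ q.1, z q.2 ≠ 0}
  have hSf : S.Finite := (hF1.prod (Set.finite_univ (α := Fin N))).subset
    fun q hq => ⟨hq.1, Set.mem_univ _⟩
  have hSn : S.Nonempty := by
    have : ∃ Z ∈ F, ¬ Z ⊆ Y₁ := by
      by_contra hcon
      push Not at hcon
      exact hn (by rw [hF3]; exact Set.sUnion_subset hcon)
    obtain ⟨Z, hZ, hZn⟩ := this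
    obtain ⟨i, hi⟩ := exists_coord hY₁ hZn
    exact ⟨(Z, i), hZ, hZn, hi⟩
  obtain ⟨⟨Z₀, i₀⟩, ⟨hZF, hZn, hi₀⟩, hmax⟩ := Set.exists_max_image S (fun q => dm (AI q.1 q.2)) hSf hSn
  simp only at hZF hZn hi₀ hmax
  have hZ₀ := hF2 _ hZF
  have hcov : ∀ Z, Irr Z → Z ⊆ Y → ∃ Z' ∈ F, Z ⊆ Z' := by
    intro Z hZ hZY
    rcases (ac_sUnion ac_zero hF1 hF2).2 Z hZ (hZY.trans (by rw [← hF3]; exact Set.subset_union_right)) with h | h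
    · exact ⟨Z₀, hZF, h.trans (by simpa using hZ₀.ac.zero)⟩
    · exact h
  have hmax' : ∀ Z, Irr Z → Z ⊆ Y → ¬ Z ⊆ Y₁ → ∀ i, (∃ z ∈ Z, z i ≠ 0) →
      dm (AI Z i) ≤ dm (AI Z₀ i₀) := by
    intro Z hZ hZY hZn i hi
    obtain ⟨Z', hZ', hZZ⟩ := hcov Z hZ hZY
    refine (dm_AI_le (hF2 _ hZ') hZ hZZ hi).trans (hmax (Z', i) ⟨hZ', fun h => hZn (hZZ.trans h), ?_⟩)
    obtain ⟨z, hz, h⟩ := hi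
    exact ⟨z, hZZ hz, h⟩
  let F' := {Z | Z ∈ F ∧ ¬ Z₀ ⊆ Z}
  obtain ⟨hY'a, hY'b⟩ := ac_sUnion hY₁ (hF1.subset (fun Z (h : Z ∈ F') => h.1)) (fun Z h => hF2 Z h.1)
  set Y' := Y₁ ∪ ⋃₀ F' with hY'
  have hZY' : ¬ Z₀ ⊆ Y' := by
    intro h
    rcases hY'b Z₀ hZ₀ h with h | ⟨Z, hZ, h⟩
    exacts [hZn h, hZ.2 h]
  have hZ₀Y : Z₀ ⊆ Y := by rw [hF3]; exact Set.subset_sUnion_of_mem hZF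
  have hYeq : Y = Z₀ ∪ Y' := by
    apply Set.Subset.antisymm
    · intro z hz
      rw [hF3] at hz
      obtain ⟨Z, hZ, hz⟩ := hz
      by_cases h : Z₀ ⊆ Z
      · left
        by_contra hzn
        have hlt := dm_AI_lt (hF2 Z hZ) hZ₀ h (fun h' => hzn (h' hz)) hi₀
        obtain ⟨z', hz', hzi⟩ := hi₀
        have := hmax (Z, i₀) ⟨hZ, fun h' => hZn (h.trans h'), z', h hz', hzi⟩
        simp only at this
        omega
      · exact Or.inr (Or.inr ⟨Z, ⟨hZ, h⟩, hz⟩)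
    · refine Set.union_subset hZ₀Y (Set.union_subset hs ?_)
      rw [hF3]
      exact Set.sUnion_subset_sUnion fun Z h => h.1
  obtain ⟨A, hA, hAZ, hWA, hZA, G, p, d, hd0, hG, hC⟩ := struct_pair hZ₀ hi₀ hY'a hZY'
  set k := dm (AI Z₀ i₀) with hk
  have hkey : ∀ x, x ∈ PV Z₀ → x ∈ PV Y' → x ∈ PV A := fun x h h' =>
    PV_mono hWA (by rw [PV_inter hZ₀.ac hY'a]; exact ⟨h, h'⟩)
  have hYY' : Y₁ ⊆ Y' := Set.subset_union_left
  have hv : ∀ i, i + 1 = 2 * k → Van (PV A) i := by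
    intro i hik
    have := vanish (m := k) (n := i) (by omega) A hA {0} ac_zero (by
      intro Z hZ hZA' hZ0 j hj
      refine (dm_AI_lt hZ₀ hZ (hZA'.trans hAZ) (fun h => hZA (h.trans hZA')) hj).trans_le ?_
      obtain ⟨z, hz, hzj⟩ := hj
      exact hmax' Z₀ hZ₀ hZ₀Y hZn j ⟨z, hAZ (hZA' hz), hzj⟩)
    rw [PV_union, PV_zero, Set.empty_union] at this
    exact van_iff_vanRel_empty.2 this
  obtain ⟨c, hc, hbc, hcn⟩ := class_exists (PV_compact hZ₀.ac) (PV_compact hA) (PV_enr hZ₀.ac)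
    (PV_enr hA) (PV_mono hAZ) hC hd0 hG hv
  refine ⟨2 * k, fd_enr (PV_compact hY₁) (PV_enr hY₁) _, ?_, c, Ch_mono (PV_mono hZ₀Y) _ hc, hbc,
    hcn (PV Y) (PV Y₁) (PV_mono hZ₀Y) ?_ ?_⟩
  · have hvan := vanish (m := k + 1) (n := 2 * k + 1) (by omega) Y hY Y₁ hY₁
      (fun Z hZ hZY hZn i hi => Nat.lt_succ_of_le (hmax' Z hZ hZY hZn i hi))
    rw [Set.union_eq_right.2 hs] at hvan
    intro c hc b hb hbc
    obtain ⟨b₂, hb₂, hb₃⟩ := hvan b hb (by rw [hbc]; exact Ch_le_ChT _ _ hc)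
    refine ⟨b - bd b₂, mem_Ch_of_ChT (Submodule.sub_mem _ hb (bd_mem_Ch hb₂)) hb₃, ?_⟩
    rw [map_sub, bd_bd, hbc, sub_zero]
  · refine ⟨(PV A ∪ PV Y')ᶜ, ((PV_compact hA).isClosed.union (PV_compact hY'a).isClosed).isOpen_compl, ?_⟩
    ext x
    have := hkey x
    have hP : x ∈ PV Y ↔ x ∈ PV Z₀ ∨ x ∈ PV Y' := by rw [hYeq, PV_union]; rfl
    simp only [Set.mem_diff, Set.mem_inter_iff, Set.mem_compl_iff, Set.mem_union, hP]
    tauto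
  · intro x hx
    refine ⟨PV_mono hs hx, fun h => h.2 (hkey x h.1 (PV_mono hYY' hx))⟩

end HV

namespace HV

section bridge
variable {X : Type} [TopologicalSpace X] {E : Type} [TopologicalSpace E]

abbrev SXX (X : Type) [TopologicalSpace X] (n : ℕ) : Type :=
  (TopCat.toSSet.obj (TopCat.of X)).obj (Opposite.op (SimplexCategory.mk n))

noncomputable def sq (n : ℕ) : SXX X n ≃ C(stdSimplex ℝ (Fin (n+1)), X) :=
  TopCat.toSSetObjEquiv (TopCat.of X) (Opposite.op (SimplexCategory.mk n))

noncomputable def smp (φ : C(X, E)) (n : ℕ) (s : SXX X n) : Sx E := ⟨n, φ.comp (sq n s)⟩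

noncomputable def iot (φ : C(X, E)) (n : ℕ) : (SXX X n →₀ ℂ) →ₗ[ℂ] Chn E :=
  Finsupp.lmapDomain ℂ ℂ (smp φ n)

noncomputable def iota (φ : C(X, E)) (n : ℕ) : (singularChainComplex X).X n →ₗ[ℂ] Chn E :=
  iot φ n

lemma smp_inj (φ : C(X, E)) (hφ : Function.Injective φ) (n : ℕ) : Function.Injective (smp φ n) := by
  intro s t h
  simp only [smp, Sigma.mk.injEq, heq_eq_eq, true_and] at h
  apply (sq n).injective
  ext x
  exact hφ (DFunLike.congr_fun h x)

lemma iota_inj (φ : C(X, E)) (hφ : Function.Injective φ) (n : ℕ) : Function.Injective (iota φ n) :=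
  Finsupp.mapDomain_injective (smp_inj φ hφ n)

lemma iota_range (φ : C(X, E)) (hφ : Topology.IsEmbedding φ) (n : ℕ) :
    LinearMap.range (iota φ n) = Ch (Set.range φ) n := by
  apply le_antisymm
  · rintro _ ⟨c, rfl⟩
    change Finsupp.mapDomain (smp φ n) c ∈ _
    induction c using Finsupp.induction_linear with
    | zero => simp
    | add f g hf hg => rw [Finsupp.mapDomain_add]; exact Submodule.add_mem _ hf hg
    | single s a =>
      rw [Finsupp.mapDomain_single]
      exact Finsupp.single_mem_supported _ _ ⟨rfl, fun x => ⟨_, rfl⟩⟩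
  · intro c hc
    refine Ch_map LinearMap.id _ ?_ hc
    intro σ hσ
    choose f hf using hσ
    have hfc : Continuous f := by
      rw [hφ.continuous_iff]
      have : (φ ∘ f) = σ := funext hf
      rw [this]; exact σ.continuous
    refine ⟨(Finsupp.single ((sq n).symm ⟨f, hfc⟩) 1 : SXX X n →₀ ℂ), ?_⟩
    change Finsupp.mapDomain (smp φ n) _ = _
    rw [Finsupp.mapDomain_single]
    simp only [smp, Equiv.apply_symm_apply]
    change Finsupp.single _ _ = Finsupp.single _ _
    congr 2
    ext x
    exact hf x

noncomputable abbrev KS (X : Type) [TopologicalSpace X] : SimplicialObject (ModuleCat ℂ) :=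
  ((CategoryTheory.SimplicialObject.whiskering _ _).obj (ModuleCat.free ℂ)).obj
      (TopCat.toSSet.obj (TopCat.of X))

noncomputable def dsx (n : ℕ) (i : Fin (n+2)) (s : SXX X (n+1)) : SXX X n :=
  SimplicialObject.δ (TopCat.toSSet.obj (TopCat.of X)) i s

noncomputable def dl (n : ℕ) (i : Fin (n+2)) : (SXX X (n+1) →₀ ℂ) →ₗ[ℂ] (SXX X n →₀ ℂ) :=
  Finsupp.lmapDomain ℂ ℂ (dsx n i)

noncomputable def Dl (n : ℕ) : (SXX X (n+1) →₀ ℂ) →ₗ[ℂ] (SXX X n →₀ ℂ) :=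
  ∑ i : Fin (n+2), (-1 : ℤ) ^ (i : ℕ) • dl n i

lemma objD_eq (n : ℕ) : ModuleCat.Hom.hom (AlgebraicTopology.AlternatingFaceMapComplex.objD (KS X) n) =
    Dl n := by
  rw [AlgebraicTopology.AlternatingFaceMapComplex.objD, ModuleCat.hom_sum]
  rfl

lemma sq_dsx (n : ℕ) (i : Fin (n+2)) (s : SXX X (n+1)) :
    sq n (dsx n i s) = (sq (n+1) s).comp (fmap i) := by
  ext x
  rfl

lemma iot_single (φ : C(X, E)) (n : ℕ) (s : SXX X n) :
    iot φ n (Finsupp.single s 1) = sx (φ.comp (sq n s)) := Finsupp.mapDomain_single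

lemma iot_d (φ : C(X, E)) (n : ℕ) : (iot φ n) ∘ₗ (Dl n) = bd ∘ₗ iot φ (n+1) := by
  refine Finsupp.lhom_ext' fun s => LinearMap.ext_ring ?_
  simp only [LinearMap.comp_apply, Finsupp.lsingle_apply]
  rw [iot_single, bd_sx_succ, Dl, LinearMap.sum_apply, map_sum]
  refine Finset.sum_congr rfl fun i _ => ?_
  have h1 : dl n i (Finsupp.single s 1) = Finsupp.single (dsx n i s) 1 := Finsupp.mapDomain_single
  rw [LinearMap.smul_apply, map_zsmul, h1, iot_single, sq_dsx]
  rw [← Int.cast_smul_eq_zsmul ℂ]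
  push_cast
  rfl

lemma iota_d (φ : C(X, E)) (n : ℕ) (c : (singularChainComplex X).X (n+1)) :
    iota φ n ((singularChainComplex X).d (n+1) n c) = bd (iota φ (n+1) c) := by
  have hd : (singularChainComplex X).d (n+1) n =
    AlgebraicTopology.AlternatingFaceMapComplex.objD (KS X) n := 
    AlgebraicTopology.AlternatingFaceMapComplex.obj_d_eq (KS X) n
  rw [hd]
  change iota φ n (ModuleCat.Hom.hom (AlgebraicTopology.AlternatingFaceMapComplex.objD (KS X) n) c) = _
  rw [objD_eq]
  exact LinearMap.congr_fun (iot_d φ n) c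

end bridge
end HV

namespace HV

section bridge
variable {X : Type} [TopologicalSpace X] {E : Type} [TopologicalSpace E]

section lin
variable {V W : Type} [AddCommGroup V] [Module ℂ V] [AddCommGroup W] [Module ℂ W]

abbrev HQ (Z B : Submodule ℂ W) : Type := Z ⧸ B.comap Z.subtype

lemma quot_equiv
    (ι : V →ₗ[ℂ] W) (hι : Function.Injective ι) (K : Submodule ℂ V) (R : Submodule ℂ K)
    (Z B : Submodule ℂ W) (hZ : K.map ι = Z) (hB : (R.map K.subtype).map ι = B) :
    Nonempty ((K ⧸ R) ≃ₗ[ℂ] HQ Z B) := by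
  subst hZ hB
  refine ⟨Submodule.Quotient.equiv R _ (Submodule.equivMapOfInjective ι hι K) ?_⟩
  ext ⟨x, hx⟩
  simp only [Submodule.mem_map, Submodule.mem_comap, Submodule.subtype_apply]
  constructor
  · rintro ⟨y, hy, h⟩
    exact ⟨y, ⟨y, hy, rfl⟩, congrArg Subtype.val h⟩
  · rintro ⟨_, ⟨y, hy, rfl⟩, h⟩
    exact ⟨y, hy, Subtype.ext h⟩

lemma HQ_fd {Z B F : Submodule ℂ W} [FiniteDimensional ℂ F] (hB : B ≤ Z)
    (h : ∀ c ∈ Z, ∃ b ∈ B, c - b ∈ F) : FiniteDimensional ℂ (HQ Z B) := by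
  let F' : Submodule ℂ Z := F.comap Z.subtype
  haveI : FiniteDimensional ℂ F' := by
    let f : F' →ₗ[ℂ] F := Z.subtype.restrict (fun x hx => hx)
    refine FiniteDimensional.of_injective f fun x y hxy => ?_
    have h1 : ((x : Z) : W) = ((y : Z) : W) := congrArg (fun t : F => (t : W)) hxy
    exact Subtype.ext (Subtype.ext h1)
  refine Module.Finite.of_surjective
    ((B.comap Z.subtype).mkQ ∘ₗ F'.subtype) fun q => ?_
  obtain ⟨⟨c, hc⟩, rfl⟩ := Submodule.mkQ_surjective _ q
  obtain ⟨b, hb, hcb⟩ := h c hc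
  have hz : c - b ∈ Z := Submodule.sub_mem _ hc (hB hb)
  refine ⟨⟨⟨c - b, hz⟩, hcb⟩, ?_⟩
  refine (Submodule.Quotient.eq _).2 ?_
  change c - b - c ∈ B
  rw [sub_sub_cancel_left]
  exact Submodule.neg_mem _ hb

lemma HQ_not_equiv {Z B Z₁ B₁ : Submodule ℂ W} [FiniteDimensional ℂ (HQ Z₁ B₁)] (hZ : Z₁ ≤ Z)
    (hB : B₁ ≤ B) (hinj : ∀ c ∈ Z₁, c ∈ B → c ∈ B₁)
    (hns : ∃ c ∈ Z, ∀ b ∈ B, c - b ∉ Z₁) (e : HQ Z₁ B₁ ≃ₗ[ℂ] HQ Z B) : False := by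
  let j : HQ Z₁ B₁ →ₗ[ℂ] HQ Z B := Submodule.mapQ _ _ (Submodule.inclusion hZ) (fun x hx => hB hx)
  have hj : Function.Injective j := by
    rw [← LinearMap.ker_eq_bot, LinearMap.ker_eq_bot']
    intro q hq
    obtain ⟨⟨c, hc⟩, rfl⟩ := Submodule.mkQ_surjective _ q
    have h1 := (Submodule.Quotient.mk_eq_zero (B.comap Z.subtype)).1 hq
    exact (Submodule.Quotient.mk_eq_zero _).2 (hinj c hc h1)
  have hsurj : Function.Surjective (e.symm.toLinearMap ∘ₗ j) :=
    LinearMap.injective_iff_surjective.1 (e.symm.injective.comp hj)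
  obtain ⟨c, hc, hn⟩ := hns
  obtain ⟨q, hq⟩ := hsurj (e.symm (Submodule.mkQ _ ⟨c, hc⟩))
  have hq' := e.symm.injective hq
  obtain ⟨⟨c', hc'⟩, rfl⟩ := Submodule.mkQ_surjective _ q
  have h : c' - c ∈ B := (Submodule.Quotient.eq (B.comap Z.subtype)).1 hq'
  refine hn (-(c' - c)) (Submodule.neg_mem _ h) ?_
  rw [sub_neg_eq_add, add_sub_cancel]
  exact hc'

end lin

noncomputable def Zc (S : Set E) (n : ℕ) : Submodule ℂ (Chn E) := Ch S n ⊓ LinearMap.ker bd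
noncomputable def Bc (S : Set E) (n : ℕ) : Submodule ℂ (Chn E) := (Ch S (n+1)).map bd

lemma Bc_le (S : Set E) (n : ℕ) : Bc S n ≤ Zc S n := by
  rintro _ ⟨b, hb, rfl⟩
  exact ⟨bd_mem_Ch hb, bd_bd _⟩

lemma ker_d (φ : C(X, E)) (hφ : Function.Injective φ) (n j : ℕ)
    (hj : j = (ComplexShape.down ℕ).next n) (c : (singularChainComplex X).X n) :
    (singularChainComplex X).d n j c = 0 ↔ bd (iota φ n c) = 0 := by
  cases n with
  | zero =>
    rw [ChainComplex.next_nat_zero] at hj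
    subst hj
    have h0 : (singularChainComplex X).d 0 0 = 0 := HomologicalComplex.shape _ _ _ (by simp)
    rw [h0]
    refine iff_of_true rfl ?_
    have h1 : iota φ 0 c ∈ Ch (Set.univ : Set E) 0 := by
      classical
      change Finsupp.mapDomain (smp φ 0) (c : SXX X 0 →₀ ℂ) ∈ _
      refine (Finsupp.mem_supported _ _).2 ?_
      intro p hp
      obtain ⟨s, -, rfl⟩ := Finset.mem_image.1 (Finsupp.mapDomain_support hp)
      exact ⟨rfl, fun _ => trivial⟩
    exact bd_Ch_zero h1
  | succ n =>
    rw [ChainComplex.next_nat_succ] at hj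
    subst hj
    rw [← iota_d]
    exact ((iota_inj φ hφ _).eq_iff' (map_zero _)).symm

lemma range_d (φ : C(X, E)) (hφ : Topology.IsEmbedding φ) (n j : ℕ)
    (hj : j = n + 1) (x : Chn E) :
    (∃ c, iota φ n ((singularChainComplex X).d j n c) = x) ↔ x ∈ Bc (Set.range φ) n := by
  subst hj
  simp only [iota_d, Bc, Submodule.mem_map]
  rw [← iota_range φ hφ]
  simp

theorem homology_equiv (φ : C(X, E)) (hφ : Topology.IsEmbedding φ) (n : ℕ) :
    Nonempty (singularHomology X n ≃ₗ[ℂ] HQ (Zc (Set.range φ) n) (Bc (Set.range φ) n)) := by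
  let S := (singularChainComplex X).sc n
  have e1 : singularHomology X n ≃ₗ[ℂ] (LinearMap.ker S.g.hom ⧸ LinearMap.range S.moduleCatToCycles) :=
    S.moduleCatHomologyIso.toLinearEquiv
  obtain ⟨e2⟩ := quot_equiv (iota φ n) (iota_inj φ hφ.injective n) (LinearMap.ker S.g.hom)
    (LinearMap.range S.moduleCatToCycles) (Zc (Set.range φ) n) (Bc (Set.range φ) n) (by
      ext x
      rw [Zc, ← iota_range φ hφ]
      simp only [Submodule.mem_map, Submodule.mem_inf, LinearMap.mem_ker, LinearMap.mem_range]
      constructor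
      · rintro ⟨c, hc, rfl⟩
        exact ⟨⟨c, rfl⟩, (ker_d φ hφ.injective n _ rfl c).1 hc⟩
      · rintro ⟨⟨c, rfl⟩, hc⟩
        exact ⟨c, (ker_d φ hφ.injective n _ rfl c).2 hc, rfl⟩) (by
      ext x
      rw [← range_d φ hφ n _ (ChainComplex.prev ℕ n)]
      simp only [Submodule.mem_map, LinearMap.mem_range]
      constructor
      · rintro ⟨_, ⟨_, ⟨c, rfl⟩, rfl⟩, rfl⟩
        exact ⟨c, rfl⟩
      · rintro ⟨c, rfl⟩
        exact ⟨_, ⟨_, ⟨c, rfl⟩, rfl⟩, rfl⟩)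
  exact ⟨e1.trans e2⟩

lemma Hc_not_equiv {S S₁ : Set E} {n : ℕ} (hs : S₁ ⊆ S) (hfd : FD S₁ n)
    (hinj : ∀ c ∈ Ch S₁ n, ∀ b ∈ Ch S (n+1), bd b = c → ∃ b' ∈ Ch S₁ (n+1), bd b' = c)
    (hns : ∃ c ∈ Ch S n, bd c = 0 ∧ ∀ e ∈ Ch S (n+1), c - bd e ∉ ChT S₁)
    (e : HQ (Zc S₁ n) (Bc S₁ n) ≃ₗ[ℂ] HQ (Zc S n) (Bc S n)) : False := by
  obtain ⟨F, hF, h⟩ := hfd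
  haveI := HQ_fd (F := F) (Bc_le S₁ n) (by
    intro c hc
    obtain ⟨b, hb, h⟩ := h c hc.1 hc.2
    exact ⟨bd b, ⟨b, hb, rfl⟩, h⟩)
  refine HQ_not_equiv (Z := Zc S n) (B := Bc S n) (Z₁ := Zc S₁ n) (B₁ := Bc S₁ n) (inf_le_inf_right _ (Ch_mono hs n)) (Submodule.map_mono (Ch_mono hs _)) ?_ ?_ e
  · rintro c hc ⟨b, hb, hbc⟩
    obtain ⟨b', hb', h⟩ := hinj c hc.1 b hb hbc
    exact ⟨b', hb', h⟩
  · obtain ⟨c, hc, hbc, hn⟩ := hns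
    refine ⟨c, ⟨hc, hbc⟩, ?_⟩
    rintro _ ⟨b, hb, rfl⟩ h
    exact hn b hb (Ch_le_ChT _ _ h.1)

end bridge
end HV

namespace HV
variable {N : ℕ}

noncomputable def Phi (x : ProjSpace N) : EI N → ℝ := Psi x.rep

lemma Phi_mk (v : Fin N → ℂ) (hv : v ≠ 0) : Phi (Projectivization.mk ℂ v hv) = Psi v := by
  obtain ⟨a, ha⟩ := Projectivization.exists_smul_eq_mk_rep ℂ v hv
  rw [Phi, ← ha]
  exact Psi_smul v a.ne_zero

noncomputable def pmk (v : {v : Fin N → ℂ // v ≠ 0}) : ProjSpace N := Projectivization.mk ℂ v.1 v.2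

lemma pmk_cont : Continuous (pmk (N := N)) :=
  (isQuotientMap_quotient_mk' : Topology.IsQuotientMap (pmk (N := N))).continuous

lemma Phi_cont : Continuous (Phi (N := N)) := by
  have hq : Topology.IsQuotientMap (pmk (N := N)) := isQuotientMap_quotient_mk'
  rw [hq.continuous_iff]
  have : (Phi ∘ pmk (N := N)) = fun v => Psi v.1 := by
    funext v
    exact Phi_mk v.1 v.2
  rw [this]
  exact continuousOn_iff_continuous_restrict.1 continuousOn_Psi

lemma Phi_inj : Function.Injective (Phi (N := N)) := by
  intro x y h
  obtain ⟨l, hl, h'⟩ := Psi_inj x.rep_nonzero y.rep_nonzero h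
  rw [← x.mk_rep, ← y.mk_rep]
  rw [Projectivization.mk_eq_mk_iff']
  exact ⟨l⁻¹, by rw [h', smul_smul, inv_mul_cancel₀ hl, one_smul]⟩

def KY (Y : Set (ProjSpace N)) : Set (Fin N → ℂ) := {z | ∀ h : z ≠ 0, Projectivization.mk ℂ z h ∈ Y}

lemma Phi_image (Y : Set (ProjSpace N)) : Phi '' Y = PV (KY Y) := by
  ext x
  constructor
  · rintro ⟨y, hy, rfl⟩
    exact ⟨y.rep, y.rep_nonzero, fun h => by rwa [Projectivization.mk_rep], rfl⟩
  · rintro ⟨z, hz, hzK, rfl⟩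
    exact ⟨_, hzK hz, Phi_mk z hz⟩

lemma hom_eval {p : MvPolynomial (Fin N) ℂ} {d : ℕ} (hp : p.IsHomogeneous d) (l : ℂ) (z : Fin N → ℂ) :
    eval (l • z) p = l ^ d * eval z p := by
  rw [eval_eq, eval_eq, Finset.mul_sum]
  refine Finset.sum_congr rfl fun m hm => ?_
  have hd : m.degree = d := by
    have := hp (mem_support_iff.1 hm)
    rw [Finsupp.degree_eq_weight_one]; exact this
  have : ∏ i ∈ m.support, (l • z) i ^ m i = l ^ d * ∏ i ∈ m.support, z i ^ m i := by
    simp only [Pi.smul_apply, smul_eq_mul, mul_pow, Finset.prod_mul_distrib,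
      Finset.prod_pow_eq_pow_sum]
    rw [← hd]
    rfl
  rw [this]
  ring

lemma KY_ac {Y : Set (ProjSpace N)} (hY : IsAlgebraicSubset Y) : AC (KY Y) := by
  classical
  obtain ⟨P, hP, rfl⟩ := hY
  refine ⟨fun h => absurd rfl h, ?_, ?_⟩
  · intro z hz l hlz
    have hl : l ≠ 0 := by rintro rfl; simp at hlz
    have hz0 : z ≠ 0 := by rintro rfl; simp at hlz
    have : Projectivization.mk ℂ (l • z) hlz = Projectivization.mk ℂ z hz0 := by
      rw [Projectivization.mk_eq_mk_iff']
      exact ⟨l, rfl⟩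
    rw [this]
    exact hz hz0
  · obtain ⟨T, hT1, hT2⟩ := exists_finset_zero {q : MvPolynomial (Fin N) ℂ | ∃ p ∈ P, ∃ j, q = X j * p}
    refine ⟨T, ?_⟩
    have hiff : ∀ z : Fin N → ℂ, ∀ hz : z ≠ 0, ∀ p ∈ P,
        (eval (Projectivization.mk ℂ z hz).rep p = 0 ↔ eval z p = 0) := by
      intro z hz p hp
      obtain ⟨d, hd⟩ := hP p hp
      obtain ⟨a, ha⟩ := Projectivization.exists_smul_eq_mk_rep ℂ z hz
      rw [← ha]
      have : eval (a • z) p = (a : ℂ) ^ d * eval z p := hom_eval hd _ _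
      rw [this]
      simp
    ext z
    constructor
    · intro hz q hq
      obtain ⟨p, hp, j, rfl⟩ := hT1 hq
      by_cases h0 : z = 0
      · subst h0; simp
      · rw [map_mul, (hiff z h0 p hp).1 (hz h0 p hp), mul_zero]
    · intro hz h0 p hp
      rw [hiff z h0 p hp]
      obtain ⟨j, hj⟩ := Function.ne_iff.1 h0
      have := hT2 z hz _ ⟨p, hp, j, rfl⟩
      rw [map_mul, eval_X] at this
      exact (mul_eq_zero.1 this).resolve_left hj

lemma KY_subset {Y Y' : Set (ProjSpace N)} (h : KY Y ⊆ KY Y') : Y ⊆ Y' := by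
  intro y hy
  have := h (show y.rep ∈ KY Y from fun h => by rwa [Projectivization.mk_rep]) y.rep_nonzero
  rwa [Projectivization.mk_rep] at this

lemma KY_mono {Y Y' : Set (ProjSpace N)} (h : Y ⊆ Y') : KY Y ⊆ KY Y' :=
  fun z hz h0 => h (hz h0)

lemma proj_compact : CompactSpace (ProjSpace N) := by
  have hS : IsCompact (Metric.sphere (0 : Fin N → ℂ) 1) := isCompact_sphere _ _
  haveI : CompactSpace (Metric.sphere (0 : Fin N → ℂ) 1) := isCompact_iff_compactSpace.1 hS
  have hne : ∀ v : Metric.sphere (0 : Fin N → ℂ) 1, (v : Fin N → ℂ) ≠ 0 := by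
    intro v h
    have := v.2
    rw [h] at this
    simp at this
  let g : Metric.sphere (0 : Fin N → ℂ) 1 → ProjSpace N := fun v => pmk ⟨v.1, hne v⟩
  have hg : Continuous g := pmk_cont.comp (continuous_subtype_val.subtype_mk _)
  have hs : Function.Surjective g := by
    intro x
    have hx := x.rep_nonzero
    have hn : ‖x.rep‖ ≠ 0 := norm_ne_zero_iff.2 hx
    have h1 : ((‖x.rep‖⁻¹ : ℝ) : ℂ) • x.rep ∈ Metric.sphere (0 : Fin N → ℂ) 1 := by
      rw [mem_sphere_zero_iff_norm, norm_smul, Complex.norm_real, norm_inv, norm_norm,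
        inv_mul_cancel₀ hn]
    refine ⟨⟨_, h1⟩, ?_⟩
    conv_rhs => rw [← x.mk_rep]
    show Projectivization.mk ℂ _ _ = _
    rw [Projectivization.mk_eq_mk_iff']
    exact ⟨_, rfl⟩
  exact ⟨by rw [← hs.range_eq]; exact isCompact_range hg⟩

lemma Phi_emb : Topology.IsEmbedding (Phi (N := N)) := by
  haveI := proj_compact (N := N)
  exact (Phi_cont.isClosedEmbedding Phi_inj).isEmbedding

lemma hom_equiv_PV (Y : Set (ProjSpace N)) (n : ℕ) :
    Nonempty (singularHomology ↥Y n ≃ₗ[ℂ] HQ (Zc (PV (KY Y)) n) (Bc (PV (KY Y)) n)) := by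
  have hr : Set.range (fun y : Y => Phi (y : ProjSpace N)) = PV (KY Y) := by
    rw [← Phi_image, Set.image_eq_range]
  have h := homology_equiv (⟨fun y : Y => Phi (y : ProjSpace N), Phi_cont.comp continuous_subtype_val⟩ : C(Y, EI N → ℝ))
    (Phi_emb.comp Topology.IsEmbedding.subtypeVal) n
  have hr' : Set.range (⟨fun y : Y => Phi (y : ProjSpace N), Phi_cont.comp continuous_subtype_val⟩ : C(Y, EI N → ℝ)) = PV (KY Y) := hr
  rw [hr'] at h
  exact h

theorem core {Y Y₁ : Set (ProjSpace N)} (hY : IsAlgebraicSubset Y) (hY₁ : IsAlgebraicSubset Y₁)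
    (hs : Y₁ ⊆ Y) (hne : Y₁ ≠ Y) :
    ¬ ∀ n : ℕ, Nonempty (singularHomology ↥Y₁ n ≅ singularHomology ↥Y n) := by
  intro H
  obtain ⟨n, hfd, hinj, hns⟩ := topo_main (KY_ac hY) (KY_ac hY₁) (KY_mono hs)
    (fun h => hne (hs.antisymm (KY_subset h)))
  obtain ⟨i⟩ := H n
  obtain ⟨e⟩ := hom_equiv_PV Y n
  obtain ⟨e₁⟩ := hom_equiv_PV Y₁ n
  exact Hc_not_equiv (PV_mono (KY_mono hs)) hfd hinj hns ((e₁.symm.trans i.toLinearEquiv).trans e)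

end HV

/-- If a complex projective variety `Y` is the union of two proper
non-empty closed subvarieties `Y₁` and `Y₂`, then neither `Y₁` nor `Y₂` has the same
additive singular homology (with `ℂ`-coefficients, in all degrees simultaneously)
as `Y`. -/
theorem homology_ne_of_union_of_proper_subvarieties {N : ℕ}
    (Y Y₁ Y₂ : Set (ProjSpace N)) (hY : IsAlgebraicSubset Y)
    (hY₁ : IsAlgebraicSubset Y₁) (hY₂ : IsAlgebraicSubset Y₂)
    (hunion : Y = Y₁ ∪ Y₂)
    (hne₁ : Y₁.Nonempty) (hne₂ : Y₂.Nonempty)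
    (hprop₁ : Y₁ ≠ Y) (hprop₂ : Y₂ ≠ Y) :
    (¬ ∀ n : ℕ, Nonempty (singularHomology ↥Y₁ n ≅ singularHomology ↥Y n)) ∧
    (¬ ∀ n : ℕ, Nonempty (singularHomology ↥Y₂ n ≅ singularHomology ↥Y n)) := by
  exact ⟨HV.core hY hY₁ (hunion ▸ Set.subset_union_left) hprop₁,
    HV.core hY hY₂ (hunion ▸ Set.subset_union_right) hprop₂⟩
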